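/- arXiv:2005.05291 — 2 statements merged into one kernel-verified Lean document; each statement's English description precedes it below -/
import Mathlib

section
/- (Vicinity Theorem.) Let k ≥ 2, 1 ≤ d ≤ k−1 and δ > 0. If δ has the (k,d)-Hamilton-vicinity property, then δ has the (k,d)-Hamilton-framework property. (Consequently the Hamilton framework threshold is at most the Hamilton vicinity threshold: hf_d(k) ≤ hv_d(k).) -/
open Finset

variable {A : Type*} [DecidableEq A]

/-- The set of vertices occupying positions `i, …, i+k-1` of the walk `w`. -/
def walkEdgeAt (k : ℕ) (w : List A) (i : ℕ) : Finset A :=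
  ((w.drop i).take k).toFinset

/-- `w` is a tight walk in the `k`-graph with edge set `E`: it has at least `k`
vertices and every `k` consecutive vertices form an edge of `E`. -/
def IsTightWalk (k : ℕ) (E : Finset (Finset A)) (w : List A) : Prop :=
  k ≤ w.length ∧ ∀ i, i + k ≤ w.length → walkEdgeAt k w i ∈ E

/-- The edge `e` appears on the walk `w` (as `k` consecutive vertices). -/
def EdgeOnWalk (k : ℕ) (w : List A) (e : Finset A) : Prop :=
  ∃ i, i + k ≤ w.length ∧ walkEdgeAt k w i = e

/-- A `k`-uniform edge set is tightly connected if any two of its edges lie on a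
common tight walk all of whose edges belong to it. -/
def TightlyConnected (k : ℕ) (E : Finset (Finset A)) : Prop :=
  ∀ e₁ ∈ E, ∀ e₂ ∈ E, ∃ w : List A, IsTightWalk k E w ∧ EdgeOnWalk k w e₁ ∧ EdgeOnWalk k w e₂

/-- `w` is a closed tight walk: every cyclic interval of `k` consecutive vertices
forms an edge of `E`.  Its length is `w.length`. -/
def IsClosedTightWalk (k : ℕ) (E : Finset (Finset A)) (w : List A) : Prop :=
  k ≤ w.length ∧ ∀ i < w.length, ((w.rotate i).take k).toFinset ∈ E

/-- A tight Hamilton cycle: a cyclic ordering of all the vertices in which every `k`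
cyclically consecutive vertices form an edge. -/
def HasTightHamCycle (k : ℕ) (V : Finset A) (E : Finset (Finset A)) : Prop :=
  ∃ w : List A, w.Nodup ∧ w.toFinset = V ∧ IsClosedTightWalk k E w

/-- The `j`-th shadow: all `j`-element sets contained in some edge. -/
def shadow (j : ℕ) (E : Finset (Finset A)) : Finset (Finset A) :=
  E.biUnion fun e => e.powersetCard j

/-- The link graph of `S`: the `(k-d)`-graph whose edges are `e \ S` for edges `e ⊇ S`. -/
def link (S : Finset A) (E : Finset (Finset A)) : Finset (Finset A) :=
  (E.filter fun e => S ⊆ e).image fun e => e \ S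

/-- `E` has a fractional matching of size at least `m`. -/
def HasFracMatching (E : Finset (Finset A)) (m : ℝ) : Prop :=
  ∃ w : Finset A → ℝ,
    (∀ e ∈ E, 0 ≤ w e ∧ w e ≤ 1) ∧
    (∀ v : A, ∑ e ∈ E.filter (fun e' => v ∈ e'), w e ≤ 1) ∧
    m ≤ ∑ e ∈ E, w e

/-- `E` has a `b`-fractional matching of size at least `m` (vertex constraints on `V`). -/
def HasBFracMatching (V : Finset A) (E : Finset (Finset A)) (b : A → ℝ) (m : ℝ) : Prop :=
  ∃ w : Finset A → ℝ,
    (∀ e ∈ E, 0 ≤ w e ∧ w e ≤ 1) ∧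
    (∀ v ∈ V, ∑ e ∈ E.filter (fun e' => v ∈ e'), w e ≤ b v) ∧
    m ≤ ∑ e ∈ E, w e

/-- `γ`-robustly matchable: every vertex weighting with values in `[1-γ,1]` is realised
exactly by an edge weighting with values in `[0,1]`. -/
def RobustlyMatchable (γ : ℝ) (V : Finset A) (E : Finset (Finset A)) : Prop :=
  ∀ b : A → ℝ, (∀ v ∈ V, 1 - γ ≤ b v ∧ b v ≤ 1) →
    ∃ w : Finset A → ℝ, (∀ e ∈ E, 0 ≤ w e ∧ w e ≤ 1) ∧
      ∀ v ∈ V, ∑ e ∈ E.filter (fun e' => v ∈ e'), w e = b v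

/-- A switcher: an edge `e` with a central vertex `a` such that for every `b ∈ e`
there is `c ∉ e` with `(e ∪ {c}) \ {a}` and `(e ∪ {c}) \ {b}` both edges. -/
def HasSwitcher (C : Finset (Finset A)) : Prop :=
  ∃ e ∈ C, ∃ a ∈ e, ∀ b ∈ e, ∃ c, c ∉ e ∧
    insert c (e.erase a) ∈ C ∧ insert c (e.erase b) ∈ C

/-- An arc for the `d`-vicinity `C` of the `k`-graph with edge set `E`: a tuple of
`k+1` distinct vertices `v₁, …, v_{k+1}` with `{v₁,…,v_d} ∈ ∂_d`,
`{v_{d+1},…,v_k} ∈ C {v₁,…,v_d}`, `{v₂,…,v_{d+1}} ∈ ∂_d` and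
`{v_{d+2},…,v_{k+1}} ∈ C {v₂,…,v_{d+1}}`. -/
def HasArc (k d : ℕ) (E : Finset (Finset A)) (C : Finset A → Finset (Finset A)) : Prop :=
  ∃ l : List A, l.length = k + 1 ∧ l.Nodup ∧
    (l.take d).toFinset ∈ shadow d E ∧
    ((l.drop d).take (k - d)).toFinset ∈ C ((l.take d).toFinset) ∧
    ((l.drop 1).take d).toFinset ∈ shadow d E ∧
    (l.drop (d + 1)).toFinset ∈ C (((l.drop 1).take d).toFinset)

/-- The `k`-graph generated by a `d`-vicinity: all sets `B ∪ S` with `S ∈ ∂_d(E)`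
and `B ∈ C S`. -/
def generatedEdges (d : ℕ) (E : Finset (Finset A)) (C : Finset A → Finset (Finset A)) :
    Finset (Finset A) :=
  (shadow d E).biUnion fun S => (C S).image fun B => B ∪ S

/-- `α`-perturbed minimum relative `d`-degree at least `δ` for a `k`-graph on vertex
set `V` with edge set `E`. -/
def PerturbedDegLB (k d : ℕ) (a δ : ℝ) (V : Finset A) (E : Finset (Finset A)) : Prop :=
  ∀ j : ℕ, 1 ≤ j → j ≤ d →
    (∀ S ∈ shadow j E,
      δ * (((V.card - j).choose (k - j) : ℕ) : ℝ) ≤ ((E.filter fun e => S ⊆ e).card : ℝ)) ∧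
    ((((V.powersetCard j).filter fun S => S ∉ shadow j E).card : ℝ)
        ≤ a * ((V.card.choose j : ℕ) : ℝ)) ∧
    (∀ T : Finset A, (T ∈ shadow (j - 1) E ∨ (j = 1 ∧ T = ∅)) →
      ((((V.powersetCard j).filter fun S => T ⊆ S ∧ S ∉ shadow j E).card : ℝ)
        < a * ((V.card : ℝ) - (j : ℝ) + 1)))

/-- A `(γ, δ)`-Hamilton `d`-vicinity of a `k`-graph on `t = V.card` vertices. -/
def IsHamVicinity (k d : ℕ) (γ δ : ℝ) (V : Finset A) (E : Finset (Finset A))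
    (C : Finset A → Finset (Finset A)) : Prop :=
  (∀ S ∈ shadow d E, C S ⊆ link S E) ∧
  (∀ S ∈ shadow d E, TightlyConnected (k - d) (C S)) ∧
  (∀ S ∈ shadow d E, ∀ S' ∈ shadow d E, (C S ∩ C S').Nonempty) ∧
  (∀ S ∈ shadow d E, HasSwitcher (C S)) ∧
  HasArc k d E C ∧
  (∀ S ∈ shadow d E, HasFracMatching (C S) ((1 / (k : ℝ) + γ) * (V.card : ℝ))) ∧
  (∀ S ∈ shadow d E, (1 - δ + γ) * ((V.card.choose (k - d) : ℕ) : ℝ) ≤ ((C S).card : ℝ))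

/-- An `(a, γ, δ)`-Hamilton framework: a subgraph on vertex set `VH` with edge set `EH`
of a `k`-graph on vertex set `VR`, satisfying (F1)–(F5). -/
def IsHamFramework (k : ℕ) (a γ δ : ℝ) (VR VH : Finset A) (EH : Finset (Finset A)) : Prop :=
  (1 - a) * (VR.card : ℝ) ≤ (VH.card : ℝ) ∧
  TightlyConnected k EH ∧
  (∃ w : List A, IsClosedTightWalk k EH w ∧ w.length % k = 1 % k) ∧
  RobustlyMatchable γ VH EH ∧
  (∀ v ∈ VH, (1 - δ + γ) * (((VH.card - 1).choose (k - 1) : ℕ) : ℝ)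
      ≤ ((EH.filter fun e => v ∈ e).card : ℝ))

/-- A tight component: an edge-maximal tightly connected subgraph. -/
def IsTightComponent (k : ℕ) (E C : Finset (Finset A)) : Prop :=
  C ⊆ E ∧ TightlyConnected k C ∧
    ∀ C' : Finset (Finset A), C ⊆ C' → C' ⊆ E → TightlyConnected k C' → C' = C

/-- `δ` has the `(k,d)`-Hamilton-cycle property. -/
def HamCycleProp (k d : ℕ) (δ : ℝ) : Prop :=
  ∀ μ : ℝ, 0 < μ → ∃ n₀ : ℕ, ∀ (B : Type) [DecidableEq B],
    ∀ (V : Finset B) (E : Finset (Finset B)),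
      n₀ ≤ V.card → (∀ e ∈ E, e ⊆ V ∧ e.card = k) →
      (∀ S ⊆ V, S.card = d →
        (δ + μ) * (((V.card - d).choose (k - d) : ℕ) : ℝ)
          ≤ ((E.filter fun e => S ⊆ e).card : ℝ)) →
      HasTightHamCycle k V E

/-- `δ` has the `(k,d)`-Hamilton-framework property. -/
def HamFrameworkProp (k d : ℕ) (δ : ℝ) : Prop :=
  ∀ μ : ℝ, 0 < μ → ∃ γ₀ : ℝ, 0 < γ₀ ∧ ∀ γ : ℝ, 0 < γ → γ ≤ γ₀ →
    ∃ α₀ : ℝ, 0 < α₀ ∧ ∀ a : ℝ, 0 < a → a ≤ α₀ →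
      ∃ ε₀ : ℝ, 0 < ε₀ ∧ ∀ ε : ℝ, 0 < ε → ε ≤ ε₀ →
        ∃ t₀ : ℕ, ∀ t : ℕ, t₀ ≤ t →
          ∀ (B : Type) [DecidableEq B], ∀ (VR : Finset B) (ER : Finset (Finset B)),
            VR.card = t → (∀ e ∈ ER, e ⊆ VR ∧ e.card = k) →
            (∀ S ⊆ VR, S.card = d →
              (δ + μ) * (((t - d).choose (k - d) : ℕ) : ℝ)
                ≤ ((ER.filter fun e => S ⊆ e).card : ℝ)) →
            ∀ I : Finset (Finset B), I ⊆ ER → (I.card : ℝ) ≤ ε * ((t.choose k : ℕ) : ℝ) →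
              ∃ (VH : Finset B) (EH : Finset (Finset B)),
                VH ⊆ VR ∧ EH ⊆ ER ∧ (∀ e ∈ EH, e ⊆ VH) ∧ (∀ e ∈ EH, e ∉ I) ∧
                IsHamFramework k a γ δ VR VH EH

/-- `δ` has the `(k,d)`-Hamilton-vicinity property. -/
def HamVicinityProp (k d : ℕ) (δ : ℝ) : Prop :=
  ∀ μ : ℝ, 0 < μ → ∃ γ₀ : ℝ, 0 < γ₀ ∧ ∀ γ : ℝ, 0 < γ → γ ≤ γ₀ →
    ∃ α₀ : ℝ, 0 < α₀ ∧ ∀ a : ℝ, 0 < a → a ≤ α₀ →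
      ∃ t₀ : ℕ, ∀ t : ℕ, t₀ ≤ t →
        ∀ (B : Type) [DecidableEq B], ∀ (V : Finset B) (E : Finset (Finset B)),
          V.card = t → (∀ e ∈ E, e ⊆ V ∧ e.card = k) →
          PerturbedDegLB k d a (δ + μ) V E →
          (∀ v ∈ V, ∃ e ∈ E, v ∈ e) →
          ∃ C : Finset B → Finset (Finset B), IsHamVicinity k d γ δ V E C

/-- One-coordinate change between two labelled edges. -/
def VAdj {ι : Type*} [Fintype ι] (E : Finset (Finset A)) (f g : ι → A) : Prop :=
  univ.image f ∈ E ∧ univ.image g ∈ E ∧ ∃ p, ∀ q, q ≠ p → f q = g q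

/-- Reachability by one-coordinate changes. -/
def VReach {ι : Type*} [Fintype ι] (E : Finset (Finset A)) (f g : ι → A) : Prop :=
  Relation.ReflTransGen (VAdj E) f g

lemma VAdj.symm' {ι : Type*} [Fintype ι] {E : Finset (Finset A)} {f g : ι → A}
    (h : VAdj E f g) : VAdj E g f := by
  obtain ⟨h1, h2, p, hp⟩ := h
  exact ⟨h2, h1, p, fun q hq => (hp q hq).symm⟩

lemma VReach.symm' {ι : Type*} [Fintype ι] {E : Finset (Finset A)} {f g : ι → A}
    (h : VReach E f g) : VReach E g f := by
  induction h with
  | refl => exact Relation.ReflTransGen.refl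
  | tail _ h2 ih => exact Relation.ReflTransGen.head (VAdj.symm' h2) ih

lemma VReach.trans' {ι : Type*} [Fintype ι] {E : Finset (Finset A)} {f g h : ι → A}
    (h1 : VReach E f g) (h2 : VReach E g h) : VReach E f h :=
  Relation.ReflTransGen.trans h1 h2

lemma inj_of_image_mem {n : ℕ} {C : Finset (Finset A)} (hC : ∀ e ∈ C, e.card = n)
    {f : Fin n → A} (h : univ.image f ∈ C) : Function.Injective f := by
  have := hC _ h
  have h2 : (univ.image f).card = (univ : Finset (Fin n)).card := by simpa using this
  have := Finset.card_image_iff.1 h2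
  simpa [Set.injOn_univ] using this

lemma image_update_inj {ι : Type*} [Fintype ι] [DecidableEq ι] {f : ι → A}
    (hf : Function.Injective f) (p : ι) (x : A) :
    univ.image (Function.update f p x) = insert x ((univ.image f).erase (f p)) := by
  ext y
  simp only [mem_image, mem_univ, true_and, mem_insert, mem_erase]
  constructor
  · rintro ⟨q, rfl⟩
    by_cases h : q = p
    · subst h; simp
    · right
      rw [Function.update_of_ne h]
      exact ⟨fun hh => h (hf hh), q, rfl⟩
  · rintro (rfl | ⟨h, q, rfl⟩)
    · exact ⟨p, by simp⟩
    · refine ⟨q, Function.update_of_ne ?_ _ _⟩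
      rintro rfl; exact h rfl

lemma vadj_update {ι : Type*} [Fintype ι] [DecidableEq ι] {E : Finset (Finset A)} {f : ι → A}
    (h : univ.image f ∈ E) (p : ι) (x : A) (h' : univ.image (Function.update f p x) ∈ E) :
    VAdj E f (Function.update f p x) :=
  ⟨h, h', p, fun q hq => by rw [Function.update_of_ne hq]⟩

lemma step_common {n : ℕ} {C : Finset (Finset A)} (hC : ∀ e ∈ C, e.card = n)
    {f : Fin n → A} {a x : A} {M : Finset A} (hM : M.card < n)
    (hf : univ.image f = insert a M) (he : insert a M ∈ C) (hx : insert x M ∈ C) :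
    ∃ g : Fin n → A, univ.image g = insert x M ∧ VReach C f g := by
  have ha : a ∉ M := by
    intro h
    have := hC _ he
    rw [insert_eq_of_mem h] at this
    omega
  have hfC : univ.image f ∈ C := by rw [hf]; exact he
  have hinj := inj_of_image_mem hC hfC
  obtain ⟨p, -, hp⟩ := mem_image.1 (show a ∈ univ.image f by rw [hf]; simp)
  have : univ.image (Function.update f p x) = insert x M := by
    rw [image_update_inj hinj, hf, hp, erase_insert ha]
  refine ⟨Function.update f p x, this, Relation.ReflTransGen.single (vadj_update hfC p x ?_)⟩
  rw [this]; exact hx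

lemma walk_succ {n : ℕ} (w : List A) (i : ℕ) (h : i + 1 + (n + 1) ≤ w.length) :
    ∃ a x M, M.card < n + 1 ∧ walkEdgeAt (n + 1) w i = insert a M ∧
      walkEdgeAt (n + 1) w (i + 1) = insert x M := by
  refine ⟨w[i], w[i + 1 + n], ((w.drop (i + 1)).take n).toFinset, ?_, ?_, ?_⟩
  · refine lt_of_le_of_lt (List.toFinset_card_le _) ?_
    simp
  · unfold walkEdgeAt
    rw [List.drop_eq_getElem_cons (by omega), List.take_succ_cons, List.toFinset_cons]
  · unfold walkEdgeAt
    rw [List.take_add_one, List.toFinset_append]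
    rw [List.getElem?_drop, List.getElem?_eq_getElem (by omega)]
    ext y; simp [or_comm]

lemma link_move {n : ℕ} {C : Finset (Finset A)} (hC : ∀ e ∈ C, e.card = n + 1)
    (hT : TightlyConnected (n + 1) C) {e e' : Finset A} (he : e ∈ C) (he' : e' ∈ C)
    {f : Fin (n + 1) → A} (hf : univ.image f = e) :
    ∃ g : Fin (n + 1) → A, univ.image g = e' ∧ VReach C f g := by
  obtain ⟨w, ⟨-, hw⟩, ⟨i, hi, rfl⟩, ⟨j, hj, rfl⟩⟩ := hT e he e' he'
  have up : ∀ m i, i + m + (n + 1) ≤ w.length → ∀ f : Fin (n + 1) → A,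
      univ.image f = walkEdgeAt (n + 1) w i →
      ∃ g : Fin (n + 1) → A, univ.image g = walkEdgeAt (n + 1) w (i + m) ∧ VReach C f g := by
    intro m
    induction m with
    | zero => intro i _ f hf; exact ⟨f, hf, Relation.ReflTransGen.refl⟩
    | succ m ih =>
      intro i hi f hf
      obtain ⟨g, hg, hr⟩ := ih i (by omega) f hf
      obtain ⟨a, x, M, hM, h1, h2⟩ := walk_succ (n := n) w (i + m) (by omega)
      obtain ⟨g', hg', hr'⟩ := step_common hC hM (hg.trans h1) (h1 ▸ hw _ (by omega))
        (h2 ▸ hw _ (by omega))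
      exact ⟨g', by rw [hg', ← h2]; rfl, hr.trans' hr'⟩
  have down : ∀ m i, i + m + (n + 1) ≤ w.length → ∀ f : Fin (n + 1) → A,
      univ.image f = walkEdgeAt (n + 1) w (i + m) →
      ∃ g : Fin (n + 1) → A, univ.image g = walkEdgeAt (n + 1) w i ∧ VReach C f g := by
    intro m
    induction m with
    | zero => intro i _ f hf; exact ⟨f, hf, Relation.ReflTransGen.refl⟩
    | succ m ih =>
      intro i hi f hf
      obtain ⟨a, x, M, hM, h1, h2⟩ := walk_succ (n := n) w (i + m) (by omega)
      obtain ⟨g', hg', hr'⟩ := step_common hC hM (hf.trans h2) (h2 ▸ hw _ (by omega))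
        (h1 ▸ hw _ (by omega))
      obtain ⟨g, hg, hr⟩ := ih i (by omega) g' (hg'.trans h1.symm)
      exact ⟨g, hg, hr'.trans' hr⟩
  rcases le_total i j with h | h
  · obtain ⟨m, rfl⟩ := Nat.exists_eq_add_of_le h
    exact up m i hj f hf
  · obtain ⟨m, rfl⟩ := Nat.exists_eq_add_of_le h
    exact down m j hi f hf

lemma image_comp_perm {ι : Type*} [Fintype ι] (f : ι → A) (π : Equiv.Perm ι) :
    univ.image (f ∘ π) = univ.image f := by
  ext y
  simp only [mem_image, mem_univ, true_and, Function.comp]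
  constructor
  · rintro ⟨q, rfl⟩; exact ⟨_, rfl⟩
  · rintro ⟨q, rfl⟩; exact ⟨π.symm q, by simp⟩

lemma switch_swap {n : ℕ} {C : Finset (Finset A)} (hC : ∀ e ∈ C, e.card = n)
    {e : Finset A} (he : e ∈ C) {a : A}
    (hs : ∀ b ∈ e, ∃ c, c ∉ e ∧ insert c (e.erase a) ∈ C ∧ insert c (e.erase b) ∈ C)
    {f : Fin n → A} (hf : univ.image f = e) (p q : Fin n) (hp : f p = a) :
    VReach C f (f ∘ Equiv.swap p q) := by
  by_cases hpq : p = q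
  · subst hpq; simp; exact Relation.ReflTransGen.refl
  have hfC : univ.image f ∈ C := by rw [hf]; exact he
  have hinj := inj_of_image_mem hC hfC
  have hfa : ∀ r, f r ∈ e := fun r => by rw [← hf]; simp
  obtain ⟨c, hc, h1, h2⟩ := hs (f q) (hfa q)
  have hab : a ≠ f q := by rw [← hp]; exact fun h => hpq (hinj h)
  have i1 : univ.image (Function.update f p c) = insert c (e.erase a) := by
    rw [image_update_inj hinj, hf, hp]
  have m1 : univ.image (Function.update f p c) ∈ C := i1 ▸ h1
  have inj1 := inj_of_image_mem hC m1
  have i2 : univ.image (Function.update (Function.update f p c) q a) = insert c (e.erase (f q)) := by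
    rw [image_update_inj inj1, i1, Function.update_of_ne (Ne.symm hpq)]
    have ha : a ∈ e := hp ▸ hfa p
    have hcq : c ≠ f q := fun h => hc (h ▸ hfa q)
    ext y
    simp only [mem_insert, mem_erase]
    by_cases hya : y = a
    · subst hya; simp [hab, ha]
    · by_cases hyc : y = c
      · subst hyc; simp [hcq]
      · simp [hya, hyc]
  have m2 : univ.image (Function.update (Function.update f p c) q a) ∈ C := i2 ▸ h2
  have e3 : Function.update (Function.update (Function.update f p c) q a) p (f q)
      = f ∘ Equiv.swap p q := by
    funext r
    by_cases hrp : r = p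
    · subst hrp; simp
    · rw [Function.update_of_ne hrp]
      by_cases hrq : r = q
      · subst hrq; simp [hp]
      · rw [Function.update_of_ne hrq, Function.update_of_ne hrp]
        simp [Equiv.swap_apply_of_ne_of_ne hrp hrq]
  have m3 : univ.image (Function.update (Function.update (Function.update f p c) q a) p (f q)) ∈ C := by
    rw [e3, image_comp_perm, hf]; exact he
  have r1 := vadj_update hfC p c m1
  have r2 := vadj_update m1 q a m2
  have r3 := vadj_update m2 p (f q) m3
  rw [e3] at r3
  exact ((Relation.ReflTransGen.single r1).tail r2).tail r3

lemma switch_perm {n : ℕ} {C : Finset (Finset A)} (hC : ∀ e ∈ C, e.card = n)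
    {e : Finset A} (he : e ∈ C) {a : A} (ha : a ∈ e)
    (hs : ∀ b ∈ e, ∃ c, c ∉ e ∧ insert c (e.erase a) ∈ C ∧ insert c (e.erase b) ∈ C)
    (π : Equiv.Perm (Fin n)) :
    ∀ {f : Fin n → A}, univ.image f = e → VReach C f (f ∘ π) := by
  have key : ∀ {f : Fin n → A}, univ.image f = e → ∀ p q,
      VReach C f (f ∘ Equiv.swap p q) := by
    intro f hf p q
    obtain ⟨r, -, hr⟩ := mem_image.1 (show a ∈ univ.image f by rw [hf]; exact ha)
    by_cases hrp : r = p
    · subst hrp; exact switch_swap hC he hs hf _ _ hr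
    by_cases hrq : r = q
    · subst hrq; rw [Equiv.swap_comm]; exact switch_swap hC he hs hf _ _ hr
    by_cases hpq : p = q
    · subst hpq; simp; exact Relation.ReflTransGen.refl
    have s1 := switch_swap hC he hs hf r p hr
    have s2 := switch_swap hC he hs (f := f ∘ Equiv.swap r p)
      (by rw [image_comp_perm, hf]) p q (by simp [hr])
    have s3 := switch_swap hC he hs (f := (f ∘ Equiv.swap r p) ∘ Equiv.swap p q)
      (by rw [image_comp_perm, image_comp_perm, hf]) q r (by simp [hr])
    have : ((f ∘ Equiv.swap r p) ∘ Equiv.swap p q) ∘ Equiv.swap q r = f ∘ Equiv.swap p q := by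
      funext x
      simp only [Function.comp, Equiv.swap_apply_def]
      congr 1
      grind
    rw [this] at s3
    exact (s1.trans' s2).trans' s3
  induction π using Equiv.Perm.swap_induction_on with
  | one => intro f _; exact Relation.ReflTransGen.refl
  | swap_mul π x y hxy ih =>
    intro f hf
    have := ih (f := f ∘ Equiv.swap x y) (by rw [image_comp_perm, hf])
    exact (key hf x y).trans' this

lemma exists_perm_of_image_eq {n : ℕ} {f g : Fin n → A} (hf : Function.Injective f)
    (hg : Function.Injective g) (h : univ.image f = univ.image g) :
    ∃ π : Equiv.Perm (Fin n), g = f ∘ π := by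
  have : ∀ i, ∃ j, f j = g i := fun i => by
    have : g i ∈ univ.image f := by rw [h]; simp
    simpa using this
  choose π hπ using this
  have hinj : Function.Injective π := fun i j hij => hg (by rw [← hπ, ← hπ, hij])
  refine ⟨Equiv.ofBijective π ((Fintype.bijective_iff_injective_and_card π).2 ⟨hinj, rfl⟩), ?_⟩
  funext i; simp [hπ]

lemma link_connected {n : ℕ} {C : Finset (Finset A)} (hC : ∀ e ∈ C, e.card = n + 1)
    (hT : TightlyConnected (n + 1) C) (hS : HasSwitcher C) {f g : Fin (n + 1) → A}
    (hf : univ.image f ∈ C) (hg : univ.image g ∈ C) : VReach C f g := by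
  obtain ⟨e, he, a, ha, hs⟩ := hS
  obtain ⟨f', hf', hr⟩ := link_move hC hT hf he rfl
  obtain ⟨g', hg', hr'⟩ := link_move hC hT hg he rfl
  obtain ⟨π, hπ⟩ := exists_perm_of_image_eq (inj_of_image_mem hC (hf'.symm ▸ he))
    (inj_of_image_mem hC (hg'.symm ▸ he)) (hf'.trans hg'.symm)
  have := switch_perm hC he ha hs π hf'
  rw [← hπ] at this
  exact (hr.trans' this).trans' hr'.symm'

lemma shadow_connected {d : ℕ} {C : Finset (Finset A)} (hC : ∀ e ∈ C, e.card = d)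
    (hext : ∀ S ∈ C, ∀ s ∈ S, ∀ S' ∈ C, ∀ s' ∈ S', ∃ x, insert x (S.erase s) ∈ C ∧
      insert x (S'.erase s') ∈ C) :
    ∀ (m : ℕ) (f g : Fin d → A), (univ.filter fun i => f i ≠ g i).card = m →
      univ.image f ∈ C → univ.image g ∈ C → VReach C f g := by
  intro m
  induction m with
  | zero =>
    intro f g h _ _
    have : f = g := by
      funext i
      rw [card_eq_zero, filter_eq_empty_iff] at h
      simpa using h (mem_univ i)
    rw [this]; exact Relation.ReflTransGen.refl
  | succ m ih =>
    intro f g h hf hg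
    obtain ⟨p, hp⟩ := card_pos.1 (show 0 < (univ.filter fun i => f i ≠ g i).card by omega)
    obtain ⟨x, h1, h2⟩ := hext _ hf (f p) (by simp) _ hg (g p) (by simp)
    rw [← image_update_inj (inj_of_image_mem hC hf)] at h1
    rw [← image_update_inj (inj_of_image_mem hC hg)] at h2
    have r1 := vadj_update hf p x h1
    have r2 := (vadj_update hg p x h2).symm'
    have := ih (Function.update f p x) (Function.update g p x) (by
      have e : (univ.filter fun i => Function.update f p x i ≠ Function.update g p x i)
          = (univ.filter fun i => f i ≠ g i).erase p := by
        ext i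
        by_cases hi : i = p
        · subst hi; simp
        · simp [hi]
      rw [e, card_erase_of_mem hp, h]; rfl) h1 h2
    exact (Relation.ReflTransGen.head r1 this).tail r2

lemma image_sum_elim {ι κ : Type*} [Fintype ι] [Fintype κ] (f : ι → A) (g : κ → A) :
    univ.image (Sum.elim f g) = univ.image g ∪ univ.image f := by
  ext y; simp [or_comm]

lemma mem_generated {d : ℕ} {E : Finset (Finset A)} {C : Finset A → Finset (Finset A)}
    {S B : Finset A} (hS : S ∈ shadow d E) (hB : B ∈ C S) : B ∪ S ∈ generatedEdges d E C := by
  unfold generatedEdges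
  exact mem_biUnion.2 ⟨S, hS, mem_image.2 ⟨B, hB, rfl⟩⟩

lemma exists_labelling {n : ℕ} {e : Finset A} (h : e.card = n) :
    ∃ f : Fin n → A, univ.image f = e := by
  refine ⟨fun i => (e.equivFinOfCardEq h).symm i, ?_⟩
  ext y
  simp only [mem_image, mem_univ, true_and]
  constructor
  · rintro ⟨i, rfl⟩; exact ((e.equivFinOfCardEq h).symm i).2
  · intro hy; exact ⟨e.equivFinOfCardEq h ⟨y, hy⟩, by simp⟩

lemma card_of_mem_shadow {d : ℕ} {E : Finset (Finset A)} {S : Finset A} (h : S ∈ shadow d E) :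
    S.card = d := by
  unfold _root_.shadow at h
  obtain ⟨e, _, he⟩ := mem_biUnion.1 h
  exact (mem_powersetCard.1 he).2

lemma gen_connected {d n : ℕ} {E : Finset (Finset A)} {C : Finset A → Finset (Finset A)}
    (hC : ∀ S ∈ shadow d E, ∀ e ∈ C S, e.card = n + 1)
    (hT : ∀ S ∈ shadow d E, TightlyConnected (n + 1) (C S))
    (hint : ∀ S ∈ shadow d E, ∀ S' ∈ shadow d E, (C S ∩ C S').Nonempty)
    (hsw : ∀ S ∈ shadow d E, HasSwitcher (C S))
    (hext : ∀ S ∈ shadow d E, ∀ s ∈ S, ∀ S' ∈ shadow d E, ∀ s' ∈ S',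
      ∃ x, insert x (S.erase s) ∈ shadow d E ∧ insert x (S'.erase s') ∈ shadow d E)
    {σ σ' : Fin d → A} {τ τ' : Fin (n + 1) → A}
    (hσ : univ.image σ ∈ shadow d E) (hσ' : univ.image σ' ∈ shadow d E)
    (hτ : univ.image τ ∈ C (univ.image σ)) (hτ' : univ.image τ' ∈ C (univ.image σ')) :
    VReach (generatedEdges d E C) (Sum.elim σ τ) (Sum.elim σ' τ') := by
  have fix : ∀ σ : Fin d → A, univ.image σ ∈ shadow d E → ∀ τ τ' : Fin (n + 1) → A,
      univ.image τ ∈ C (univ.image σ) → univ.image τ' ∈ C (univ.image σ) →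
      VReach (generatedEdges d E C) (Sum.elim σ τ) (Sum.elim σ τ') := by
    intro σ hσ τ τ' hτ hτ'
    have := link_connected (hC _ hσ) (hT _ hσ) (hsw _ hσ) hτ hτ'
    refine Relation.ReflTransGen.lift (r := VAdj (C (univ.image σ))) (fun τ => Sum.elim σ τ) ?_ _ _ this
    rintro a b ⟨h1, h2, p, hp⟩
    refine ⟨?_, ?_, Sum.inr p, ?_⟩
    · rw [image_sum_elim]; exact mem_generated hσ h1
    · rw [image_sum_elim]; exact mem_generated hσ h2
    · rintro (q | q) hq
      · rfl
      · exact hp q (fun h => hq (by rw [h]))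
  have hr := shadow_connected (fun e he => card_of_mem_shadow he) hext _ σ σ' rfl hσ hσ'
  have main : ∀ σ', VReach (shadow d E) σ σ' → ∀ τ', univ.image τ' ∈ C (univ.image σ') →
      VReach (generatedEdges d E C) (Sum.elim σ τ) (Sum.elim σ' τ') := by
    intro σ' h
    induction h with
    | refl => intro τ' hτ'; exact fix σ hσ τ τ' hτ hτ'
    | tail hab hbc ih =>
      rename_i b c
      intro τ' hτ'
      obtain ⟨h1, h2, p, hp⟩ := hbc
      obtain ⟨B, hB⟩ := hint _ h1 _ h2
      rw [mem_inter] at hB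
      obtain ⟨τ0, hτ0⟩ := exists_labelling (hC _ h1 B hB.1)
      have r1 := ih τ0 (hτ0 ▸ hB.1)
      have r3 := fix c h2 τ0 τ' (hτ0 ▸ hB.2) hτ'
      have r2 : VAdj (generatedEdges d E C) (Sum.elim b τ0) (Sum.elim c τ0) := by
        refine ⟨?_, ?_, Sum.inl p, ?_⟩
        · rw [image_sum_elim, hτ0]; exact mem_generated h1 hB.1
        · rw [image_sum_elim, hτ0]; exact mem_generated h2 hB.2
        · rintro (q | q) hq
          · exact hp q (fun h => hq (by rw [h]))
          · rfl
      exact VReach.trans' (Relation.ReflTransGen.tail r1 r2) r3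
  exact main σ' hr τ' hτ'

lemma image_comp_equiv {ι κ : Type*} [Fintype ι] [Fintype κ] (f : ι → A) (π : κ ≃ ι) :
    univ.image (f ∘ π) = univ.image f := by
  ext y
  simp only [mem_image, mem_univ, true_and, Function.comp]
  constructor
  · rintro ⟨q, rfl⟩; exact ⟨_, rfl⟩
  · rintro ⟨q, rfl⟩; exact ⟨π.symm q, by simp⟩

lemma VReach.comp_equiv {ι κ : Type*} [Fintype ι] [Fintype κ] {E : Finset (Finset A)}
    {f g : ι → A} (h : VReach E f g) (π : κ ≃ ι) : VReach E (f ∘ π) (g ∘ π) := by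
  refine Relation.ReflTransGen.lift (r := VAdj E) (fun f : ι → A => (f ∘ π : κ → A)) ?_ _ _ h
  rintro a b ⟨h1, h2, p, hp⟩
  refine ⟨by rwa [image_comp_equiv], by rwa [image_comp_equiv], π.symm p, fun q hq => hp _ ?_⟩
  rintro rfl; simp at hq

lemma VReach.exists_chain {k : ℕ} {E : Finset (Finset A)} {f g : Fin k → A} (h : VReach E f g)
    (hk : 0 < k) (hf : univ.image f ∈ E) :
    ∃ (m : ℕ) (c : ℕ → Fin k → A), c 0 = f ∧ (∀ q, m ≤ q → c q = g) ∧
      ∀ q, VAdj E (c q) (c (q + 1)) := by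
  induction h with
  | refl => exact ⟨0, fun _ => f, rfl, fun _ _ => rfl, fun _ => ⟨hf, hf, ⟨0, hk⟩, fun _ _ => rfl⟩⟩
  | tail hab hbc ih =>
    rename_i b g
    obtain ⟨m, c, h0, hm, hc⟩ := ih
    refine ⟨m + 1, fun q => if q ≤ m then c q else g, by simp [h0], ?_, ?_⟩
    · intro q hq; simp; omega
    · intro q
      rcases lt_trichotomy q m with h | h | h
      · simp only [h.le, Nat.succ_le_of_lt h, if_true]; exact hc q
      · subst h; simp; rw [hm q le_rfl]; exact hbc
      · have h1 : ¬ q ≤ m := by omega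
        have h2 : ¬ q + 1 ≤ m := by omega
        simp only [h1, h2, if_false]
        exact ⟨hbc.2.1, hbc.2.1, ⟨0, hk⟩, fun _ _ => rfl⟩

lemma image_mod {k : ℕ} (hk : 0 < k) (g : Fin k → A) (n : ℕ) :
    (range k).image (fun i => g ⟨(n + i) % k, Nat.mod_lt _ hk⟩) = univ.image g := by
  ext y
  simp only [mem_image, mem_univ, true_and, mem_range]
  constructor
  · rintro ⟨i, _, rfl⟩; exact ⟨_, rfl⟩
  · rintro ⟨⟨j, hj⟩, rfl⟩
    refine ⟨(j + (k - n % k)) % k, Nat.mod_lt _ hk, ?_⟩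
    congr 2
    have h1 := Nat.mod_lt n hk
    have h2 : (n + (j + (k - n % k)) % k) % k = (n % k + (j + (k - n % k))) % k := by
      simp [Nat.add_mod]
    rw [h2, show n % k + (j + (k - n % k)) = j + k by omega]
    simp [Nat.mod_eq_of_lt hj]

/-- The infinite walk written by a chain of labelled edges. -/
def chainWalk {k : ℕ} (hk : 0 < k) (c : ℕ → Fin k → A) (n : ℕ) : A :=
  c (n / k) ⟨n % k, Nat.mod_lt _ hk⟩

lemma div_mod_aux {n k q r : ℕ} (hr : r < k) (h : n = q * k + r) : n / k = q ∧ n % k = r :=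
  (Nat.div_mod_unique (by omega)).2 ⟨by rw [h]; ring, hr⟩

lemma chain_window {k : ℕ} (hk : 0 < k) {E : Finset (Finset A)} {c : ℕ → Fin k → A}
    (hc : ∀ q, VAdj E (c q) (c (q + 1))) (n : ℕ) :
    (range k).image (fun i => chainWalk hk c (n + i)) ∈ E := by
  obtain ⟨h1, h2, p, hp⟩ := hc (n / k)
  have hn := Nat.div_add_mod n k
  have hr := Nat.mod_lt n hk
  by_cases hpr : (p : ℕ) < n % k
  · have : (range k).image (fun i => chainWalk hk c (n + i))
      = (range k).image (fun i => c (n / k + 1) ⟨(n + i) % k, Nat.mod_lt _ hk⟩) := by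
      refine image_congr ?_
      intro i hi
      simp only [coe_range, Set.mem_Iio] at hi
      unfold chainWalk
      by_cases hlt : n % k + i < k
      · have e1 : (n + i) / k = n / k :=
          (div_mod_aux hlt (by rw [mul_comm]; omega)).1
        have e2 : (n + i) % k = n % k + i := by
          rw [Nat.add_mod, Nat.mod_eq_of_lt hi, Nat.mod_eq_of_lt hlt]
        simp only [e1]
        refine hp _ ?_
        intro h
        have := congrArg Fin.val h
        simp only [e2] at this
        omega
      · have e1 : (n + i) / k = n / k + 1 :=
          (div_mod_aux (r := n % k + i - k) (by omega) (by rw [add_mul, mul_comm (n / k)]; omega)).1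
        simp only [e1]
    rw [this, image_mod hk]; exact h2
  · have : (range k).image (fun i => chainWalk hk c (n + i))
      = (range k).image (fun i => c (n / k) ⟨(n + i) % k, Nat.mod_lt _ hk⟩) := by
      refine image_congr ?_
      intro i hi
      simp only [coe_range, Set.mem_Iio] at hi
      unfold chainWalk
      by_cases hlt : n % k + i < k
      · have e1 : (n + i) / k = n / k :=
          (div_mod_aux hlt (by rw [mul_comm]; omega)).1
        simp only [e1]
      · have e1 : (n + i) / k = n / k + 1 :=
          (div_mod_aux (r := n % k + i - k) (by omega) (by rw [add_mul, mul_comm (n / k)]; omega)).1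
        have e2 : (n + i) % k = n % k + i - k := by
          rw [Nat.add_mod, Nat.mod_eq_of_lt hi, Nat.mod_eq_sub_mod (by omega), Nat.mod_eq_of_lt (by omega)]
        simp only [e1]
        refine (hp _ ?_).symm
        intro h
        have := congrArg Fin.val h
        simp only [e2] at this
        omega
    rw [this, image_mod hk]; exact h1

lemma take_drop_map_range (W : ℕ → A) (N i k : ℕ) (h : i + k ≤ N) :
    ((((List.range N).map W).drop i).take k).toFinset = (range k).image (fun j => W (i + j)) := by
  have : (((List.range N).map W).drop i).take k = (List.range k).map (fun j => W (i + j)) := by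
    apply List.ext_getElem
    · simp; omega
    · intro j h1 h2; simp
  rw [this]
  ext y; simp

lemma walk_of_reach {k : ℕ} (hk : 0 < k) {E : Finset (Finset A)} {f g : Fin k → A}
    (h : VReach E f g) (hf : univ.image f ∈ E) :
    ∃ w : List A, IsTightWalk k E w ∧ EdgeOnWalk k w (univ.image f) ∧
      EdgeOnWalk k w (univ.image g) := by
  obtain ⟨m, c, h0, hm, hc⟩ := h.exists_chain hk hf
  have hW : ∀ q, (range k).image (fun j => chainWalk hk c (q * k + j)) = univ.image (c q) := by
    intro q
    rw [← image_mod hk (c q) (q * k)]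
    refine image_congr ?_
    intro i hi
    simp only [coe_range, Set.mem_Iio] at hi
    unfold chainWalk
    have : (q * k + i) / k = q := (div_mod_aux hi rfl).1
    simp only [this]
  have hlen : ((List.range (m * k + k)).map (chainWalk hk c)).length = m * k + k := by simp
  refine ⟨(List.range (m * k + k)).map (chainWalk hk c), ⟨by simp, ?_⟩, ⟨0, by simp, ?_⟩,
    ⟨m * k, by simp, ?_⟩⟩
  · intro i hi
    rw [hlen] at hi
    unfold walkEdgeAt
    rw [take_drop_map_range _ _ _ _ hi]
    exact chain_window hk hc i
  · unfold walkEdgeAt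
    rw [take_drop_map_range _ _ _ _ (by omega), ← h0, ← hW 0]
    simp
  · unfold walkEdgeAt
    rw [take_drop_map_range _ _ _ _ (by omega), ← hm m le_rfl, ← hW m]

lemma closed_walk_of_reach {k : ℕ} (hk : 2 ≤ k) {E : Finset (Finset A)} {f g : Fin k → A}
    (h : VReach E f g) (hf : univ.image f ∈ E)
    (hg : ∀ i (hi : i + 1 < k), g ⟨i + 1, hi⟩ = f ⟨i, by omega⟩)
    (hg0 : g ⟨0, by omega⟩ = f ⟨k - 1, by omega⟩) :
    ∃ w : List A, IsClosedTightWalk k E w ∧ w.length % k = 1 % k := by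
  have hk0 : 0 < k := by omega
  obtain ⟨m, c, h0, hm, hc⟩ := h.exists_chain hk0 hf
  set W := chainWalk hk0 c with hWdef
  have hL : ((List.range ((m + 1) * k + 1)).map W).length = (m + 1) * k + 1 := by simp
  have hper : ∀ i, i < k → W ((m + 1) * k + 1 + i) = W i := by
    intro i hi
    have r1 : W i = f ⟨i, hi⟩ := by
      simp [hWdef, chainWalk, Nat.div_eq_of_lt hi, Nat.mod_eq_of_lt hi, h0]
    rw [r1]
    by_cases hik : i + 1 < k
    · have e1 : ((m + 1) * k + 1 + i) / k = m + 1 :=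
        (div_mod_aux (q := m + 1) hik (by ring)).1
      have e2 : ((m + 1) * k + 1 + i) % k = i + 1 :=
        (div_mod_aux (q := m + 1) hik (by ring)).2
      simp only [hWdef, chainWalk, e1, e2, hm (m + 1) (by omega)]
      exact hg i hik
    · have hi' : i = k - 1 := by omega
      have e0 : (m + 1) * k + 1 + i = (m + 2) * k := by
        have : (m + 2) * k = (m + 1) * k + k := by ring
        omega
      rw [e0]
      have e1 : ((m + 2) * k) / k = m + 2 := Nat.mul_div_cancel _ hk0
      have e2 : ((m + 2) * k) % k = 0 := by simp
      simp only [hWdef, chainWalk, e1, e2, hm (m + 2) (by omega)]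
      subst hi'
      exact hg0
  refine ⟨(List.range ((m + 1) * k + 1)).map W, ⟨?_, ?_⟩, ?_⟩
  · rw [hL]; nlinarith
  · intro i hi
    rw [hL] at hi
    have : (((List.range ((m + 1) * k + 1)).map W).rotate i).take k
        = (List.range k).map (fun j => W (i + j)) := by
      apply List.ext_getElem
      · simp; nlinarith
      · intro j h1 h2
        have hj : j < k := by simpa using h2
        simp only [List.getElem_take, List.getElem_rotate, List.getElem_map, List.getElem_range,
          List.length_map, List.length_range]
        by_cases hlt : j + i < (m + 1) * k + 1
        · rw [Nat.mod_eq_of_lt hlt, add_comm]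
        · have hkm : k ≤ (m + 1) * k := by nlinarith
          rw [Nat.mod_eq_sub_mod (by omega), Nat.mod_eq_of_lt (by omega)]
          rw [← hper (j + i - ((m + 1) * k + 1)) (by omega)]
          congr 1; omega
    rw [this]
    have h2 := chain_window hk0 hc i
    have e : ((List.range k).map (fun j => W (i + j))).toFinset
        = (range k).image (fun j => W (i + j)) := by ext y; simp
    rw [e]; exact h2
  · rw [hL]; simp [Nat.add_mod]

lemma gen_tight {d n : ℕ} {E : Finset (Finset A)} {C : Finset A → Finset (Finset A)}
    (hC : ∀ S ∈ shadow d E, ∀ e ∈ C S, e.card = n + 1)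
    (hT : ∀ S ∈ shadow d E, TightlyConnected (n + 1) (C S))
    (hint : ∀ S ∈ shadow d E, ∀ S' ∈ shadow d E, (C S ∩ C S').Nonempty)
    (hsw : ∀ S ∈ shadow d E, HasSwitcher (C S))
    (hext : ∀ S ∈ shadow d E, ∀ s ∈ S, ∀ S' ∈ shadow d E, ∀ s' ∈ S',
      ∃ x, insert x (S.erase s) ∈ shadow d E ∧ insert x (S'.erase s') ∈ shadow d E) :
    TightlyConnected (d + (n + 1)) (generatedEdges d E C) := by
  have lab : ∀ e ∈ generatedEdges d E C, ∃ (σ : Fin d → A) (τ : Fin (n + 1) → A),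
      univ.image σ ∈ shadow d E ∧ univ.image τ ∈ C (univ.image σ) ∧
      univ.image (Sum.elim σ τ) = e := by
    intro e he
    unfold generatedEdges at he
    obtain ⟨S, hS, h2⟩ := mem_biUnion.1 he
    obtain ⟨B, hB, rfl⟩ := mem_image.1 h2
    obtain ⟨σ, hσ⟩ := exists_labelling (card_of_mem_shadow hS)
    obtain ⟨τ, hτ⟩ := exists_labelling (hC S hS B hB)
    refine ⟨σ, τ, hσ ▸ hS, ?_, ?_⟩
    · rw [hσ, hτ]; exact hB
    · rw [image_sum_elim, hσ, hτ]
  intro e₁ h₁ e₂ h₂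
  obtain ⟨σ, τ, a1, a2, a3⟩ := lab e₁ h₁
  obtain ⟨σ', τ', b1, b2, b3⟩ := lab e₂ h₂
  have := (gen_connected hC hT hint hsw hext a1 b1 a2 b2).comp_equiv
    (finSumFinEquiv (m := d) (n := n + 1)).symm
  obtain ⟨w, h1, h2, h3⟩ := walk_of_reach (by omega) this (by
    rw [image_comp_equiv, a3]; exact h₁)
  rw [image_comp_equiv, a3] at h2
  rw [image_comp_equiv, b3] at h3
  exact ⟨w, h1, h2, h3⟩

lemma gen_closed {d n : ℕ} (hd : 1 ≤ d) {E : Finset (Finset A)} {C : Finset A → Finset (Finset A)}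
    (hC : ∀ S ∈ shadow d E, ∀ e ∈ C S, e.card = n + 1)
    (hT : ∀ S ∈ shadow d E, TightlyConnected (n + 1) (C S))
    (hint : ∀ S ∈ shadow d E, ∀ S' ∈ shadow d E, (C S ∩ C S').Nonempty)
    (hsw : ∀ S ∈ shadow d E, HasSwitcher (C S))
    (hext : ∀ S ∈ shadow d E, ∀ s ∈ S, ∀ S' ∈ shadow d E, ∀ s' ∈ S',
      ∃ x, insert x (S.erase s) ∈ shadow d E ∧ insert x (S'.erase s') ∈ shadow d E)
    (harc : HasArc (d + (n + 1)) d E C) :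
    ∃ w : List A, IsClosedTightWalk (d + (n + 1)) (generatedEdges d E C) w ∧
      w.length % (d + (n + 1)) = 1 % (d + (n + 1)) := by
  obtain ⟨l, hl, -, h1, h2, h3, h4⟩ := harc
  have key : ∀ (i m : ℕ) (h : i + m ≤ l.length),
      ((l.drop i).take m).toFinset = univ.image (fun j : Fin m => l[i + j]) := by
    intro i m h
    have : (l.drop i).take m = List.ofFn (fun j : Fin m => l[i + j]) := by
      apply List.ext_getElem
      · simp; omega
      · intro j h1 h2; simp
    rw [this]; ext y; simp [List.mem_ofFn]
  have e1 : (l.take d).toFinset = univ.image (fun j : Fin d => l[(j : ℕ)]) := by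
    have := key 0 d (by omega)
    simpa using this
  have e2 : ((l.drop d).take (d + (n + 1) - d)).toFinset
      = univ.image (fun j : Fin (n + 1) => l[d + (j : ℕ)]) := by
    rw [Nat.add_sub_cancel_left]; exact key d (n + 1) (by omega)
  have e3 : ((l.drop 1).take d).toFinset = univ.image (fun j : Fin d => l[1 + (j : ℕ)]) :=
    key 1 d (by omega)
  have e4 : (l.drop (d + 1)).toFinset
      = univ.image (fun j : Fin (n + 1) => l[d + 1 + (j : ℕ)]) := by
    rw [← key (d + 1) (n + 1) (by omega), List.take_of_length_le (by simp; omega)]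
  rw [e1] at h1 h2
  rw [e2] at h2
  rw [e3] at h3 h4
  rw [e4] at h4
  have hr := gen_connected hC hT hint hsw hext h3 h1 h4 h2
  have hkk : d + (n + 1) = (d + n) + 1 := by omega
  let u : Fin (d + (n + 1)) → A := fun x => l[(x : ℕ)]
  let u' : Fin (d + (n + 1)) → A := fun x => l[(x : ℕ) + 1]
  have hu : Sum.elim (fun j : Fin d => l[(j : ℕ)]) (fun j : Fin (n + 1) => l[d + (j : ℕ)])
      = u ∘ finSumFinEquiv := by
    funext x; rcases x with x | x <;> simp [u]
  have hu' : Sum.elim (fun j : Fin d => l[1 + (j : ℕ)]) (fun j : Fin (n + 1) => l[d + 1 + (j : ℕ)])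
      = u' ∘ finSumFinEquiv := by
    funext x; rcases x with x | x
    · simp [u', add_comm]
    · simp only [u', Sum.elim_inr, Function.comp, finSumFinEquiv_apply_right, Fin.val_natAdd]
      congr 1; omega
  have hm : univ.image u ∈ generatedEdges d E C := by
    have := mem_generated h1 h2
    rwa [← image_sum_elim, hu, image_comp_equiv] at this
  have hm' : univ.image u' ∈ generatedEdges d E C := by
    have := mem_generated h3 h4
    rwa [← image_sum_elim, hu', image_comp_equiv] at this
  rw [hu, hu'] at hr
  have hr2 := (hr.comp_equiv (finSumFinEquiv (m := d) (n := n + 1)).symm).comp_equiv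
    (finRotate (d + (n + 1))).symm
  have s1 : (u ∘ (finSumFinEquiv (m := d) (n := n + 1))) ∘ (finSumFinEquiv (m := d) (n := n + 1)).symm
    = u := by funext x; simp
  have s2 : (u' ∘ (finSumFinEquiv (m := d) (n := n + 1))) ∘ (finSumFinEquiv (m := d) (n := n + 1)).symm
    = u' := by funext x; simp
  rw [s1, s2] at hr2
  have hadj : VAdj (generatedEdges d E C) u (u' ∘ (finRotate (d + (n + 1))).symm) := by
    refine ⟨hm, by rwa [image_comp_equiv], ⟨0, by omega⟩, ?_⟩
    intro q hq
    have hq' : q ≠ 0 := hq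
    have := coe_finRotate_symm_of_ne_zero hq'
    have h0 : (q : ℕ) ≠ 0 := fun h => hq (Fin.ext h)
    simp only [u, u', Function.comp]
    congr 1
    omega
  have hfin : VReach (generatedEdges d E C) u (u ∘ (finRotate (d + (n + 1))).symm) :=
    Relation.ReflTransGen.head hadj hr2
  refine closed_walk_of_reach (by omega) hfin hm ?_ ?_
  · intro i hi
    have hq' : (⟨i + 1, hi⟩ : Fin (d + (n + 1))) ≠ 0 := by
      intro h; have := congrArg Fin.val h; simp at this
    have := coe_finRotate_symm_of_ne_zero hq'
    simp only [u, Function.comp]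
    congr 1
  · have : (finRotate (d + (n + 1))).symm ⟨0, by omega⟩ = ⟨d + (n + 1) - 1, by omega⟩ := by
      rw [Equiv.symm_apply_eq]
      exact (finRotate_last' (n := d + n)).symm
    simp only [Function.comp, this]

/-- Separation: if no functional strictly separates, then `b` is realised. -/
lemma realise_of_no_sep {V : Finset A} {E : Finset (Finset A)} (b : A → ℝ)
    (h : ∀ y : A → ℝ, ∃ w : Finset A → ℝ, (∀ e ∈ E, 0 ≤ w e ∧ w e ≤ 1) ∧
      ∑ v ∈ V, y v * ∑ e ∈ E.filter (fun e' => v ∈ e'), w e ≤ ∑ v ∈ V, y v * b v) :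
    ∃ w : Finset A → ℝ, (∀ e ∈ E, 0 ≤ w e ∧ w e ≤ 1) ∧
      ∀ v ∈ V, ∑ e ∈ E.filter (fun e' => v ∈ e'), w e = b v := by
  classical
  let Φ : (E → ℝ) →ₗ[ℝ] (V → ℝ) :=
    { toFun := fun w v => ∑ e : E, if (v : A) ∈ (e : Finset A) then w e else 0
      map_add' := by
        intro w w'; funext v
        simp only [Pi.add_apply, ← sum_add_distrib]
        refine sum_congr rfl fun e _ => ?_
        split_ifs <;> simp
      map_smul' := by
        intro c w; funext v
        simp only [Pi.smul_apply, smul_eq_mul, RingHom.id_apply, mul_sum]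
        refine sum_congr rfl fun e _ => ?_
        split_ifs <;> simp }
  let K : Set (E → ℝ) := Set.Icc 0 1
  have hΦ : ∀ (w : Finset A → ℝ) (v : V),
      Φ (fun e => w e) v = ∑ e ∈ E.filter (fun e' => (v : A) ∈ e'), w e := by
    intro w v
    show (∑ e : E, if (v : A) ∈ (e : Finset A) then w e else 0) = _
    rw [sum_filter, ← sum_coe_sort E (fun e => if (v : A) ∈ e then w e else 0)]
  by_cases hb : (fun v : V => b v) ∈ Φ '' K
  · obtain ⟨w, hw, hw2⟩ := hb
    refine ⟨fun e => if h : e ∈ E then w ⟨e, h⟩ else 0, ?_, ?_⟩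
    · intro e he
      simp only [he, dif_pos]
      exact ⟨hw.1 ⟨e, he⟩, hw.2 ⟨e, he⟩⟩
    · intro v hv
      have := hΦ (fun e => if h : e ∈ E then w ⟨e, h⟩ else 0) ⟨v, hv⟩
      rw [← this]
      have e : (fun e : E => (fun e => if h : e ∈ E then w ⟨e, h⟩ else 0 : Finset A → ℝ) e) = w := by
        funext e; simp
      rw [e, hw2]
  · exfalso
    have hconv : Convex ℝ (Φ '' K) := (convex_Icc 0 1).linear_image Φ
    have hcl : IsClosed (Φ '' K) := by
      have : IsCompact K := isCompact_Icc
      exact (this.image Φ.continuous_of_finiteDimensional).isClosed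
    obtain ⟨f, u, h1, h2⟩ := geometric_hahn_banach_point_closed hconv hcl hb
    let y : A → ℝ := fun v => if h : v ∈ V then f (Pi.single ⟨v, h⟩ 1) else 0
    have hf : ∀ z : A → ℝ, f (fun v : V => z v) = ∑ v ∈ V, y v * z v := by
      intro z
      have : (fun v : V => z v) = ∑ v : V, (z v) • (Pi.single v (1 : ℝ) : V → ℝ) := by
        funext v
        simp [Finset.sum_apply, Pi.single_apply]
      rw [this, map_sum, ← sum_coe_sort V (fun v => y v * z v)]
      refine sum_congr rfl fun v _ => ?_
      simp [y, mul_comm]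
    obtain ⟨w, hw, hw2⟩ := h y
    have h3 := h2 _ ⟨fun e : E => w e, ⟨fun e => (hw e e.2).1, fun e => (hw e e.2).2⟩, rfl⟩
    have e : Φ (fun e : E => w e) = fun v : V => (fun a : A => ∑ e ∈ E.filter (fun e' => a ∈ e'), w e) v := by
      funext v; exact hΦ w v
    rw [e, hf (fun a : A => ∑ e ∈ E.filter (fun e' => a ∈ e'), w e)] at h3
    rw [hf] at h1
    linarith

lemma sum_vertex_swap {V : Finset A} {E : Finset (Finset A)} (hE : ∀ e ∈ E, e ⊆ V)
    (y : A → ℝ) (w : Finset A → ℝ) :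
    ∑ v ∈ V, y v * ∑ e ∈ E.filter (fun e' => v ∈ e'), w e = ∑ e ∈ E, w e * ∑ v ∈ e, y v := by
  simp only [mul_sum, sum_filter]
  rw [sum_comm]
  refine sum_congr rfl fun e he => ?_
  have : V.filter (fun v => v ∈ e) = e := by
    ext v; simp only [mem_filter]; exact ⟨fun h => h.2, fun h => ⟨hE e he h, h⟩⟩
  calc _ = ∑ v ∈ V.filter (fun v => v ∈ e), y v * w e := by
        rw [sum_filter]
        refine sum_congr rfl fun v _ => ?_
        split_ifs <;> simp
    _ = _ := by rw [this]; exact sum_congr rfl fun v _ => mul_comm _ _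

lemma mem_link_iff {S B : Finset A} {E : Finset (Finset A)} :
    B ∈ link S E ↔ Disjoint B S ∧ B ∪ S ∈ E := by
  unfold link
  simp only [mem_image, mem_filter]
  constructor
  · rintro ⟨e, ⟨he, hS⟩, rfl⟩
    exact ⟨sdiff_disjoint, by rwa [sdiff_union_of_subset hS]⟩
  · rintro ⟨h1, h2⟩
    exact ⟨B ∪ S, ⟨h2, subset_union_right⟩, union_sdiff_cancel_right h1⟩

set_option maxHeartbeats 2000000 in
lemma robust {k d : ℕ} (hd : 1 ≤ d) (hdk : d < k) {γ N : ℝ} {V : Finset A}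
    {E : Finset (Finset A)} {C : Finset A → Finset (Finset A)}
    (hE : ∀ e ∈ E, e ⊆ V ∧ e.card = k)
    (hlink : ∀ S ∈ shadow d E, C S ⊆ link S E)
    (hfm : ∀ S ∈ shadow d E, HasFracMatching (C S) ((1 / (k : ℝ) + 2 * γ) * (V.card : ℝ)))
    (hv : ∀ v ∈ V, ∃ S ∈ shadow d E, v ∈ S)
    (hext : ∀ S ∈ shadow d E, ∀ s ∈ S,
      (((V \ S).filter fun x => insert x (S.erase s) ∉ shadow d E).card : ℝ) ≤ N)
    (hγ : 0 < γ) (hγk : 2 * k * γ ≤ 1) (hN : 2 * d * (N + d) ≤ γ * V.card) :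
    RobustlyMatchable γ V (generatedEdges d E C) := by
  intro b hb
  apply realise_of_no_sep
  intro y
  have hk2 : (2 : ℝ) ≤ k := by exact_mod_cast (by omega : 2 ≤ k)
  have hγ4 : γ ≤ 1 / 4 := by nlinarith
  have hzero : 0 ≤ ∑ v ∈ V, y v * b v → ∃ w : Finset A → ℝ,
      (∀ e ∈ generatedEdges d E C, 0 ≤ w e ∧ w e ≤ 1) ∧
      ∑ v ∈ V, y v * ∑ e ∈ (generatedEdges d E C).filter (fun e' => v ∈ e'), w e
        ≤ ∑ v ∈ V, y v * b v := by
    intro h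
    exact ⟨fun _ => 0, fun _ _ => by simp, by simpa using h⟩
  have hb0 : ∀ v ∈ V, 0 ≤ b v := fun v hv => by linarith [(hb v hv).1]
  rcases V.eq_empty_or_nonempty with hV | hV
  · exact hzero (by simp [hV])
  obtain ⟨s1, hs1, hmin⟩ := exists_min_image V y hV
  by_cases hneg : 0 ≤ y s1
  · exact hzero (sum_nonneg fun v hv => mul_nonneg (hneg.trans (hmin v hv)) (hb0 v hv))
  push Not at hneg
  obtain ⟨S0, hS0, hs1S0⟩ := hv s1 hs1
  obtain ⟨S, hS, hSmin⟩ := exists_min_image ((shadow d E).filter fun S => s1 ∈ S)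
    (fun S => ∑ v ∈ S, y v) ⟨S0, mem_filter.2 ⟨hS0, hs1S0⟩⟩
  rw [mem_filter] at hS
  obtain ⟨hS, hs1S⟩ := hS
  have hScard := card_of_mem_shadow hS
  obtain ⟨m, hm, hmax⟩ := exists_max_image S y ⟨s1, hs1S⟩
  set Z : Finset A := S ∪ (V \ S).filter fun x => insert x (S.erase m) ∉ shadow d E with hZ
  have hSV : S ⊆ V := by
    have h := hS
    unfold _root_.shadow at h
    obtain ⟨e, he, h2⟩ := mem_biUnion.1 h
    exact (mem_powersetCard.1 h2).1.trans (hE e he).1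
  have hZV : Z ⊆ V := union_subset hSV ((filter_subset _ _).trans sdiff_subset)
  have hZc : (Z.card : ℝ) ≤ N + d := by
    have h1 : (Z.card : ℝ) ≤ S.card + ((V \ S).filter fun x => insert x (S.erase m) ∉ shadow d E).card := by
      exact_mod_cast card_union_le _ _
    have h2 := hext S hS m hm
    rw [hScard] at h1
    linarith
  have hgood : ∀ v ∈ V, v ∉ Z → y m ≤ y v := by
    intro v hvV hvZ
    by_cases hms : m = s1
    · rw [hms]; exact hmin v hvV
    have hvS : v ∉ S := fun h => hvZ (mem_union_left _ h)
    have hin : insert v (S.erase m) ∈ shadow d E := by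
      by_contra h
      exact hvZ (mem_union_right _ (mem_filter.2 ⟨mem_sdiff.2 ⟨hvV, hvS⟩, h⟩))
    have h1 := hSmin _ (mem_filter.2 ⟨hin, mem_insert_of_mem (mem_erase.2 ⟨Ne.symm hms, hs1S⟩)⟩)
    have h1' : ∑ v ∈ S, y v ≤ ∑ v ∈ insert v (S.erase m), y v := h1
    rw [sum_insert (fun h => hvS (mem_of_mem_erase h))] at h1'
    have h2 := add_sum_erase S y hm
    linarith
  set Y := - y s1 with hY
  have hYpos : 0 < Y := by linarith
  have hdR : (1 : ℝ) ≤ d := by exact_mod_cast hd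
  set t : ℝ := (V.card : ℝ) with ht
  have htpos : 0 < t := by
    have := card_pos.2 hV
    rw [ht]; exact_mod_cast this
  have hz2 : 2 * d * (Z.card : ℝ) ≤ γ * t := by
    refine le_trans ?_ hN
    exact mul_le_mul_of_nonneg_left hZc (by positivity)
  have hz0 : (0 : ℝ) ≤ Z.card := by positivity
  by_cases hu : Y ≤ 2 * d * y m
  · apply hzero
    have hup : 0 < y m := by
      by_contra h
      push Not at h
      nlinarith
    have hsplit := sum_sdiff (f := fun v => y v * b v) hZV
    have h1 : ∑ v ∈ V \ Z, (1 - γ) * y m ≤ ∑ v ∈ V \ Z, y v * b v := by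
      refine sum_le_sum fun v hv => ?_
      rw [mem_sdiff] at hv
      have a1 := hgood v hv.1 hv.2
      have a2 := (hb v hv.1).1
      rw [mul_comm]
      exact mul_le_mul a1 a2 (by linarith) (by linarith)
    have h2 : ∑ v ∈ Z, (-Y) ≤ ∑ v ∈ Z, y v * b v := by
      refine sum_le_sum fun v hv => ?_
      have a1 := hmin v (hZV hv)
      have a2 := hb0 v (hZV hv)
      have a3 := (hb v (hZV hv)).2
      nlinarith
    rw [sum_const, nsmul_eq_mul] at h1 h2
    have hcard : ((V \ Z).card : ℝ) = t - Z.card := by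
      rw [card_sdiff_of_subset hZV, Nat.cast_sub (card_le_card hZV)]
    rw [hcard] at h1
    have hzt : (Z.card : ℝ) ≤ t / 8 := by nlinarith
    have h3 : t / 2 * y m ≤ (t - Z.card) * ((1 - γ) * y m) := by
      rw [← mul_assoc]
      refine mul_le_mul_of_nonneg_right ?_ hup.le
      nlinarith
    have h4 : (Z.card : ℝ) * Y ≤ t / 2 * y m := by
      have : (Z.card : ℝ) * Y ≤ Z.card * (2 * d * y m) := mul_le_mul_of_nonneg_left hu hz0
      have h5 : (2 * d * (Z.card : ℝ)) * y m ≤ γ * t * y m := mul_le_mul_of_nonneg_right hz2 hup.le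
      have h6 : γ * t * y m ≤ t / 2 * y m := mul_le_mul_of_nonneg_right (by nlinarith) hup.le
      linarith
    linarith
  · push Not at hu
    set s := - ∑ v ∈ S, y v with hs
    have hsu : -s ≤ d * y m := by
      have : ∑ v ∈ S, y v ≤ ∑ v ∈ S, y m := sum_le_sum hmax
      rw [sum_const, nsmul_eq_mul, hScard] at this
      linarith
    have hsY : Y ≤ 2 * s := by
      have h1 := add_sum_erase S y hs1S
      have h2 : ∑ v ∈ S.erase s1, y v ≤ ∑ v ∈ S.erase s1, y m :=
        sum_le_sum fun v hv => hmax v (mem_of_mem_erase hv)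
      rw [sum_const, nsmul_eq_mul, card_erase_of_mem hs1S, hScard, Nat.cast_sub hd, Nat.cast_one] at h2
      have h3 : 2 * ((d : ℝ) - 1) * y m ≤ Y := by
        by_cases hp : 0 ≤ y m
        · nlinarith
        · push Not at hp; nlinarith
      linarith
    have hspos : 0 < s := by linarith
    obtain ⟨w, hw01, hwv, hwM⟩ := hfm S hS
    have hCS : ∀ B ∈ C S, B ⊆ V ∧ B.card = k - d ∧ Disjoint B S := by
      intro B hB
      obtain ⟨h1, h2⟩ := mem_link_iff.1 (hlink S hS hB)
      refine ⟨subset_union_left.trans (hE _ h2).1, ?_, h1⟩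
      have := (hE _ h2).2
      rw [card_union_of_disjoint h1, hScard] at this
      omega
    set p : A → ℝ := fun v => (1 - γ) * ∑ B ∈ (C S).filter (fun e' => v ∈ e'), w B with hp
    set M : ℝ := ∑ B ∈ C S, w B with hMdef
    let W : Finset A → ℝ := fun e => if S ⊆ e ∧ e \ S ∈ C S then (1 - γ) * w (e \ S) else 0
    refine ⟨W, ?_, ?_⟩
    · intro e _
      simp only [W]
      split_ifs with h
      · have := hw01 _ h.2
        constructor
        · exact mul_nonneg (by linarith) this.1
        · nlinarith
      · simp
    have hgenV : ∀ e ∈ generatedEdges d E C, e ⊆ V := by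
      intro e he
      unfold generatedEdges at he
      obtain ⟨S', hS', h2⟩ := mem_biUnion.1 he
      obtain ⟨B, hB, rfl⟩ := mem_image.1 h2
      exact (hE _ (mem_link_iff.1 (hlink S' hS' hB)).2).1
    have e1 : ∑ v ∈ V, y v * ∑ e ∈ (generatedEdges d E C).filter (fun e' => v ∈ e'), W e
        = ∑ B ∈ C S, (1 - γ) * w B * (∑ v ∈ B, y v - s) := by
      rw [sum_vertex_swap hgenV]
      have hsub : (C S).image (fun B => B ∪ S) ⊆ generatedEdges d E C := by
        intro e he
        obtain ⟨B, hB, rfl⟩ := mem_image.1 he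
        exact mem_generated hS hB
      rw [← sum_subset hsub]
      · rw [sum_image]
        · refine sum_congr rfl fun B hB => ?_
          have hdis := (hCS B hB).2.2
          simp only [W, union_sdiff_cancel_right hdis, subset_union_right, hB, and_self, if_true]
          rw [sum_union hdis]
          ring
        · intro B hB B' hB' h
          have h' : B ∪ S = B' ∪ S := h
          rw [← union_sdiff_cancel_right (hCS B hB).2.2, h',
            union_sdiff_cancel_right (hCS B' hB').2.2]
      · intro e _ hne
        have : ¬ (S ⊆ e ∧ e \ S ∈ C S) := by
          rintro ⟨h1, h2⟩
          exact hne (mem_image.2 ⟨e \ S, h2, sdiff_union_of_subset h1⟩)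
        simp [W, this]
    have e2 : ∑ B ∈ C S, (1 - γ) * w B * (∑ v ∈ B, y v - s)
        = ∑ v ∈ V, y v * p v - (1 - γ) * s * M := by
      have h1 := sum_vertex_swap (fun B hB => (hCS B hB).1) y w
      have h2 : ∑ v ∈ V, y v * p v
          = (1 - γ) * ∑ v ∈ V, y v * ∑ B ∈ (C S).filter (fun e' => v ∈ e'), w B := by
        rw [mul_sum]; refine sum_congr rfl fun v _ => ?_
        simp only [hp]; ring
      rw [h2, h1, hMdef, mul_sum, mul_sum, ← sum_sub_distrib]
      refine sum_congr rfl fun B _ => ?_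
      ring
    have e3 : ∑ v ∈ V, p v = (1 - γ) * (k - d) * M := by
      have h1 := sum_vertex_swap (fun B hB => (hCS B hB).1) (fun _ => 1) w
      simp only [one_mul, sum_const, nsmul_eq_mul, mul_one] at h1
      simp only [hp]
      rw [← mul_sum, h1, hMdef, mul_assoc]
      congr 1
      rw [mul_sum]
      refine sum_congr rfl fun B hB => ?_
      rw [(hCS B hB).2.1, Nat.cast_sub hdk.le]; ring
    rw [e1, e2]
    have hpt : ∀ v ∈ V, -(s / d) * (b v - p v) - (if v ∈ Z then 2 * s else 0)
        ≤ y v * b v - y v * p v := by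
      intro v hv
      have a1 : p v ≤ 1 - γ := by
        have := hwv v
        simp only [hp]
        nlinarith
      have a0 : 0 ≤ p v := by
        simp only [hp]
        refine mul_nonneg (by linarith) (sum_nonneg fun B hB => (hw01 B (mem_filter.1 hB).1).1)
      have a2 : 0 ≤ b v - p v := by linarith [(hb v hv).1]
      have a3 : b v - p v ≤ 1 := by linarith [(hb v hv).2]
      have hsd : 0 ≤ s / d := by positivity
      by_cases hvZ : v ∈ Z
      · simp only [hvZ, if_true]
        have := hmin v hv
        nlinarith [mul_nonneg hsd a2]
      · simp only [hvZ, if_false]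
        have g := hgood v hv hvZ
        have g2 : -(s / d) ≤ y m := by
          rw [neg_le, div_eq_mul_inv, ← div_eq_mul_inv, le_div_iff₀ (by linarith)] <;> nlinarith
        nlinarith
    have hsum := sum_le_sum hpt
    rw [sum_sub_distrib, sum_sub_distrib, ← mul_sum, sum_sub_distrib, e3, ← sum_filter] at hsum
    have hfz : V.filter (fun v => v ∈ Z) = Z := by
      ext v; simp only [mem_filter]; exact ⟨fun h => h.2, fun h => ⟨hZV h, h⟩⟩
    rw [hfz, sum_const, nsmul_eq_mul] at hsum
    have hbt : ∑ v ∈ V, b v ≤ t := by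
      have : ∑ v ∈ V, b v ≤ ∑ v ∈ V, (1 : ℝ) := sum_le_sum fun v hv => (hb v hv).2
      simpa using this
    have hkM : (1 + 2 * k * γ) * t ≤ k * M := by
      have : (k : ℝ) * ((1 / k + 2 * γ) * t) ≤ k * M := mul_le_mul_of_nonneg_left hwM (by linarith)
      have e : (k : ℝ) * ((1 / k + 2 * γ) * t) = (1 + 2 * k * γ) * t := by
        field_simp
      linarith
    have hfinal : 0 ≤ (1 - γ) * (k * M) - t - 2 * d * (Z.card : ℝ) := by
      have h1 : (1 - γ) * ((1 + 2 * k * γ) * t) ≤ (1 - γ) * (k * M) :=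
        mul_le_mul_of_nonneg_left hkM (by linarith)
      have h2 : t + γ * t ≤ (1 - γ) * ((1 + 2 * k * γ) * t) := by
        have : 1 + γ ≤ (1 - γ) * (1 + 2 * k * γ) := by nlinarith
        nlinarith
      linarith
    have hfin2 : 0 ≤ (s / d) * ((1 - γ) * (k * M) - t - 2 * d * (Z.card : ℝ)) :=
      mul_nonneg (by positivity) hfinal
    have hdd : s / d * d = s := by field_simp
    have hb2 : s / d * ∑ v ∈ V, b v ≤ s / d * t := mul_le_mul_of_nonneg_left hbt (by positivity)
    have expand : (s / d) * ((1 - γ) * (k * M) - t - 2 * d * (Z.card : ℝ))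
        = (s / d) * ((1 - γ) * ((k - d) * M)) + (s / d * d) * ((1 - γ) * M) - s / d * t
          - 2 * (s / d * d) * Z.card := by ring
    rw [expand, hdd] at hfin2
    nlinarith

/-- iterated bad families. -/
noncomputable def badFam (k : ℕ) (V : Finset A) (θ : ℝ) (I : Finset (Finset A)) : ℕ → Finset (Finset A)
  | 0 => I
  | m + 1 => (V.powersetCard (k - (m + 1))).filter fun T =>
      θ < (((badFam k V θ I m).filter fun F => T ⊆ F).card : ℝ)

lemma badFam_card {k : ℕ} {V : Finset A} {θ : ℝ} {I : Finset (Finset A)}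
    (hI : ∀ e ∈ I, e ⊆ V ∧ e.card = k) (m : ℕ) :
    ∀ F ∈ badFam k V θ I m, F ⊆ V ∧ F.card = k - m := by
  cases m with
  | zero => intro F hF; exact hI F hF
  | succ m =>
    intro F hF
    unfold badFam at hF
    exact mem_powersetCard.1 (mem_filter.1 hF).1

lemma badFam_count {k : ℕ} {V : Finset A} {θ : ℝ} {I : Finset (Finset A)}
    (hI : ∀ e ∈ I, e ⊆ V ∧ e.card = k) (m : ℕ) (hm : m < k) :
    ((badFam k V θ I (m + 1)).card : ℝ) * θ ≤ (k - m : ℕ) * ((badFam k V θ I m).card : ℝ) := by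
  have h1 : ((badFam k V θ I (m + 1)).card : ℝ) * θ
      ≤ ∑ T ∈ badFam k V θ I (m + 1), (((badFam k V θ I m).filter fun F => T ⊆ F).card : ℝ) := by
    rw [← nsmul_eq_mul, ← sum_const]
    refine sum_le_sum fun T hT => ?_
    unfold badFam at hT
    exact (mem_filter.1 hT).2.le
  have h2 : ∑ T ∈ badFam k V θ I (m + 1), ((badFam k V θ I m).filter fun F => T ⊆ F).card
      = ∑ F ∈ badFam k V θ I m, ((badFam k V θ I (m + 1)).filter fun T => T ⊆ F).card := by
    exact sum_card_bipartiteAbove_eq_sum_card_bipartiteBelow (fun T F : Finset A => T ⊆ F)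
  have h3 : ∑ F ∈ badFam k V θ I m, ((badFam k V θ I (m + 1)).filter fun T => T ⊆ F).card
      ≤ ∑ F ∈ badFam k V θ I m, (k - m) := by
    refine sum_le_sum fun F hF => ?_
    have hFc := (badFam_card hI m F hF).2
    have : (badFam k V θ I (m + 1)).filter (fun T => T ⊆ F) ⊆ F.powersetCard (k - (m + 1)) := by
      intro T hT
      rw [mem_filter] at hT
      exact mem_powersetCard.2 ⟨hT.2, (badFam_card hI (m + 1) T hT.1).2⟩
    refine (card_le_card this).trans ?_
    rw [card_powersetCard, hFc]
    have e : k - m = (k - (m + 1)) + 1 := by omega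
    rw [e, Nat.choose_succ_self_right]
  rw [sum_const, smul_eq_mul] at h3
  refine h1.trans ?_
  rw [← Nat.cast_sum, h2, mul_comm]
  exact_mod_cast h3

lemma badFam_bound {k : ℕ} {V : Finset A} {θ : ℝ} {I : Finset (Finset A)} (hθ : 0 < θ)
    (hI : ∀ e ∈ I, e ⊆ V ∧ e.card = k) (m : ℕ) (hm : m ≤ k) :
    ((badFam k V θ I m).card : ℝ) * θ ^ m ≤ (k.descFactorial m : ℝ) * (I.card : ℝ) := by
  induction m with
  | zero => simp [badFam]
  | succ m ih =>
    have h1 := badFam_count (θ := θ) hI m (by omega)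
    have h2 := ih (by omega)
    rw [Nat.descFactorial_succ, pow_succ]
    push_cast
    have h3 : (((badFam k V θ I (m + 1)).card : ℝ) * θ) * θ ^ m
        ≤ ((k - m : ℕ) * ((badFam k V θ I m).card : ℝ)) * θ ^ m :=
      mul_le_mul_of_nonneg_right h1 (by positivity)
    have h4 : ((k - m : ℕ) : ℝ) * (((badFam k V θ I m).card : ℝ) * θ ^ m)
        ≤ (k - m : ℕ) * ((k.descFactorial m : ℝ) * (I.card : ℝ)) :=
      mul_le_mul_of_nonneg_left h2 (by positivity)
    linarith

lemma cleaning {k : ℕ} {V : Finset A} {θ : ℝ} {I : Finset (Finset A)} (hθ : 0 < θ)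
    (hI : ∀ e ∈ I, e ⊆ V ∧ e.card = k) (hsmall : (k.factorial : ℝ) * I.card < θ ^ k) :
    ∃ D : Finset (Finset A), (∀ T ∈ D, T ⊆ V) ∧ (∀ T ∈ D, ∀ S ⊆ T, S ∈ D) ∧ ∅ ∈ D ∧
      (∀ e ∈ I, e ∉ D) ∧
      ∀ T ∈ D, T.card < k →
        (((V \ T).filter fun x => insert x T ∉ D).card : ℝ) ≤ 2 ^ k * θ := by
  classical
  set D : Finset (Finset A) := V.powerset.filter fun T =>
    ∀ m ≤ k, ∀ F ∈ badFam k V θ I m, ¬ F ⊆ T with hD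
  have memD : ∀ T, T ∈ D ↔ T ⊆ V ∧ ∀ m ≤ k, ∀ F ∈ badFam k V θ I m, ¬ F ⊆ T := by
    intro T; simp [hD]
  refine ⟨D, fun T hT => ((memD T).1 hT).1, ?_, ?_, ?_, ?_⟩
  · intro T hT S hST
    rw [memD] at hT ⊢
    exact ⟨hST.trans hT.1, fun m hm F hF h => hT.2 m hm F hF (h.trans hST)⟩
  · rw [memD]
    refine ⟨empty_subset _, fun m hm F hF h => ?_⟩
    have hF0 := subset_empty.1 h
    subst hF0
    have hc := (badFam_card hI m _ hF).2
    rw [card_empty] at hc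
    have hmk : m = k := by omega
    subst hmk
    have hb := badFam_bound hθ hI m le_rfl
    rw [Nat.descFactorial_self] at hb
    have h1 : (1 : ℝ) ≤ ((badFam m V θ I m).card : ℝ) := by
      exact_mod_cast card_pos.2 ⟨_, hF⟩
    have : θ ^ m ≤ ((badFam m V θ I m).card : ℝ) * θ ^ m := by
      nlinarith [pow_pos hθ m]
    linarith
  · intro e he h
    exact ((memD e).1 h).2 0 (Nat.zero_le _) e he Subset.rfl
  · intro T hT hTk
    obtain ⟨hTV, hTc⟩ := (memD T).1 hT
    have hsub : (V \ T).filter (fun x => insert x T ∉ D) ⊆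
        T.powerset.biUnion fun F' => (V \ T).filter fun x =>
          insert x F' ∈ badFam k V θ I (k - 1 - F'.card) := by
      intro x hx
      rw [mem_filter, mem_sdiff] at hx
      obtain ⟨⟨hxV, hxT⟩, hx⟩ := hx
      rw [memD] at hx
      have : ∃ m ≤ k, ∃ F ∈ badFam k V θ I m, F ⊆ insert x T := by
        by_contra h
        push Not at h
        exact hx ⟨insert_subset hxV hTV, h⟩
      obtain ⟨m, hm, F, hF, hFs⟩ := this
      have hxF : x ∈ F := by
        by_contra h
        exact hTc m hm F hF ((subset_insert_iff_of_notMem h).1 hFs)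
      have hFc := (badFam_card hI m F hF).2
      have hpos := card_pos.2 ⟨x, hxF⟩
      refine mem_biUnion.2 ⟨F.erase x, mem_powerset.2 ?_, mem_filter.2 ⟨mem_sdiff.2 ⟨hxV, hxT⟩, ?_⟩⟩
      · exact subset_insert_iff.1 hFs
      · rw [insert_erase hxF, card_erase_of_mem hxF]
        have : k - 1 - (F.card - 1) = m := by omega
        rw [this]; exact hF
    have hcard : ∀ F' ∈ T.powerset, (((V \ T).filter fun x =>
          insert x F' ∈ badFam k V θ I (k - 1 - F'.card)).card : ℝ) ≤ θ := by
      intro F' hF'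
      have hF'T := mem_powerset.1 hF'
      have hle := card_le_card hF'T
      have hnot : F' ∉ badFam k V θ I (k - 1 - F'.card + 1) := by
        intro h
        exact hTc _ (by omega) F' h hF'T
      unfold badFam at hnot
      rw [mem_filter] at hnot
      have h2 : ((((badFam k V θ I (k - 1 - F'.card)).filter fun F => F' ⊆ F).card : ℝ)) ≤ θ := by
        by_contra h
        push Not at h
        exact hnot ⟨mem_powersetCard.2 ⟨hF'T.trans hTV, by omega⟩, h⟩
      refine le_trans ?_ h2
      norm_cast
      refine card_le_card_of_injOn (fun x => insert x F') ?_ ?_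
      · intro x hx
        have hx' := mem_filter.1 (mem_coe.1 hx)
        exact mem_coe.2 (mem_filter.2 ⟨hx'.2, subset_insert _ _⟩)
      · intro x hx y hy hxy
        have hx' := mem_sdiff.1 (mem_filter.1 (mem_coe.1 hx)).1
        have hxy' : insert x F' = insert y F' := hxy
        have : x ∈ insert y F' := hxy' ▸ mem_insert_self x F'
        rcases mem_insert.1 this with h | h
        · exact h
        · exact absurd (hF'T h) hx'.2
    have h1 := (card_le_card hsub).trans card_biUnion_le
    have h2 : ((((V \ T).filter fun x => insert x T ∉ D).card : ℕ) : ℝ) ≤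
        ∑ F' ∈ T.powerset, (((V \ T).filter fun x =>
          insert x F' ∈ badFam k V θ I (k - 1 - F'.card)).card : ℝ) := by
      exact_mod_cast h1
    refine h2.trans ((sum_le_sum hcard).trans ?_)
    rw [sum_const, card_powerset, nsmul_eq_mul]
    push_cast
    refine mul_le_mul_of_nonneg_right ?_ hθ.le
    exact pow_le_pow_right₀ (by norm_num) hTk.le

lemma card_super {V T : Finset A} (hT : T ⊆ V) (m : ℕ) :
    ((V.powersetCard (T.card + m)).filter fun e => T ⊆ e).card = (V.card - T.card).choose m := by
  rw [← card_sdiff_of_subset hT, ← card_powersetCard]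
  symm
  refine card_bij (fun B _ => B ∪ T) ?_ ?_ ?_
  · intro B hB
    obtain ⟨h1, h2⟩ := mem_powersetCard.1 hB
    have hd : Disjoint B T := disjoint_of_subset_left h1 sdiff_disjoint
    refine mem_filter.2 ⟨mem_powersetCard.2 ⟨union_subset (h1.trans sdiff_subset) hT, ?_⟩,
      subset_union_right⟩
    rw [card_union_of_disjoint hd, h2, add_comm]
  · intro B hB B' hB' h
    have hd : Disjoint B T := disjoint_of_subset_left (mem_powersetCard.1 hB).1 sdiff_disjoint
    have hd' : Disjoint B' T := disjoint_of_subset_left (mem_powersetCard.1 hB').1 sdiff_disjoint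
    rw [← union_sdiff_cancel_right hd, h, union_sdiff_cancel_right hd']
  · intro e he
    obtain ⟨h1, h2⟩ := mem_filter.1 he
    obtain ⟨h3, h4⟩ := mem_powersetCard.1 h1
    refine ⟨e \ T, mem_powersetCard.2 ⟨sdiff_subset_sdiff h3 Subset.rfl, ?_⟩,
      sdiff_union_of_subset h2⟩
    rw [card_sdiff_of_subset h2, h4]; omega

lemma dirty_count {k : ℕ} {V : Finset A} {D : Finset (Finset A)} {c : ℝ} (hc : 0 ≤ c)
    (hDV : ∀ T ∈ D, T ⊆ V)
    (hext : ∀ T ∈ D, T.card < k →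
      (((V \ T).filter fun x => insert x T ∉ D).card : ℝ) ≤ c * V.card) (m : ℕ) :
    ∀ T ∈ D, T.card + m ≤ k →
      (((V.powersetCard (T.card + m)).filter fun e => T ⊆ e ∧ e ∉ D).card : ℝ)
        ≤ m * c * (V.card : ℝ) ^ m := by
  induction m with
  | zero =>
    intro T hT _
    have : (V.powersetCard (T.card + 0)).filter (fun e => T ⊆ e ∧ e ∉ D) = ∅ := by
      refine filter_eq_empty_iff.2 fun e he h => ?_
      have := eq_of_subset_of_card_le h.1 (by rw [(mem_powersetCard.1 he).2, add_zero])
      exact h.2 (this ▸ hT)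
    rw [this]; simp
  | succ m ih =>
    intro T hT hTk
    have hTV := hDV T hT
    set X := V \ T
    let G : A → Finset (Finset A) := fun x =>
      (V.powersetCard ((insert x T).card + m)).filter fun e => insert x T ⊆ e ∧ e ∉ D
    have hcardx : ∀ x ∈ X, (insert x T).card = T.card + 1 := fun x hx =>
      card_insert_of_notMem (mem_sdiff.1 hx).2
    have hsub : (V.powersetCard (T.card + (m + 1))).filter (fun e => T ⊆ e ∧ e ∉ D)
        ⊆ X.biUnion G := by
      intro e he
      obtain ⟨h1, h2, h3⟩ := mem_filter.1 he
      obtain ⟨h4, h5⟩ := mem_powersetCard.1 h1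
      obtain ⟨x, hx, hxT⟩ : ∃ x ∈ e, x ∉ T := by
        by_contra h
        push Not at h
        have := card_le_card (show e ⊆ T from h)
        omega
      have hxX : x ∈ X := mem_sdiff.2 ⟨h4 hx, hxT⟩
      refine mem_biUnion.2 ⟨x, hxX, mem_filter.2 ⟨mem_powersetCard.2 ⟨h4, ?_⟩,
        insert_subset hx h2, h3⟩⟩
      rw [hcardx x hxX]; omega
    have hG : ∀ x ∈ X, ((G x).card : ℝ) ≤
        m * c * (V.card : ℝ) ^ m + (if insert x T ∉ D then (V.card : ℝ) ^ m else 0) := by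
      intro x hx
      by_cases hxD : insert x T ∈ D
      · have := ih _ hxD (by rw [hcardx x hx]; omega)
        simpa [hxD] using this
      · have h1 : (G x).card ≤ (V.card) ^ m := by
          have h2 : G x ⊆ (V.powersetCard ((insert x T).card + m)).filter fun e => insert x T ⊆ e := by
            intro e he
            have := mem_filter.1 he
            exact mem_filter.2 ⟨this.1, this.2.1⟩
          refine (card_le_card h2).trans ?_
          rw [card_super (insert_subset (mem_sdiff.1 hx).1 hTV)]
          refine (Nat.choose_le_pow _ _).trans ?_
          exact Nat.pow_le_pow_left (Nat.sub_le _ _) _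
        have h1' : ((G x).card : ℝ) ≤ (V.card : ℝ) ^ m := by exact_mod_cast h1
        simp only [hxD, not_false_eq_true, if_true]
        have : 0 ≤ m * c * (V.card : ℝ) ^ m := by positivity
        linarith
    have h1 : ((((V.powersetCard (T.card + (m + 1))).filter fun e => T ⊆ e ∧ e ∉ D).card : ℕ) : ℝ)
        ≤ ∑ x ∈ X, ((G x).card : ℝ) := by
      exact_mod_cast (card_le_card hsub).trans card_biUnion_le
    refine h1.trans ((sum_le_sum hG).trans ?_)
    rw [sum_add_distrib, sum_const, ← sum_filter, sum_const, nsmul_eq_mul, nsmul_eq_mul]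
    have h2 := hext T hT (by omega)
    have h3 : (X.card : ℝ) ≤ V.card := by exact_mod_cast card_le_card sdiff_subset
    have h4 : (X.card : ℝ) * (m * c * (V.card : ℝ) ^ m) ≤ V.card * (m * c * (V.card : ℝ) ^ m) :=
      mul_le_mul_of_nonneg_right h3 (by positivity)
    have h5 := mul_le_mul_of_nonneg_right h2 (show (0 : ℝ) ≤ (V.card : ℝ) ^ m by positivity)
    rw [pow_succ]
    push_cast
    linarith

/-- double counting degrees -/
lemma deg_down {k d j : ℕ} (hjd : j ≤ d) (hdk : d ≤ k) {V : Finset A} {E : Finset (Finset A)}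
    (hk : k ≤ V.card) {c : ℝ}
    (hE : ∀ e ∈ E, e ⊆ V ∧ e.card = k)
    (hdeg : ∀ S ⊆ V, S.card = d → c * (((V.card - d).choose (k - d) : ℕ) : ℝ)
      ≤ ((E.filter fun e => S ⊆ e).card : ℝ)) (S : Finset A) (hS : S ⊆ V) (hSj : S.card = j) :
    c * (((V.card - j).choose (k - j) : ℕ) : ℝ) ≤ ((E.filter fun e => S ⊆ e).card : ℝ) := by
  set P := (V.powersetCard d).filter fun T => S ⊆ T with hP
  have hPc : P.card = (V.card - j).choose (d - j) := by
    have := card_super hS (d - j)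
    rw [hSj, Nat.add_sub_cancel' hjd] at this
    exact this
  have h1 : (P.card : ℝ) * (c * (((V.card - d).choose (k - d) : ℕ) : ℝ))
      ≤ ∑ T ∈ P, ((E.filter fun e => T ⊆ e).card : ℝ) := by
    rw [← nsmul_eq_mul, ← sum_const]
    refine sum_le_sum fun T hT => ?_
    obtain ⟨h1, h2⟩ := mem_powersetCard.1 (mem_filter.1 hT).1
    exact hdeg T h1 h2
  have h2 : ∑ T ∈ P, (E.filter fun e => T ⊆ e).card
      = ∑ e ∈ E, (P.filter fun T => T ⊆ e).card :=
    sum_card_bipartiteAbove_eq_sum_card_bipartiteBelow (fun T F : Finset A => T ⊆ F)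
  have h3 : ∑ e ∈ E, (P.filter fun T => T ⊆ e).card
      = ∑ e ∈ E.filter (fun e => S ⊆ e), (k - j).choose (d - j) := by
    rw [sum_filter]
    refine sum_congr rfl fun e he => ?_
    obtain ⟨heV, hek⟩ := hE e he
    split_ifs with hSe
    · have := card_super hSe (d - j)
      rw [hSj, Nat.add_sub_cancel' hjd, hek] at this
      rw [← this]
      congr 1
      ext T
      simp only [hP, mem_filter, mem_powersetCard]
      constructor
      · rintro ⟨⟨⟨a, b⟩, c⟩, d⟩; exact ⟨⟨d, b⟩, c⟩
      · rintro ⟨⟨a, b⟩, c⟩; exact ⟨⟨⟨a.trans heV, b⟩, c⟩, a⟩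
    · rw [card_eq_zero]
      refine filter_eq_empty_iff.2 fun T hT h => hSe ?_
      exact (mem_filter.1 hT).2.trans h
  rw [← Nat.cast_sum, h2, h3, sum_const, smul_eq_mul, hPc] at h1
  push_cast at h1
  have hch := Nat.choose_mul (n := V.card - j) (k := k - j) (s := d - j) (by omega)
  have e1 : V.card - j - (d - j) = V.card - d := by omega
  have e2 : k - j - (d - j) = k - d := by omega
  rw [e1, e2] at hch
  have hch' : ((V.card - j).choose (k - j) : ℝ) * ((k - j).choose (d - j) : ℝ)
      = ((V.card - j).choose (d - j) : ℝ) * ((V.card - d).choose (k - d) : ℝ) := by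
    exact_mod_cast hch
  have hpos : (0 : ℝ) < ((k - j).choose (d - j) : ℝ) := by
    exact_mod_cast Nat.choose_pos (by omega)
  refine le_of_mul_le_mul_right ?_ hpos
  rw [mul_assoc, hch']
  linarith

/-- comparison of powers and binomials -/
lemma pow_le_K {k t t' j m : ℕ} (ht : t ≤ 2 * t') (hk : 4 * k ≤ t) (hjm : j + m ≤ k) :
    (t : ℝ) ^ m ≤ (4 ^ k * k.factorial : ℝ) * ((t' - j).choose m : ℝ) := by
  have h1 := Nat.pow_le_choose (α := ℝ) m (t' - j)
  have h2 : (t : ℝ) ^ m ≤ (4 : ℝ) ^ m * ((t' - j + 1 - m : ℕ) : ℝ) ^ m := by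
    rw [← mul_pow]
    refine pow_le_pow_left₀ (by positivity) ?_ m
    have : t ≤ 4 * (t' - j + 1 - m) := by omega
    exact_mod_cast this
  have h3 : (m.factorial : ℝ) ≤ k.factorial := by
    exact_mod_cast Nat.factorial_le (by omega)
  have h4 : (4 : ℝ) ^ m ≤ 4 ^ k := pow_le_pow_right₀ (by norm_num) (by omega)
  have h5 : (((t' - j + 1 - m : ℕ) : ℝ)) ^ m ≤ m.factorial * ((t' - j).choose m : ℝ) := by
    first
    | exact_mod_cast h1
    | (rw [div_le_iff₀ (by positivity)] at h1; rw [mul_comm]; exact_mod_cast h1)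
  calc (t : ℝ) ^ m ≤ 4 ^ m * ((t' - j + 1 - m : ℕ) : ℝ) ^ m := h2
    _ ≤ 4 ^ k * (k.factorial * ((t' - j).choose m : ℝ)) := by
      refine mul_le_mul h4 (h5.trans ?_) (by positivity) (by positivity)
      exact mul_le_mul_of_nonneg_right h3 (by positivity)
    _ = _ := by ring

lemma clean_sub {V : Finset A} {D : Finset (Finset A)} (hDV : ∀ T ∈ D, T ⊆ V)
    (hdown : ∀ T ∈ D, ∀ S ⊆ T, S ∈ D) : ∀ T ∈ D, T ⊆ V.filter fun v => {v} ∈ D := by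
  intro T hT v hv
  exact mem_filter.2 ⟨hDV T hT hv, hdown T hT _ (singleton_subset_iff.2 hv)⟩

lemma clean_card {k : ℕ} (hk : 0 < k) {V : Finset A} {D : Finset (Finset A)} {c : ℝ}
    (hD0 : ∅ ∈ D)
    (hext : ∀ T ∈ D, T.card < k →
      (((V \ T).filter fun x => insert x T ∉ D).card : ℝ) ≤ c * V.card) :
    (1 - c) * (V.card : ℝ) ≤ ((V.filter fun v => {v} ∈ D).card : ℝ) := by
  have h := hext ∅ hD0 (by simpa using hk)
  have h2 := card_filter_add_card_filter_not (s := V) (fun v => {v} ∈ D)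
  have h3 : ((V \ ∅).filter fun x => insert x ∅ ∉ D) = V.filter fun v => ¬ {v} ∈ D := by
    simp
  rw [h3] at h
  have h2' : ((V.filter fun v => {v} ∈ D).card : ℝ) + ((V.filter fun v => ¬ {v} ∈ D).card : ℝ)
      = V.card := by exact_mod_cast h2
  linarith

lemma clean_deg {k d j : ℕ} (hjd : j ≤ d) (hdk : d < k) {V : Finset A} {E D : Finset (Finset A)}
    {c r μ : ℝ} (hc : 0 ≤ c) (hkt : 4 * k ≤ V.card)
    (hE : ∀ e ∈ E, e ⊆ V ∧ e.card = k)
    (hdeg : ∀ S ⊆ V, S.card = d → (r + μ) * (((V.card - d).choose (k - d) : ℕ) : ℝ)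
      ≤ ((E.filter fun e => S ⊆ e).card : ℝ))
    (hDV : ∀ T ∈ D, T ⊆ V)
    (hext : ∀ T ∈ D, T.card < k →
      (((V \ T).filter fun x => insert x T ∉ D).card : ℝ) ≤ c * V.card)
    (hcμ : k * c * (4 ^ k * k.factorial : ℝ) ≤ μ / 2)
    (S : Finset A) (hS : S ∈ D) (hSj : S.card = j) :
    (r + μ / 2) * (((V.card - j).choose (k - j) : ℕ) : ℝ)
      ≤ (((E.filter fun e => e ∈ D).filter fun e => S ⊆ e).card : ℝ) := by
  have h1 := deg_down hjd hdk.le (by omega) hE hdeg S (hDV S hS) hSj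
  have h2 := dirty_count hc hDV hext (k - j) S hS (by omega)
  rw [hSj, Nat.add_sub_cancel' (by omega)] at h2
  have h3 : (E.filter fun e => S ⊆ e).card ≤ ((E.filter fun e => e ∈ D).filter fun e => S ⊆ e).card
      + ((V.powersetCard k).filter fun e => S ⊆ e ∧ e ∉ D).card := by
    refine (card_le_card ?_).trans (card_union_le _ _)
    intro e he
    obtain ⟨heE, hSe⟩ := mem_filter.1 he
    by_cases heD : e ∈ D
    · exact mem_union_left _ (mem_filter.2 ⟨mem_filter.2 ⟨heE, heD⟩, hSe⟩)
    · exact mem_union_right _ (mem_filter.2 ⟨mem_powersetCard.2 (hE e heE), hSe, heD⟩)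
  have h3' : ((E.filter fun e => S ⊆ e).card : ℝ) ≤
      (((E.filter fun e => e ∈ D).filter fun e => S ⊆ e).card : ℝ)
      + (((V.powersetCard k).filter fun e => S ⊆ e ∧ e ∉ D).card : ℝ) := by exact_mod_cast h3
  have h4 := pow_le_K (t := V.card) (t' := V.card) (j := j) (m := k - j) (by omega) hkt (by omega)
  set Q : ℝ := (((V.card - j).choose (k - j) : ℕ) : ℝ)
  have hQ : 0 ≤ Q := by positivity
  have h5 : ((k - j : ℕ) : ℝ) * c * (V.card : ℝ) ^ (k - j) ≤ μ / 2 * Q := by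
    have a1 : ((k - j : ℕ) : ℝ) ≤ k := by exact_mod_cast Nat.sub_le _ _
    calc ((k - j : ℕ) : ℝ) * c * (V.card : ℝ) ^ (k - j)
        ≤ k * c * ((4 ^ k * k.factorial : ℝ) * Q) :=
          mul_le_mul (mul_le_mul_of_nonneg_right a1 hc) h4 (by positivity) (by positivity)
      _ = k * c * (4 ^ k * k.factorial : ℝ) * Q := by ring
      _ ≤ _ := mul_le_mul_of_nonneg_right hcμ hQ
  linarith

lemma clean_shadow {k d j : ℕ} (hjd : j ≤ d) (hdk : d < k) {V : Finset A}
    {E D : Finset (Finset A)}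
    {c r μ : ℝ} (hc : 0 ≤ c) (hkt : 4 * k ≤ V.card)
    (hE : ∀ e ∈ E, e ⊆ V ∧ e.card = k)
    (hdeg : ∀ S ⊆ V, S.card = d → (r + μ) * (((V.card - d).choose (k - d) : ℕ) : ℝ)
      ≤ ((E.filter fun e => S ⊆ e).card : ℝ))
    (hDV : ∀ T ∈ D, T ⊆ V) (hdown : ∀ T ∈ D, ∀ S ⊆ T, S ∈ D)
    (hext : ∀ T ∈ D, T.card < k →
      (((V \ T).filter fun x => insert x T ∉ D).card : ℝ) ≤ c * V.card)
    (hcμ : k * c * (4 ^ k * k.factorial : ℝ) ≤ μ / 2) (hr : 0 < r) (hμ : 0 < μ)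
    (S : Finset A) : S ∈ shadow j (E.filter fun e => e ∈ D) ↔ S ∈ D ∧ S.card = j := by
  constructor
  · intro h
    refine ⟨?_, card_of_mem_shadow h⟩
    unfold _root_.shadow at h
    obtain ⟨e, he, h2⟩ := mem_biUnion.1 h
    exact hdown e (mem_filter.1 he).2 S (mem_powersetCard.1 h2).1
  · rintro ⟨hS, hSj⟩
    have h := clean_deg hjd hdk hc hkt hE hdeg hDV hext hcμ S hS hSj
    have hpos : 0 < (r + μ / 2) * (((V.card - j).choose (k - j) : ℕ) : ℝ) := by
      refine mul_pos (by linarith) ?_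
      exact_mod_cast Nat.choose_pos (by omega)
    have hc0 : 0 < ((E.filter fun e => e ∈ D).filter fun e => S ⊆ e).card := by
      exact_mod_cast hpos.trans_le h
    obtain ⟨e, he⟩ := card_pos.1 hc0
    obtain ⟨h1, h2⟩ := mem_filter.1 he
    unfold _root_.shadow
    exact mem_biUnion.2 ⟨e, h1, mem_powersetCard.2 ⟨h2, hSj⟩⟩

lemma clean_dirty' {k : ℕ} {V V' : Finset A} {D : Finset (Finset A)} {c α : ℝ} (hc : 0 ≤ c)
    (hV' : V' ⊆ V) (ht : V.card ≤ 2 * V'.card) (hkt : 4 * k ≤ V.card)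
    (hDV : ∀ T ∈ D, T ⊆ V)
    (hext : ∀ T ∈ D, T.card < k →
      (((V \ T).filter fun x => insert x T ∉ D).card : ℝ) ≤ c * V.card)
    (hcα : k * c * (4 ^ k * k.factorial : ℝ) ≤ α)
    (j m : ℕ) (hjm : j + m ≤ k) (T : Finset A) (hT : T ∈ D) (hTj : T.card = j) :
    (((V'.powersetCard (j + m)).filter fun S => T ⊆ S ∧ S ∉ D).card : ℝ)
        ≤ α * (((V'.card - j).choose m : ℕ) : ℝ) := by
  have h2 := dirty_count hc hDV hext m T hT (by omega)
  rw [hTj] at h2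
  have h3 : (((V'.powersetCard (j + m)).filter fun S => T ⊆ S ∧ S ∉ D).card : ℝ)
      ≤ (((V.powersetCard (j + m)).filter fun S => T ⊆ S ∧ S ∉ D).card : ℝ) := by
    exact_mod_cast card_le_card (filter_subset_filter _ (powersetCard_mono hV'))
  have h4 := pow_le_K (t := V.card) (t' := V'.card) (j := j) (m := m) ht hkt hjm
  set Q : ℝ := (((V'.card - j).choose m : ℕ) : ℝ)
  have hQ : 0 ≤ Q := by positivity
  have a1 : (m : ℝ) ≤ k := by exact_mod_cast (by omega : m ≤ k)
  refine h3.trans (h2.trans ?_)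
  calc (m : ℝ) * c * (V.card : ℝ) ^ m
      ≤ k * c * ((4 ^ k * k.factorial : ℝ) * Q) :=
        mul_le_mul (mul_le_mul_of_nonneg_right a1 hc) h4 (by positivity) (by positivity)
    _ = k * c * (4 ^ k * k.factorial : ℝ) * Q := by ring
    _ ≤ _ := mul_le_mul_of_nonneg_right hcα hQ

lemma clean_perturbed {k d : ℕ} (hdk : d < k) {V V' : Finset A}
    {E D : Finset (Finset A)}
    {c r μ α : ℝ} (hc : 0 ≤ c) (hα : 0 < α) (hV' : V' ⊆ V) (ht : V.card ≤ 2 * V'.card)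
    (hkt : 4 * k ≤ V.card)
    (hE : ∀ e ∈ E, e ⊆ V ∧ e.card = k)
    (hdeg : ∀ S ⊆ V, S.card = d → (r + μ) * (((V.card - d).choose (k - d) : ℕ) : ℝ)
      ≤ ((E.filter fun e => S ⊆ e).card : ℝ))
    (hDV : ∀ T ∈ D, T ⊆ V) (hdown : ∀ T ∈ D, ∀ S ⊆ T, S ∈ D) (hD0 : ∅ ∈ D)
    (hext : ∀ T ∈ D, T.card < k →
      (((V \ T).filter fun x => insert x T ∉ D).card : ℝ) ≤ c * V.card)
    (hcμ : k * c * (4 ^ k * k.factorial : ℝ) ≤ μ / 2)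
    (hcα : k * c * (4 ^ k * k.factorial : ℝ) ≤ α / 2) (hr : 0 < r) (hμ : 0 < μ) :
    PerturbedDegLB k d α (r + μ / 2) V' (E.filter fun e => e ∈ D) := by
  intro j hj1 hjd
  have hsh : ∀ i ≤ d, ∀ S, S ∈ shadow i (E.filter fun e => e ∈ D) ↔ S ∈ D ∧ S.card = i :=
    fun i hi S => clean_shadow hi hdk hc hkt hE hdeg hDV hdown hext hcμ hr hμ S
  have hdir := clean_dirty' hc hV' ht hkt hDV hext hcα
  refine ⟨?_, ?_, ?_⟩
  · intro S hS
    obtain ⟨h1, h2⟩ := (hsh j hjd S).1 hS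
    refine le_trans ?_ (clean_deg hjd hdk hc hkt hE hdeg hDV hext hcμ S h1 h2)
    refine mul_le_mul_of_nonneg_left ?_ (by linarith)
    exact_mod_cast Nat.choose_le_choose _ (Nat.sub_le_sub_right (card_le_card hV') _)
  · have h := hdir 0 j (by omega) ∅ hD0 card_empty
    rw [zero_add, Nat.sub_zero] at h
    have heq : (V'.powersetCard j).filter (fun S => S ∉ shadow j (E.filter fun e => e ∈ D))
        ⊆ (V'.powersetCard j).filter fun S => ∅ ⊆ S ∧ S ∉ D := by
      intro S hS
      obtain ⟨h1, h2⟩ := mem_filter.1 hS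
      refine mem_filter.2 ⟨h1, empty_subset _, fun h => h2 ?_⟩
      exact (hsh j hjd S).2 ⟨h, (mem_powersetCard.1 h1).2⟩
    have h' : (((V'.powersetCard j).filter
        (fun S => S ∉ shadow j (E.filter fun e => e ∈ D))).card : ℝ)
        ≤ (((V'.powersetCard j).filter fun S => ∅ ⊆ S ∧ S ∉ D).card : ℝ) := by
      exact_mod_cast card_le_card heq
    refine h'.trans (h.trans ?_)
    exact mul_le_mul_of_nonneg_right (by linarith) (by positivity)
  · intro T hT
    have hT' : T ∈ D ∧ T.card = j - 1 := by
      rcases hT with hT | ⟨rfl, rfl⟩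
      · exact (hsh (j - 1) (by omega) T).1 hT
      · exact ⟨hD0, by simp⟩
    have h := hdir (j - 1) 1 (by omega) T hT'.1 hT'.2
    rw [Nat.sub_add_cancel hj1, Nat.choose_one_right] at h
    have heq : (V'.powersetCard j).filter (fun S => T ⊆ S ∧ S ∉ shadow j (E.filter fun e => e ∈ D))
        ⊆ (V'.powersetCard j).filter fun S => T ⊆ S ∧ S ∉ D := by
      intro S hS
      obtain ⟨h1, h2, h3⟩ := mem_filter.1 hS
      refine mem_filter.2 ⟨h1, h2, fun h => h3 ?_⟩
      exact (hsh j hjd S).2 ⟨h, (mem_powersetCard.1 h1).2⟩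
    have h' : (((V'.powersetCard j).filter
        (fun S => T ⊆ S ∧ S ∉ shadow j (E.filter fun e => e ∈ D))).card : ℝ)
        ≤ (((V'.powersetCard j).filter fun S => T ⊆ S ∧ S ∉ D).card : ℝ) := by
      exact_mod_cast card_le_card heq
    have hlt : j - 1 < V'.card := by omega
    have hcast : ((V'.card - (j - 1) : ℕ) : ℝ) = (V'.card : ℝ) - j + 1 := by
      rw [Nat.cast_sub hlt.le, Nat.cast_sub hj1]; push_cast; ring
    have hpos : (0 : ℝ) < ((V'.card - (j - 1) : ℕ) : ℝ) := by
      exact_mod_cast (by omega : 0 < V'.card - (j - 1))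
    rw [← hcast]
    refine h'.trans_lt (h.trans_lt ?_)
    exact mul_lt_mul_of_pos_right (by linarith) hpos

/-- (F5) -/
lemma clean_F5 {k d : ℕ} (hd : 1 ≤ d) (hdk : d < k) {V' : Finset A}
    {E D : Finset (Finset A)} {C : Finset A → Finset (Finset A)} {γ δ : ℝ}
    (hγ : 0 < γ) (hγ2 : γ ≤ 1 / 2) (hδ : 0 < δ)
    (hkt : k ≤ V'.card)
    (hE : ∀ e ∈ E, e ⊆ V' ∧ e.card = k)
    (hsh : ∀ S, S ∈ shadow d E ↔ S ∈ D ∧ S.card = d)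
    (hlink : ∀ S ∈ shadow d E, C S ⊆ link S E)
    (hC : ∀ S ∈ shadow d E, (1 - δ + 2 * γ) * ((V'.card.choose (k - d) : ℕ) : ℝ) ≤ ((C S).card : ℝ))
    (v : A) (hv : v ∈ V')
    (hdir : (((V'.powersetCard d).filter fun S => {v} ⊆ S ∧ S ∉ D).card : ℝ)
      ≤ γ / 2 * (((V'.card - 1).choose (d - 1) : ℕ) : ℝ)) :
    (1 - δ + γ) * (((V'.card - 1).choose (k - 1) : ℕ) : ℝ)
      ≤ (((generatedEdges d E C).filter fun e => v ∈ e).card : ℝ) := by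
  by_cases hneg : 1 - δ + γ ≤ 0
  · exact (mul_nonpos_of_nonpos_of_nonneg hneg (by positivity)).trans (by positivity)
  push Not at hneg
  set P := (shadow d E).filter fun S => v ∈ S with hP
  set H := (generatedEdges d E C).filter fun e => v ∈ e with hH
  have hSc : ∀ S ∈ shadow d E, S.card = d := fun S hS => card_of_mem_shadow hS
  have hgk : ∀ e ∈ generatedEdges d E C, e.card = k := by
    intro e he
    unfold generatedEdges at he
    obtain ⟨S', hS', h2⟩ := mem_biUnion.1 he
    obtain ⟨B, hB, rfl⟩ := mem_image.1 h2
    exact (hE _ (mem_link_iff.1 (hlink S' hS' hB)).2).2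
  -- size of P
  have hPc : (1 - γ / 2) * (((V'.card - 1).choose (d - 1) : ℕ) : ℝ) ≤ (P.card : ℝ) := by
    have h1 := card_super (singleton_subset_iff.2 hv) (d - 1)
    rw [card_singleton, Nat.add_sub_cancel' hd] at h1
    have h2 : ((V'.powersetCard d).filter fun S => {v} ⊆ S).card ≤ P.card +
        ((V'.powersetCard d).filter fun S => {v} ⊆ S ∧ S ∉ D).card := by
      refine (card_le_card ?_).trans (card_union_le _ _)
      intro S hS
      obtain ⟨h3, h4⟩ := mem_filter.1 hS
      by_cases hSD : S ∈ D
      · exact mem_union_left _ (mem_filter.2 ⟨(hsh S).2 ⟨hSD, (mem_powersetCard.1 h3).2⟩,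
          singleton_subset_iff.1 h4⟩)
      · exact mem_union_right _ (mem_filter.2 ⟨h3, h4, hSD⟩)
    rw [h1] at h2
    have h2' : (((V'.card - 1).choose (d - 1) : ℕ) : ℝ) ≤ P.card +
        (((V'.powersetCard d).filter fun S => {v} ⊆ S ∧ S ∉ D).card : ℝ) := by exact_mod_cast h2
    linarith
  -- double count
  have h1 : (P.card : ℝ) * ((1 - δ + 2 * γ) * ((V'.card.choose (k - d) : ℕ) : ℝ))
      ≤ ∑ S ∈ P, ((H.filter fun e => S ⊆ e).card : ℝ) := by
    rw [← nsmul_eq_mul, ← sum_const]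
    refine sum_le_sum fun S hS => ?_
    obtain ⟨hS1, hS2⟩ := mem_filter.1 hS
    refine (hC S hS1).trans ?_
    norm_cast
    refine card_le_card_of_injOn (fun B => B ∪ S) ?_ ?_
    · intro B hB
      refine mem_coe.2 (mem_filter.2 ⟨mem_filter.2 ⟨mem_generated hS1 (mem_coe.1 hB),
        mem_union_right _ hS2⟩, subset_union_right⟩)
    · intro B hB B' hB' h
      have h' : B ∪ S = B' ∪ S := h
      have d1 := (mem_link_iff.1 (hlink S hS1 (mem_coe.1 hB))).1
      have d2 := (mem_link_iff.1 (hlink S hS1 (mem_coe.1 hB'))).1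
      rw [← union_sdiff_cancel_right d1, h', union_sdiff_cancel_right d2]
  have h2 : ∑ S ∈ P, (H.filter fun e => S ⊆ e).card = ∑ e ∈ H, (P.filter fun S => S ⊆ e).card :=
    sum_card_bipartiteAbove_eq_sum_card_bipartiteBelow (fun T F : Finset A => T ⊆ F)
  have h3 : ∑ e ∈ H, (P.filter fun S => S ⊆ e).card ≤ ∑ e ∈ H, (k - 1).choose (d - 1) := by
    refine sum_le_sum fun e he => ?_
    obtain ⟨he1, he2⟩ := mem_filter.1 he
    have h4 := card_super (singleton_subset_iff.2 he2) (d - 1)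
    rw [card_singleton, Nat.add_sub_cancel' hd, hgk e he1] at h4
    rw [← h4]
    refine card_le_card fun S hS => ?_
    obtain ⟨h5, h6⟩ := mem_filter.1 hS
    obtain ⟨h7, h8⟩ := mem_filter.1 h5
    exact mem_filter.2 ⟨mem_powersetCard.2 ⟨h6, hSc S h7⟩, singleton_subset_iff.2 h8⟩
  rw [sum_const, smul_eq_mul, ← h2] at h3
  have h3' : ∑ S ∈ P, ((H.filter fun e => S ⊆ e).card : ℝ) ≤ H.card * ((k - 1).choose (d - 1) : ℝ) := by
    exact_mod_cast h3
  have hch := Nat.choose_mul (n := V'.card - 1) (k := k - 1) (s := d - 1) (by omega)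
  have e1 : V'.card - 1 - (d - 1) = V'.card - d := by omega
  have e2 : k - 1 - (d - 1) = k - d := by omega
  rw [e1, e2] at hch
  have hch' : ((V'.card - 1).choose (k - 1) : ℝ) * ((k - 1).choose (d - 1) : ℝ)
      = ((V'.card - 1).choose (d - 1) : ℝ) * ((V'.card - d).choose (k - d) : ℝ) := by
    exact_mod_cast hch
  have hmono : ((V'.card - d).choose (k - d) : ℝ) ≤ (V'.card.choose (k - d) : ℝ) := by
    exact_mod_cast Nat.choose_le_choose _ (Nat.sub_le _ _)
  have hpos : (0 : ℝ) < ((k - 1).choose (d - 1) : ℝ) := by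
    exact_mod_cast Nat.choose_pos (by omega)
  refine le_of_mul_le_mul_right ?_ hpos
  rw [mul_assoc, hch']
  refine le_trans ?_ (h1.trans h3')
  set a : ℝ := ((V'.card - 1).choose (d - 1) : ℝ)
  have ha : 0 ≤ a := by positivity
  have hcoef : 1 - δ + γ ≤ (1 - γ / 2) * (1 - δ + 2 * γ) := by nlinarith
  calc (1 - δ + γ) * (a * ((V'.card - d).choose (k - d) : ℝ))
      ≤ ((1 - γ / 2) * (1 - δ + 2 * γ)) * (a * (V'.card.choose (k - d) : ℝ)) := by
        refine mul_le_mul hcoef (mul_le_mul_of_nonneg_left hmono ha) (by positivity) ?_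
        linarith
    _ = ((1 - γ / 2) * a) * ((1 - δ + 2 * γ) * (V'.card.choose (k - d) : ℝ)) := by ring
    _ ≤ _ := mul_le_mul_of_nonneg_right hPc (mul_nonneg (by linarith) (by positivity))

lemma framework_core {k d : ℕ} (hd : 1 ≤ d) (hdk : d < k) {V V' : Finset A}
    {E D : Finset (Finset A)} {C : Finset A → Finset (Finset A)} {c γ δ a : ℝ}
    (hc : 0 ≤ c) (hca : c ≤ a) (hγ : 0 < γ) (hγ2 : γ ≤ 1 / 2) (hγk : 2 * k * γ ≤ 1) (hδ : 0 < δ)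
    (hV' : V' ⊆ V) (hV'c : (1 - c) * (V.card : ℝ) ≤ V'.card) (ht : V.card ≤ 2 * V'.card)
    (hkt : 4 * k ≤ V.card) (hbig : 4 * (k : ℝ) ^ 2 ≤ γ * V'.card)
    (hE : ∀ e ∈ E, e ⊆ V' ∧ e.card = k)
    (hDV : ∀ T ∈ D, T ⊆ V) (hdown : ∀ T ∈ D, ∀ S ⊆ T, S ∈ D) (hsing : ∀ v ∈ V', {v} ∈ D)
    (hedge : ∀ v ∈ V', ∃ e ∈ E, v ∈ e)
    (hext : ∀ T ∈ D, T.card < k →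
      (((V \ T).filter fun x => insert x T ∉ D).card : ℝ) ≤ c * V.card)
    (hcγ : k * c * (4 ^ k * k.factorial : ℝ) ≤ γ / 2)
    (hsh : ∀ S, S ∈ shadow d E ↔ S ∈ D ∧ S.card = d)
    (hvic : IsHamVicinity k d (2 * γ) δ V' E C) :
    IsHamFramework k a γ δ V V' (generatedEdges d E C) := by
  obtain ⟨hlink, hT, hint, hsw, harc, hfm, hsize⟩ := hvic
  have hkR : (2 : ℝ) ≤ k := by exact_mod_cast (by omega : 2 ≤ k)
  have hdkR : (d : ℝ) ≤ k := by exact_mod_cast hdk.le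
  have hdR : (1 : ℝ) ≤ d := by exact_mod_cast hd
  have htR : (V.card : ℝ) ≤ 2 * V'.card := by exact_mod_cast ht
  have ht'0 : (0 : ℝ) ≤ V'.card := by positivity
  have hK4 : (4 : ℝ) ≤ 4 ^ k * k.factorial := by
    have h1 : (4 : ℝ) ^ 1 ≤ 4 ^ k := pow_le_pow_right₀ (by norm_num) (by omega)
    have h2 : (1 : ℝ) ≤ k.factorial := by exact_mod_cast Nat.factorial_pos k
    nlinarith
  have h4kc : 4 * (k * c) ≤ γ / 2 := by
    have : (k * c) * 4 ≤ k * c * (4 ^ k * k.factorial : ℝ) :=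
      mul_le_mul_of_nonneg_left hK4 (by positivity)
    linarith
  have hct : k * (c * V.card) ≤ γ / 4 * V'.card := by
    have h1 : (k * c) * (V.card : ℝ) ≤ (k * c) * (2 * V'.card) :=
      mul_le_mul_of_nonneg_left htR (by positivity)
    have h2 : (k * c) * (2 * (V'.card : ℝ)) ≤ γ / 8 * (2 * V'.card) :=
      mul_le_mul_of_nonneg_right (by linarith) (by positivity)
    linarith
  have hbadx : ∀ S ∈ shadow d E, ∀ s ∈ S,
      (((V' \ S).filter fun x => insert x (S.erase s) ∉ shadow d E).card : ℝ) ≤ c * V.card := by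
    intro S hS s hs
    obtain ⟨hSD, hSc⟩ := (hsh S).1 hS
    have hec : (S.erase s).card = d - 1 := by rw [card_erase_of_mem hs, hSc]
    have h1 := hext (S.erase s) (hdown S hSD _ (erase_subset _ _)) (by omega)
    refine le_trans ?_ h1
    norm_cast
    refine card_le_card fun x hx => ?_
    obtain ⟨h2, h3⟩ := mem_filter.1 hx
    obtain ⟨h4, h5⟩ := mem_sdiff.1 h2
    have hxe : x ∉ S.erase s := fun h => h5 (mem_of_mem_erase h)
    refine mem_filter.2 ⟨mem_sdiff.2 ⟨hV' h4, hxe⟩, fun h => h3 ?_⟩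
    refine (hsh _).2 ⟨h, ?_⟩
    rw [card_insert_of_notMem hxe, hec]; omega
  have hext2 : ∀ S ∈ shadow d E, ∀ s ∈ S, ∀ S' ∈ shadow d E, ∀ s' ∈ S',
      ∃ x, insert x (S.erase s) ∈ shadow d E ∧ insert x (S'.erase s') ∈ shadow d E := by
    intro S hS s hs S' hS' s' hs'
    by_contra hno
    push Not at hno
    have hsub : V' ⊆ (S ∪ S') ∪
        (((V' \ S).filter fun x => insert x (S.erase s) ∉ shadow d E) ∪
         ((V' \ S').filter fun x => insert x (S'.erase s') ∉ shadow d E)) := by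
      intro x hx
      by_cases h1 : x ∈ S
      · exact mem_union_left _ (mem_union_left _ h1)
      by_cases h2 : x ∈ S'
      · exact mem_union_left _ (mem_union_right _ h2)
      refine mem_union_right _ ?_
      by_cases h3 : insert x (S.erase s) ∈ shadow d E
      · exact mem_union_right _ (mem_filter.2 ⟨mem_sdiff.2 ⟨hx, h2⟩, hno x h3⟩)
      · exact mem_union_left _ (mem_filter.2 ⟨mem_sdiff.2 ⟨hx, h1⟩, h3⟩)
    have h1 := (card_le_card hsub).trans (card_union_le _ _)
    have h2 := card_union_le S S'
    have h3 := card_union_le ((V' \ S).filter fun x => insert x (S.erase s) ∉ shadow d E)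
      ((V' \ S').filter fun x => insert x (S'.erase s') ∉ shadow d E)
    rw [((hsh S).1 hS).2, ((hsh S').1 hS').2] at h2
    have h4 : (V'.card : ℝ) ≤ (d + d) +
        ((((V' \ S).filter fun x => insert x (S.erase s) ∉ shadow d E).card : ℝ) +
        (((V' \ S').filter fun x => insert x (S'.erase s') ∉ shadow d E).card : ℝ)) := by
      exact_mod_cast h1.trans (add_le_add h2 h3)
    have h5 := hbadx S hS s hs
    have h6 := hbadx S' hS' s' hs'
    have h7 : c * (V.card : ℝ) ≤ k * (c * V.card) := by
      have : 0 ≤ c * (V.card : ℝ) := by positivity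
      nlinarith
    have h8 : γ * (V'.card : ℝ) ≤ 1 / 2 * V'.card := mul_le_mul_of_nonneg_right hγ2 ht'0
    nlinarith
  have hCcard : ∀ S ∈ shadow d E, ∀ e ∈ C S, e.card = k - d := by
    intro S hS e he
    obtain ⟨h1, h2⟩ := mem_link_iff.1 (hlink S hS he)
    have := (hE _ h2).2
    rw [card_union_of_disjoint h1, ((hsh S).1 hS).2] at this
    omega
  have hshv : ∀ v ∈ V', ∃ S ∈ shadow d E, v ∈ S := by
    intro v hv
    obtain ⟨e, he, hve⟩ := hedge v hv
    obtain ⟨S, h1, h2, h3⟩ := exists_subsuperset_card_eq (singleton_subset_iff.2 hve)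
      (n := d) (by simpa using hd) (by rw [(hE e he).2]; omega)
    refine ⟨S, ?_, singleton_subset_iff.1 h1⟩
    unfold _root_.shadow
    exact mem_biUnion.2 ⟨e, he, mem_powersetCard.2 ⟨h2, h3⟩⟩
  obtain ⟨n, rfl⟩ : ∃ n, k = d + (n + 1) := ⟨k - d - 1, by omega⟩
  have hkd : d + (n + 1) - d = n + 1 := by omega
  rw [hkd] at hT hCcard
  refine ⟨?_, gen_tight hCcard hT hint hsw hext2, gen_closed hd hCcard hT hint hsw hext2 harc,
    ?_, ?_⟩
  · refine le_trans ?_ hV'c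
    exact mul_le_mul_of_nonneg_right (by linarith) (by positivity)
  · refine robust hd hdk hE hlink hfm hshv hbadx hγ hγk ?_
    have h1 : d * (c * (V.card : ℝ)) ≤ ((d + (n + 1) : ℕ) : ℝ) * (c * V.card) :=
      mul_le_mul_of_nonneg_right hdkR (by positivity)
    have h2 : (d : ℝ) * d ≤ ((d + (n + 1) : ℕ) : ℝ) ^ 2 := by
      rw [pow_two]; exact mul_le_mul hdkR hdkR (by positivity) (by positivity)
    nlinarith
  · intro v hv
    refine clean_F5 hd hdk hγ hγ2 hδ (by omega) hE hsh hlink hsize v hv ?_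
    have := clean_dirty' hc hV' ht hkt hDV hext hcγ 1 (d - 1) (by omega) {v} (hsing v hv)
      (card_singleton v)
    rwa [Nat.add_sub_cancel' hd] at this

/-- Vicinity Theorem: `hf_d(k) ≤ hv_d(k)`. -/
theorem vicinity_theorem (k d : ℕ) (hk : 2 ≤ k) (hd : 1 ≤ d) (hdk : d ≤ k - 1)
    (δ : ℝ) (hδ : 0 < δ) (h : HamVicinityProp k d δ) :
    HamFrameworkProp k d δ := by
  have hdk' : d < k := by omega
  have hkR : (2 : ℝ) ≤ k := by exact_mod_cast hk
  intro μ hμ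
  obtain ⟨γ0, hγ0, h1⟩ := h (μ / 2) (by linarith)
  refine ⟨min (γ0 / 2) (1 / (2 * k)), by positivity, fun γ hγ hγle => ?_⟩
  have hγa : 2 * γ ≤ γ0 := by
    have := hγle.trans (min_le_left _ _); linarith
  have hγk : 2 * k * γ ≤ 1 := by
    have := hγle.trans (min_le_right _ _)
    rw [le_div_iff₀ (by positivity)] at this
    linarith
  have hγ2 : γ ≤ 1 / 2 := by nlinarith
  obtain ⟨α, hα, h2⟩ := h1 (2 * γ) (by linarith) hγa
  obtain ⟨t1, h3⟩ := h2 α hα le_rfl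
  refine ⟨1, one_pos, fun a ha _ => ?_⟩
  set K : ℝ := 4 ^ k * k.factorial with hK
  have hK1 : 1 ≤ K := by
    have h1 : (1 : ℝ) ≤ 4 ^ k := one_le_pow₀ (by norm_num)
    have h2 : (1 : ℝ) ≤ k.factorial := by exact_mod_cast Nat.factorial_pos k
    rw [hK]; nlinarith
  set m : ℝ := min a (min (μ / 2) (min (α / 2) (γ / 2))) with hm
  have hmpos : 0 < m := by
    refine lt_min ha (lt_min (by linarith) (lt_min (by linarith) (by linarith)))
  have hma : m ≤ a := min_le_left _ _
  have hmμ : m ≤ μ / 2 := (min_le_right _ _).trans (min_le_left _ _)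
  have hmα : m ≤ α / 2 := (min_le_right _ _).trans ((min_le_right _ _).trans (min_le_left _ _))
  have hmγ : m ≤ γ / 2 := (min_le_right _ _).trans ((min_le_right _ _).trans (min_le_right _ _))
  set c : ℝ := m / (k * K) with hcdef
  have hkK : 0 < k * K := by positivity
  have hcpos : 0 < c := by positivity
  have hckK : k * c * K = m := by rw [hcdef]; field_simp
  have hcm : c ≤ m := by
    rw [hcdef, div_le_iff₀ hkK]
    have : 1 ≤ k * K := by nlinarith
    nlinarith
  refine ⟨(c / 2 ^ k) ^ k / 2, by positivity, fun ε hε hεle => ?_⟩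
  refine ⟨2 * t1 + 4 * k + 2 * ⌈4 * (k : ℝ) ^ 2 / γ⌉₊, ?_⟩
  intro t ht B _ V E hVt hE hdeg I hIE hI
  subst hVt
  have htpos : (0 : ℝ) < V.card := by
    exact_mod_cast (by omega : 0 < V.card)
  set θ : ℝ := c / 2 ^ k * V.card with hθ
  have hθpos : 0 < θ := by positivity
  have hsmall : (k.factorial : ℝ) * I.card < θ ^ k := by
    have a1 : (k.factorial : ℝ) * (V.card.choose k : ℝ) ≤ (V.card : ℝ) ^ k := by
      have := Nat.descFactorial_le_pow V.card k
      rw [Nat.descFactorial_eq_factorial_mul_choose] at this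
      exact_mod_cast this
    have a2 : (k.factorial : ℝ) * I.card ≤ ε * (V.card : ℝ) ^ k := by
      calc (k.factorial : ℝ) * I.card ≤ k.factorial * (ε * (V.card.choose k : ℝ)) :=
            mul_le_mul_of_nonneg_left hI (by positivity)
        _ = ε * (k.factorial * (V.card.choose k : ℝ)) := by ring
        _ ≤ _ := mul_le_mul_of_nonneg_left a1 hε.le
    have a3 : ε < (c / 2 ^ k) ^ k := by
      have : 0 < (c / 2 ^ k) ^ k := by positivity
      linarith
    rw [hθ, mul_pow]
    exact a2.trans_lt (mul_lt_mul_of_pos_right a3 (by positivity))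
  obtain ⟨D, hDV, hdown, hD0, hDI, hext⟩ := cleaning hθpos (fun e he => hE e (hIE he)) hsmall
  have e2 : 2 ^ k * θ = c * V.card := by rw [hθ]; field_simp
  rw [e2] at hext
  set V' : Finset B := V.filter fun v => {v} ∈ D with hV'def
  have hV' : V' ⊆ V := filter_subset _ _
  have hV'c : (1 - c) * (V.card : ℝ) ≤ V'.card := clean_card (by omega : 0 < k) hD0 hext
  have ht2 : V.card ≤ 2 * V'.card := by
    have : (V.card : ℝ) ≤ 2 * V'.card := by nlinarith
    exact_mod_cast this
  have hkt : 4 * k ≤ V.card := by omega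
  have hbig : 4 * (k : ℝ) ^ 2 ≤ γ * V'.card := by
    have b1 : ⌈4 * (k : ℝ) ^ 2 / γ⌉₊ ≤ V'.card := by omega
    have b2 := (Nat.le_ceil (4 * (k : ℝ) ^ 2 / γ)).trans (Nat.cast_le.2 b1)
    rw [div_le_iff₀ hγ] at b2
    linarith
  have hcμ : k * c * (4 ^ k * k.factorial : ℝ) ≤ μ / 2 := by rw [← hK, hckK]; exact hmμ
  have hcα : k * c * (4 ^ k * k.factorial : ℝ) ≤ α / 2 := by rw [← hK, hckK]; exact hmα
  have hcγ : k * c * (4 ^ k * k.factorial : ℝ) ≤ γ / 2 := by rw [← hK, hckK]; exact hmγ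
  have hsh : ∀ i ≤ d, ∀ S, S ∈ shadow i (E.filter fun e => e ∈ D) ↔ S ∈ D ∧ S.card = i :=
    fun i hi S => clean_shadow hi hdk' hcpos.le hkt hE hdeg hDV hdown hext hcμ hδ hμ S
  have hE' : ∀ e ∈ E.filter (fun e => e ∈ D), e ⊆ V' ∧ e.card = k := by
    intro e he
    obtain ⟨b1, b2⟩ := mem_filter.1 he
    exact ⟨clean_sub hDV hdown e b2, (hE e b1).2⟩
  have hsing : ∀ v ∈ V', {v} ∈ D := fun v hv => (mem_filter.1 hv).2
  have hedge : ∀ v ∈ V', ∃ e ∈ E.filter (fun e => e ∈ D), v ∈ e := by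
    intro v hv
    have := (hsh 1 hd {v}).2 ⟨hsing v hv, card_singleton v⟩
    unfold _root_.shadow at this
    obtain ⟨e, he, b⟩ := mem_biUnion.1 this
    exact ⟨e, he, singleton_subset_iff.1 (mem_powersetCard.1 b).1⟩
  have hpert := clean_perturbed hdk' hcpos.le hα hV' ht2 hkt hE hdeg hDV hdown hD0 hext hcμ hcα hδ hμ
  obtain ⟨C, hC⟩ := h3 V'.card (by omega) B V' (E.filter fun e => e ∈ D) rfl hE' hpert hedge
  have hgen : generatedEdges d (E.filter fun e => e ∈ D) C ⊆ E.filter fun e => e ∈ D := by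
    intro e he
    unfold generatedEdges at he
    obtain ⟨S', hS', b2⟩ := mem_biUnion.1 he
    obtain ⟨X, hX, rfl⟩ := mem_image.1 b2
    exact (mem_link_iff.1 (hC.1 S' hS' hX)).2
  refine ⟨V', generatedEdges d (E.filter fun e => e ∈ D) C, hV', hgen.trans (filter_subset _ _),
    fun e he => (hE' e (hgen he)).1, fun e he hI => hDI e hI (mem_filter.1 (hgen he)).2, ?_⟩
  exact framework_core hd hdk' hcpos.le (hcm.trans hma) hγ hγ2 hγk hδ hV' hV'c ht2 hkt hbig hE' hDV
    hdown hsing hedge hext hcγ (hsh d le_rfl) hC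
end

section
/- Let k ≥ 2 and 1 ≤ d ≤ k−1, and set δ = 2^(−1/(k−d)). For every μ > 0 there exists γ_0 > 0 such that for every 0 < γ ≤ γ_0 there exists α_0 > 0 such that for every 0 < α ≤ α_0 there exists t_0 such that for every t ≥ t_0: every k-graph R on t vertices with α-perturbed minimum relative d-degree at least δ + μ and no isolated vertices admits a (γ, δ)-Hamilton d-vicinity. (Equivalently, the Hamilton vicinity threshold satisfies hv_d(k) ≤ 2^(−1/(k−d)).) -/
open Finset

variable {A : Type*} [DecidableEq A]

section helpers

theorem tight_cons {l : ℕ} {K : Finset (Finset A)} {w : List A} {x : A}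
    (h : IsTightWalk l K w) (hx : ((x :: w).take l).toFinset ∈ K) : IsTightWalk l K (x :: w) := by
  refine ⟨by have := h.1; simp; omega, ?_⟩
  intro i hi
  cases i with
  | zero => simpa [walkEdgeAt] using hx
  | succ i =>
    have := h.2 i (by simp at hi; omega)
    simpa [walkEdgeAt] using this

theorem edgeOn_append {l : ℕ} {w : List A} {e : Finset A} (s : List A)
    (h : EdgeOnWalk l w e) : EdgeOnWalk l (s ++ w) e := by
  obtain ⟨i, hi, he⟩ := h
  refine ⟨s.length + i, by simp; omega, ?_⟩
  rw [← he]
  unfold walkEdgeAt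
  rw [← List.drop_drop, List.drop_left]

theorem walk_extend {l : ℕ} {K : Finset (Finset A)} {a v : A} (q : List A) :
    ∀ (p r : List A), IsTightWalk l K (p ++ a :: q ++ r) → (p ++ a :: q).length = l →
      (p ++ a :: q).Nodup → insert v ((p ++ a :: q).toFinset.erase a) ∈ K →
      (p ++ a :: q).toFinset ∈ K →
      ∃ s, IsTightWalk l K (s ++ (p ++ a :: q ++ r)) ∧
        ((s ++ (p ++ a :: q ++ r)).take l).toFinset = insert v ((p ++ a :: q).toFinset.erase a) := by
  induction q using List.reverseRecOn with
  | nil =>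
    intro p r hw hl hn hv he
    have hap : a ∉ p := by
      intro h
      have := List.nodup_append.1 hn
      exact this.2.2 a h a (by simp) rfl
    have h1 : (p ++ [a]).toFinset.erase a = p.toFinset := by
      ext x; simp only [mem_erase, List.mem_toFinset, List.mem_append, List.mem_singleton]
      constructor
      · rintro ⟨h1, h2 | h2⟩ <;> [exact h2; exact absurd h2 h1]
      · intro h; exact ⟨fun h' => hap (h' ▸ h), Or.inl h⟩
    have h2 : ((v :: (p ++ [a] ++ r)).take l).toFinset = insert v p.toFinset := by
      have : l = (v :: p).length := by simp at hl ⊢; omega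
      rw [this]
      have : v :: (p ++ [a] ++ r) = (v :: p) ++ (a :: r) := by simp
      rw [this, List.take_left]; simp
    rw [h1] at hv ⊢
    refine ⟨[v], tight_cons hw ?_, ?_⟩
    · exact h2 ▸ hv
    · exact h2
  | append_singleton q x ih =>
    intro p r hw hl hn hv he
    have hset : ((x :: p) ++ a :: q).toFinset = (p ++ a :: (q ++ [x])).toFinset := by
      ext y; simp; tauto
    have heq : (x :: p) ++ a :: q ++ (x :: r) = x :: (p ++ a :: (q ++ [x]) ++ r) := by simp
    have hperm : ((x :: p) ++ a :: q).Perm (p ++ a :: (q ++ [x])) := by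
      have : p ++ a :: (q ++ [x]) = (p ++ a :: q) ++ [x] := by simp
      rw [this]
      exact (List.perm_append_singleton x (p ++ a :: q)).symm
    have hl' : ((x :: p) ++ a :: q).length = l := by rw [hperm.length_eq, hl]
    obtain ⟨s, hs, hs'⟩ := ih (x :: p) (x :: r) (by
      rw [heq]
      refine tight_cons hw ?_
      rw [← heq, ← hl', List.take_left, hset]; exact he) hl'
      (hperm.nodup_iff.2 hn) (by rw [hset]; exact hv) (by rw [hset]; exact he)
    refine ⟨s ++ [x], ?_, ?_⟩
    · rw [heq] at hs
      simpa using hs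
    · rw [hset, heq] at hs'
      rw [← hs']
      simp

def tadj (L : Finset (Finset A)) (e f : Finset A) : Prop :=
  e ∈ L ∧ f ∈ L ∧ ∃ a ∈ e, ∃ b ∈ f, e.erase a = f.erase b

theorem tadj_symm {L : Finset (Finset A)} {e f : Finset A} (h : tadj L e f) : tadj L f e := by
  obtain ⟨h1, h2, a, ha, b, hb, h⟩ := h
  exact ⟨h2, h1, b, hb, a, ha, h.symm⟩

theorem walk_of_path {l : ℕ} {L K : Finset (Finset A)} (hL : ∀ e ∈ L, e.card = l) (hKL : K ⊆ L)
    (hK : ∀ e ∈ K, ∀ f, tadj L e f → f ∈ K) {e f : Finset A} (he : e ∈ K)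
    (h : Relation.ReflTransGen (tadj L) e f) :
    f ∈ K ∧ ∃ w, IsTightWalk l K w ∧ EdgeOnWalk l w e ∧ (w.take l).toFinset = f := by
  induction h with
  | refl =>
    have hlen : e.toList.length = l := by simp [hL e (hKL he)]
    have ht : (e.toList.take l).toFinset = e := by rw [← hlen, List.take_length]; simp
    refine ⟨he, e.toList, ⟨hlen.ge, ?_⟩, ⟨0, by omega, by simpa [walkEdgeAt] using ht⟩, ht⟩
    intro i hi
    have : i = 0 := by omega
    subst this
    simpa [walkEdgeAt, ht] using he
  | @tail f g _ hfg ih =>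
    obtain ⟨hf, w, hw, hew, hwf⟩ := ih
    have hg := hK f hf g hfg
    refine ⟨hg, ?_⟩
    obtain ⟨-, hgL, a, ha, b, hb, hab⟩ := hfg
    have hlen : (w.take l).length = l := by simp [hw.1]
    have hnd : (w.take l).Nodup := by
      have h1 : (w.take l).toFinset.card = (w.take l).length := by
        rw [hwf, hlen, hL f (hKL hf)]
      have h2 := (Multiset.toFinset_card_eq_card_iff_nodup (m := (↑(w.take l) : Multiset A))).1 h1
      exact h2
    have ha' : a ∈ w.take l := by rw [← List.mem_toFinset, hwf]; exact ha
    obtain ⟨p, q, hpq⟩ := List.append_of_mem ha'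
    have hw' : w = p ++ a :: q ++ w.drop l := by rw [← hpq, List.take_append_drop]
    have hgi : insert b ((p ++ a :: q).toFinset.erase a) = g := by
      rw [← hpq, hwf, hab, Finset.insert_erase hb]
    obtain ⟨s, hs, hs'⟩ := walk_extend (l := l) (K := K) (a := a) (v := b) q p (w.drop l)
      (hw' ▸ hw) (hpq ▸ hlen) (hpq ▸ hnd) (hgi ▸ hg) (by rw [← hpq, hwf]; exact hf)
    rw [← hw'] at hs hs'
    exact ⟨s ++ w, hs, edgeOn_append s hew, hs'.trans hgi⟩

open Classical in
theorem exists_component {l n : ℕ} (hl : 1 ≤ l) (hln : l ≤ n) (X : Finset A) (hX : X.card = n)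
    (L : Finset (Finset A)) (hLX : L ⊆ X.powersetCard l) (β : ℝ) (hβ : 0 < β)
    (hL : β * (n.choose l : ℝ) ≤ (L.card : ℝ)) :
    ∃ K ⊆ L, K.Nonempty ∧ TightlyConnected l K ∧
      β * ((n : ℝ) - l + 1) * ((Finset.shadow K).card : ℝ) ≤ l * (K.card : ℝ) := by
  have hLc : ∀ e ∈ L, e.card = l := fun e he => (mem_powersetCard.1 (hLX he)).2
  let R := Relation.ReflTransGen (tadj L)
  have Rsymm : ∀ e f, R e f → R f e := fun e f h =>
    (@Relation.ReflTransGen.stdSymm _ (tadj L) ⟨fun _ _ h => tadj_symm h⟩).symm _ _ h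
  let comp : Finset A → Finset (Finset A) := fun e => L.filter (fun f => R e f)
  have hself : ∀ e ∈ L, e ∈ comp e := fun e he => mem_filter.2 ⟨he, Relation.ReflTransGen.refl⟩
  have hcompeq : ∀ e f, R e f → comp e = comp f := by
    intro e f h
    ext g
    simp only [comp, mem_filter, and_congr_right_iff]
    intro _
    exact ⟨fun h' => (Rsymm _ _ h).trans h', fun h' => h.trans h'⟩
  let KK := L.image comp
  have hLpos : 0 < (L.card : ℝ) := lt_of_lt_of_le (mul_pos hβ (by exact_mod_cast Nat.choose_pos hln)) hL
  have hLne : L.Nonempty := by rw [← card_pos]; exact_mod_cast hLpos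
  have hdisj : ∀ K ∈ KK, ∀ K' ∈ KK, ∀ g, g ∈ Finset.shadow K → g ∈ Finset.shadow K' → K = K' := by
    intro K hK K' hK' g hg hg'
    obtain ⟨e, he, rfl⟩ := mem_image.1 hK
    obtain ⟨e', he', rfl⟩ := mem_image.1 hK'
    obtain ⟨f, hf, a, ha, rfl⟩ := mem_shadow_iff.1 hg
    obtain ⟨f', hf', a', ha', h⟩ := mem_shadow_iff.1 hg'
    obtain ⟨hf1, hf2⟩ := mem_filter.1 hf
    obtain ⟨hf1', hf2'⟩ := mem_filter.1 hf'
    have : R f f' := Relation.ReflTransGen.single ⟨hf1, hf1', a, ha, a', ha', h.symm⟩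
    exact hcompeq _ _ ((hf2.trans this).trans (Rsymm _ _ hf2'))
  have hsum1 : (L.card : ℝ) ≤ ∑ K ∈ KK, (K.card : ℝ) := by
    have : L ⊆ KK.biUnion id := by
      intro e he
      exact mem_biUnion.2 ⟨comp e, mem_image_of_mem _ he, hself e he⟩
    exact_mod_cast (card_le_card this).trans card_biUnion_le
  have hsum2 : ∑ K ∈ KK, ((Finset.shadow K).card : ℝ) ≤ (n.choose (l - 1) : ℝ) := by
    have h1 : (KK.biUnion Finset.shadow).card = ∑ K ∈ KK, (Finset.shadow K).card := by
      refine card_biUnion ?_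
      intro K hK K' hK' hne
      show Disjoint (Finset.shadow K) (Finset.shadow K')
      rw [Finset.disjoint_left]
      intro g hg hg'
      exact hne (hdisj K hK K' hK' g hg hg')
    have h2 : KK.biUnion Finset.shadow ⊆ X.powersetCard (l - 1) := by
      intro g hg
      obtain ⟨K, hK, hg⟩ := mem_biUnion.1 hg
      obtain ⟨e, he, rfl⟩ := mem_image.1 hK
      obtain ⟨f, hf, a, ha, rfl⟩ := mem_shadow_iff.1 hg
      have := mem_powersetCard.1 (hLX (mem_filter.1 hf).1)
      refine mem_powersetCard.2 ⟨(erase_subset _ _).trans this.1, ?_⟩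
      rw [card_erase_of_mem ha, this.2]
    have := card_le_card h2
    rw [h1, card_powersetCard, hX] at this
    exact_mod_cast this
  have hch : (l : ℝ) * (n.choose l : ℝ) = ((n : ℝ) - l + 1) * (n.choose (l - 1) : ℝ) := by
    obtain ⟨m, rfl⟩ : ∃ m, l = m + 1 := ⟨l - 1, by omega⟩
    have := Nat.choose_succ_right_eq n m
    have h2 : ((n - m : ℕ) : ℝ) = n - m := by rw [Nat.cast_sub]; omega
    have h3 : (n.choose (m+1) : ℝ) * ((m+1 : ℕ) : ℝ) = n.choose m * ((n - m : ℕ) : ℝ) := by exact_mod_cast this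
    rw [h2] at h3
    simp only [Nat.add_sub_cancel]
    push_cast at h3 ⊢
    linarith
  have hnl : (l : ℝ) ≤ n := by exact_mod_cast hln
  have key : ∑ K ∈ KK, β * ((n : ℝ) - l + 1) * ((Finset.shadow K).card : ℝ) ≤ ∑ K ∈ KK, l * (K.card : ℝ) := by
    rw [← mul_sum, ← mul_sum]
    calc β * ((n : ℝ) - l + 1) * ∑ K ∈ KK, ((Finset.shadow K).card : ℝ)
        ≤ β * ((n : ℝ) - l + 1) * (n.choose (l - 1) : ℝ) := by
          apply mul_le_mul_of_nonneg_left hsum2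
          apply mul_nonneg hβ.le; linarith
      _ = l * (β * (n.choose l : ℝ)) := by rw [mul_assoc, ← hch]; ring
      _ ≤ l * ∑ K ∈ KK, (K.card : ℝ) := by
          apply mul_le_mul_of_nonneg_left (hL.trans hsum1); positivity
  obtain ⟨K, hK, hKle⟩ := Finset.exists_le_of_sum_le (hLne.image comp) key
  obtain ⟨e0, he0, rfl⟩ := mem_image.1 hK
  refine ⟨comp e0, filter_subset _ _, ⟨e0, hself e0 he0⟩, ?_, hKle⟩
  intro e₁ h₁ e₂ h₂
  have hcl : ∀ e ∈ comp e0, ∀ f, tadj L e f → f ∈ comp e0 := by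
    intro e he f hef
    exact mem_filter.2 ⟨hef.2.1, (mem_filter.1 he).2.tail hef⟩
  obtain ⟨-, w, hw, hw1, hw2⟩ := walk_of_path hLc (filter_subset _ _) hcl h₁
    ((Rsymm _ _ (mem_filter.1 h₁).2).trans (mem_filter.1 h₂).2)
  exact ⟨w, hw, hw1, 0, by have := hw.1; omega, by simpa [walkEdgeAt] using hw2⟩

theorem kk_bound {l n m : ℕ} (hl : 1 ≤ l) (hlm : l ≤ m) (hmn : m ≤ n) (X : Finset A)
    (hX : X.card = n) (K : Finset (Finset A)) (hK : K ⊆ X.powersetCard l) (hne : K.Nonempty)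
    (h : m * (Finset.shadow K).card ≤ l * K.card) : m.choose l ≤ K.card := by
  by_contra hlt
  push Not at hlt
  have hex : ∃ y, K.card < (y + 1).choose l := ⟨m, hlt.trans_le (Nat.choose_le_choose _ (by omega))⟩
  classical
  let x := Nat.find hex
  have hx1 : K.card < (x + 1).choose l := Nat.find_spec hex
  have hxl : l ≤ x := by
    by_contra hcon
    have : (x + 1).choose l ≤ l.choose l := Nat.choose_le_choose _ (by omega)
    rw [Nat.choose_self] at this
    have := hne.card_pos
    omega
  have hx2 : x.choose l ≤ K.card := by
    by_contra hcon
    push Not at hcon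
    have := Nat.find_min' hex (m := x - 1) (by
      have : x - 1 + 1 = x := by omega
      rw [this]; exact hcon)
    have : x ≤ x - 1 := this
    omega
  have hxm : x < m := by
    by_contra hcon
    have := Nat.choose_le_choose l (not_lt.1 hcon)
    omega
  -- transfer to Fin n
  have hn : 0 < n := by omega
  let eq : X ≃ Fin n := X.equivFinOfCardEq hX
  let f : A → Fin n := fun a => if ha : a ∈ X then eq ⟨a, ha⟩ else ⟨0, hn⟩
  have finj : Set.InjOn f X := by
    intro a ha b hb hab
    have ha' : a ∈ X := ha
    have hb' : b ∈ X := hb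
    simp only [f, ha', hb', dif_pos] at hab
    simpa using eq.injective hab
  have hKX : ∀ e ∈ K, e ⊆ X := fun e he => (mem_powersetCard.1 (hK he)).1
  let F : Finset A → Finset (Fin n) := fun e => e.image f
  have Finj : Set.InjOn F K := by
    intro e he e' he' hee
    exact Finset.image_injOn_powerset_of_injOn finj (by simpa using hKX e he) (by simpa using hKX e' he') hee
  let K' := K.image F
  have hcard : K'.card = K.card := card_image_of_injOn Finj
  have hsz : (K' : Set (Finset (Fin n))).Sized l := by
    intro s hs
    obtain ⟨e, he, rfl⟩ := mem_image.1 (mem_coe.1 hs)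
    show (e.image f).card = l
    rw [card_image_of_injOn (finj.mono (by exact_mod_cast hKX e he))]
    exact (mem_powersetCard.1 (hK he)).2
  have hsh : Finset.shadow K' ⊆ (Finset.shadow K).image F := by
    intro g hg
    obtain ⟨s, hs, b, hb, rfl⟩ := mem_shadow_iff.1 hg
    obtain ⟨e, he, rfl⟩ := mem_image.1 hs
    obtain ⟨a, ha, rfl⟩ := mem_image.1 hb
    refine mem_image.2 ⟨e.erase a, erase_mem_shadow he ha, ?_⟩
    ext y
    simp only [F, mem_image, mem_erase]
    constructor
    · rintro ⟨c, ⟨hca, hc⟩, rfl⟩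
      exact ⟨fun hh => hca (finj (hKX e he hc) (hKX e he ha) hh), c, hc, rfl⟩
    · rintro ⟨hy, c, hc, rfl⟩
      exact ⟨c, ⟨fun hh => hy (hh ▸ rfl), hc⟩, rfl⟩
  have hkk := Finset.kruskal_katona_lovasz_form (i := 1) (r := l) (k := x) (n := n) (𝒜 := K') hl hxl
    (by omega) hsz (by rw [hcard]; exact hx2)
  rw [Function.iterate_one] at hkk
  have hsc : x.choose (l - 1) ≤ (Finset.shadow K).card :=
    hkk.trans ((card_le_card hsh).trans card_image_le)
  have hid : (x + 1) * x.choose (l - 1) = (x + 1).choose l * l := by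
    obtain ⟨j, rfl⟩ : ∃ j, l = j + 1 := ⟨l - 1, by omega⟩
    exact Nat.add_one_mul_choose_eq x j
  have h1 : (x + 1) * x.choose (l - 1) ≤ m * (Finset.shadow K).card := Nat.mul_le_mul (by omega) hsc
  have h2 : l * K.card < l * (x + 1).choose l := Nat.mul_lt_mul_of_pos_left hx1 (by omega)
  nlinarith

theorem erase_sum (K : Finset (Finset A)) (g : Finset A → ℝ) (e : Finset A) (he : e ∈ K)
    (l : ℕ) (hc : ∀ e ∈ K, e.card = l) :
    ∑ a ∈ e, g (e.erase a) = ∑ f ∈ (Finset.shadow K).filter (fun f => f ⊆ e), g f := by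
  have : (Finset.shadow K).filter (fun f => f ⊆ e) = e.image (fun a => e.erase a) := by
    ext f
    simp only [mem_filter, mem_image]
    constructor
    · rintro ⟨hf, hfe⟩
      obtain ⟨s, hs, a, ha, rfl⟩ := mem_shadow_iff.1 hf
      have h1 : (s.erase a).card + 1 = l := by rw [card_erase_add_one ha, hc s hs]
      have h2 : (e \ s.erase a).card = 1 := by
        rw [card_sdiff_of_subset hfe, hc e he]; omega
      obtain ⟨b, hb⟩ := card_eq_one.1 h2
      have hbe : b ∈ e \ s.erase a := by rw [hb]; simp
      refine ⟨b, (mem_sdiff.1 hbe).1, ?_⟩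
      rw [erase_eq, ← hb, Finset.sdiff_sdiff_eq_self hfe]
    · rintro ⟨a, ha, rfl⟩
      exact ⟨erase_mem_shadow he ha, erase_subset _ _⟩
  rw [this, sum_image]
  intro a ha b hb hab
  exact Finset.erase_injOn e ha hb hab

theorem exists_rich (K : Finset (Finset A)) (hne : K.Nonempty) (l : ℕ) (hl : 1 ≤ l)
    (hc : ∀ e ∈ K, e.card = l) (D : ℝ)
    (h : D * ((Finset.shadow K).card : ℝ) ≤ l * (K.card : ℝ)) :
    ∃ e ∈ K, l * D ≤ ∑ a ∈ e, ((K.filter fun h => e.erase a ⊆ h).card : ℝ) := by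
  let deg : Finset A → ℝ := fun f => ((K.filter fun h => f ⊆ h).card : ℝ)
  have key : ∀ g : Finset A → ℝ, ∑ e ∈ K, ∑ a ∈ e, g (e.erase a)
      = ∑ f ∈ Finset.shadow K, deg f * g f := by
    intro g
    rw [sum_congr rfl (fun e he => erase_sum K g e he l hc)]
    simp_rw [sum_filter]
    rw [sum_comm]
    refine sum_congr rfl fun f _ => ?_
    rw [← sum_filter, sum_const, nsmul_eq_mul]
  have h1 : ∑ f ∈ Finset.shadow K, deg f = l * (K.card : ℝ) := by
    have := key (fun _ => 1)
    simp only [mul_one] at this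
    rw [← this]
    rw [sum_congr rfl (fun e he => by rw [sum_const, hc e he])]
    simp [mul_comm]
  have h2 := key deg
  have hcs := sq_sum_le_card_mul_sum_sq (s := Finset.shadow K) (f := deg)
  rw [h1] at hcs
  have hKpos : (0 : ℝ) < K.card := by exact_mod_cast hne.card_pos
  have hlpos : (0 : ℝ) < l := by exact_mod_cast hl
  have hspos : (0 : ℝ) < (Finset.shadow K).card := by
    obtain ⟨e, he⟩ := hne
    have : e.Nonempty := by rw [← card_pos, hc e he]; omega
    obtain ⟨a, ha⟩ := this
    exact_mod_cast card_pos.2 ⟨_, erase_mem_shadow he ha⟩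
  have h3 : ∑ e ∈ K, l * D ≤ ∑ e ∈ K, ∑ a ∈ e, deg (e.erase a) := by
    rw [h2, sum_const, nsmul_eq_mul]
    simp_rw [← sq]
    set s : ℝ := ((Finset.shadow K).card : ℝ)
    set c : ℝ := (K.card : ℝ)
    have : s * (c * (l * D)) ≤ s * ∑ f ∈ Finset.shadow K, deg f ^ 2 := by
      refine le_trans ?_ hcs
      have : (D * s) * (l * c) ≤ (l * c) * (l * c) :=
        mul_le_mul_of_nonneg_right h (by positivity)
      nlinarith
    exact le_of_mul_le_mul_left this hspos
  exact exists_le_of_sum_le hne h3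

theorem exists_switcher {l n : ℕ} (hl : 1 ≤ l) (X : Finset A)
    (hX : X.card = n) (K : Finset (Finset A)) (hK : K ⊆ X.powersetCard l) (hne : K.Nonempty)
    (D : ℝ) (h : D * ((Finset.shadow K).card : ℝ) ≤ l * (K.card : ℝ))
    (hD : ((l : ℝ) - 1) * ((n : ℝ) - l) + l < l * D) : HasSwitcher K := by
  have hc : ∀ e ∈ K, e.card = l := fun e he => (mem_powersetCard.1 (hK he)).2
  obtain ⟨e, he, hsum⟩ := exists_rich K hne l hl hc D h
  have heX : e ⊆ X := (mem_powersetCard.1 (hK he)).1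
  let N : A → Finset A := fun a => (X \ e).filter fun c => insert c (e.erase a) ∈ K
  have hN : ∀ a ∈ e, ((K.filter fun h => e.erase a ⊆ h).card : ℝ) ≤ (N a).card + 1 := by
    intro a ha
    have : (K.filter fun h => e.erase a ⊆ h) ⊆ insert e ((N a).image fun c => insert c (e.erase a)) := by
      intro g hg
      obtain ⟨hgK, hg⟩ := mem_filter.1 hg
      by_cases hge : g = e
      · rw [hge]; exact mem_insert_self _ _
      apply mem_insert_of_mem
      have h1 : (e.erase a).card + 1 = l := by rw [card_erase_add_one ha, hc e he]
      have h2 : (g \ e.erase a).card = 1 := by rw [card_sdiff_of_subset hg, hc g hgK]; omega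
      obtain ⟨b, hb⟩ := card_eq_one.1 h2
      have hbe : b ∈ g \ e.erase a := by rw [hb]; simp
      have hgb : insert b (e.erase a) = g := by
        have := sdiff_union_of_subset hg
        rw [hb] at this
        rw [← this]; ext; simp
      refine mem_image.2 ⟨b, mem_filter.2 ⟨mem_sdiff.2 ⟨(mem_powersetCard.1 (hK hgK)).1 (mem_sdiff.1 hbe).1, ?_⟩, ?_⟩, hgb⟩
      · intro hbe'
        have : b = a := by
          by_contra hba
          exact (mem_sdiff.1 hbe).2 (mem_erase.2 ⟨hba, hbe'⟩)
        apply hge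
        rw [← hgb, this, insert_erase ha]
      · rw [hgb]; exact hgK
    have := (card_le_card this).trans (card_insert_le _ _)
    have := this.trans (Nat.add_le_add_right card_image_le 1)
    exact_mod_cast this
  have hNsum : ((l : ℝ) - 1) * ((n : ℝ) - l) < ∑ a ∈ e, ((N a).card : ℝ) := by
    have := hsum.trans (sum_le_sum hN)
    rw [sum_add_distrib, sum_const, hc e he] at this
    simp at this
    linarith
  have hcomm : ∑ a ∈ e, ((N a).card : ℝ) = ∑ c ∈ X \ e, ((e.filter fun a => insert c (e.erase a) ∈ K).card : ℝ) := by
    simp only [N, card_filter]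
    push_cast
    exact sum_comm
  have hXe : ((X \ e).card : ℝ) = (n : ℝ) - l := by
    rw [card_sdiff_of_subset heX, Nat.cast_sub (card_le_card heX), hX, hc e he]
  have : ∑ c ∈ X \ e, ((l : ℝ) - 1) < ∑ c ∈ X \ e, ((e.filter fun a => insert c (e.erase a) ∈ K).card : ℝ) := by
    rw [← hcomm, sum_const, nsmul_eq_mul, hXe, mul_comm]; exact hNsum
  obtain ⟨c, hcX, hlt⟩ := exists_lt_of_sum_lt this
  have hfull : e.filter (fun a => insert c (e.erase a) ∈ K) = e := by
    apply eq_of_subset_of_card_le (filter_subset _ _)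
    rw [hc e he]
    have : (l : ℝ) < ((e.filter fun a => insert c (e.erase a) ∈ K).card : ℝ) + 1 := by linarith
    have : l < (e.filter fun a => insert c (e.erase a) ∈ K).card + 1 := by exact_mod_cast this
    omega
  have hall : ∀ a ∈ e, insert c (e.erase a) ∈ K := by
    intro a ha; rw [← hfull] at ha; exact (mem_filter.1 ha).2
  have : e.Nonempty := by rw [← card_pos, hc e he]; omega
  obtain ⟨a, ha⟩ := this
  exact ⟨e, he, a, ha, fun b hb => ⟨c, (mem_sdiff.1 hcX).2, hall a ha, hall b hb⟩⟩

theorem exists_fracMatching (K : Finset (Finset A)) (hne : K.Nonempty) (l : ℕ) (hl : 1 ≤ l)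
    (hc : ∀ e ∈ K, e.card = l) (D : ℝ)
    (h : D * ((Finset.shadow K).card : ℝ) ≤ l * (K.card : ℝ)) :
    HasFracMatching K (D / l) := by
  have hlpos : (0 : ℝ) < l := by exact_mod_cast hl
  have hs : 1 ≤ (Finset.shadow K).card := by
    obtain ⟨e, he⟩ := hne
    have : e.Nonempty := by rw [← card_pos, hc e he]; omega
    obtain ⟨a, ha⟩ := this
    exact card_pos.2 ⟨_, erase_mem_shadow he ha⟩
  have hs1 : (1 : ℝ) ≤ (Finset.shadow K).card := by exact_mod_cast hs
  refine ⟨fun _ => 1 / ((Finset.shadow K).card : ℝ), ?_, ?_, ?_⟩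
  · intro e _
    refine ⟨by positivity, ?_⟩
    rw [div_le_one (by linarith)]; exact hs1
  · intro v
    rw [sum_const, nsmul_eq_mul, mul_one_div, div_le_one (by linarith)]
    have : (K.filter fun e => v ∈ e).card ≤ (Finset.shadow K).card := by
      refine card_le_card_of_injOn (fun e => e.erase v) ?_ ?_
      · intro e he
        have he := mem_filter.1 he
        exact erase_mem_shadow he.1 he.2
      · intro e he e' he' hee
        have he := mem_filter.1 he
        have he' := mem_filter.1 he'
        have hee : e.erase v = e'.erase v := hee
        rw [← insert_erase he.2, hee, insert_erase he'.2]
    exact_mod_cast this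
  · rw [sum_const, nsmul_eq_mul, mul_one_div, div_le_div_iff₀ hlpos (by linarith)]
    linarith

theorem mem_link' {S x : Finset A} {E : Finset (Finset A)} (h : x ∈ link S E) :
    Disjoint S x ∧ S ∪ x ∈ E := by
  obtain ⟨e, he, rfl⟩ := mem_image.1 h
  obtain ⟨he, hS⟩ := mem_filter.1 he
  exact ⟨disjoint_sdiff, by rwa [union_sdiff_of_subset hS]⟩

theorem mem_shadow' {j : ℕ} {S : Finset A} {E : Finset (Finset A)} :
    S ∈ _root_.shadow j E ↔ ∃ e ∈ E, S ⊆ e ∧ S.card = j := by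
  simp [_root_.shadow, mem_powersetCard]

theorem ext_count {l : ℕ} (V : Finset A) (F : Finset (Finset A)) (hF : F ⊆ V.powersetCard l) :
    (l : ℝ) * F.card ≤ ∑ Q ∈ V.powersetCard (l - 1),
      (((V \ Q).filter fun a => insert a Q ∈ F).card : ℝ) := by
  have hc : ∀ e ∈ F, e ⊆ V ∧ e.card = l := fun e he => mem_powersetCard.1 (hF he)
  have h1 : (F.sigma fun e => e).card = l * F.card := by
    rw [card_sigma, sum_congr rfl (fun e he => (hc e he).2)]; simp [mul_comm]
  have h2 : (F.sigma fun e => e).card ≤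
      ((V.powersetCard (l - 1)).sigma fun Q => (V \ Q).filter fun a => insert a Q ∈ F).card := by
    refine card_le_card_of_injOn (fun p => ⟨p.1.erase p.2, p.2⟩) ?_ ?_
    · rintro ⟨e, a⟩ h
      have h := mem_sigma.1 h
      have he : e ∈ F := h.1
      have ha : a ∈ e := h.2
      refine mem_sigma.2 ⟨mem_powersetCard.2 ⟨(erase_subset _ _).trans (hc e he).1, ?_⟩, mem_filter.2 ⟨mem_sdiff.2 ⟨(hc e he).1 ha, ?_⟩, ?_⟩⟩
      · show (e.erase a).card = _
        rw [card_erase_of_mem ha, (hc e he).2]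
      · show a ∉ e.erase a
        simp
      · show insert a (e.erase a) ∈ F
        rwa [insert_erase ha]
    · rintro ⟨e, a⟩ h ⟨e', a'⟩ h' hh
      have ha : a ∈ e := (mem_sigma.1 h).2
      have ha' : a' ∈ e' := (mem_sigma.1 h').2
      simp only [Sigma.mk.injEq, heq_eq_eq] at hh
      obtain ⟨hh, rfl⟩ := hh
      have : e = e' := by rw [← insert_erase ha, hh, insert_erase ha']
      rw [this]
  rw [h1, card_sigma] at h2
  exact_mod_cast h2

theorem exists_arc {k d : ℕ} (hd : 1 ≤ d) (hdk : d < k) (V : Finset A) (E : Finset (Finset A))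
    (hE : ∀ e ∈ E, e ⊆ V ∧ e.card = k) (hkV : k ≤ V.card)
    (C : Finset A → Finset (Finset A))
    (hsub : ∀ S ∈ _root_.shadow d E, C S ⊆ link S E) (ν : ℝ) (hν : 0 ≤ ν)
    (hbig : ∀ S ∈ _root_.shadow d E,
      (1 / 2 + ν) * (V.card.choose (k - d) : ℝ) ≤ ((C S).card : ℝ))
    (M U : Finset A) (hMc : M.card = d - 1)
    (hU : U = (V \ M).filter fun u => insert u M ∈ _root_.shadow d E)
    (hU1 : ((V \ M).card : ℝ) < (1 + 2 * ν) * (U.card : ℝ)) (hU3 : 3 ≤ U.card) :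
    HasArc k d E C := by
  obtain ⟨l, hl⟩ : ∃ l, k - d = l := ⟨_, rfl⟩
  rw [hl] at hbig
  have hl1 : 1 ≤ l := by omega
  have hUm : ∀ u ∈ U, u ∈ V ∧ u ∉ M ∧ insert u M ∈ _root_.shadow d E := by
    intro u hu
    rw [hU] at hu
    obtain ⟨h1, h2⟩ := mem_filter.1 hu
    exact ⟨(mem_sdiff.1 h1).1, (mem_sdiff.1 h1).2, h2⟩
  have hUsub : U ⊆ V \ M := by rw [hU]; exact filter_subset _ _
  -- facts about members of C
  have hCm : ∀ u ∈ U, ∀ x ∈ C (insert u M), x ⊆ V ∧ x.card = l ∧ u ∉ x ∧ Disjoint M x := by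
    intro u hu x hx
    obtain ⟨h1, h2⟩ := mem_link' (hsub _ (hUm u hu).2.2 hx)
    have h3 := hE _ h2
    have hMd : (insert u M).card = d := by rw [card_insert_of_notMem (hUm u hu).2.1, hMc]; omega
    refine ⟨subset_union_right.trans h3.1, ?_, ?_, ?_⟩
    · have := h3.2
      rw [card_union_of_disjoint h1, hMd] at this; omega
    · exact Finset.disjoint_left.1 h1 (mem_insert_self _ _)
    · exact h1.mono_left (subset_insert _ _)
  have hCps : ∀ u ∈ U, C (insert u M) ⊆ V.powersetCard l := by
    intro u hu x hx
    have := hCm u hu x hx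
    exact mem_powersetCard.2 ⟨this.1, this.2.1⟩
  let pS : Finset A → A → Finset A := fun Q a => U.filter fun u => insert a Q ∈ C (insert u M)
  let qS : Finset A → A → Finset A := fun Q a =>
    if a ∈ U then (V \ Q).filter fun c => insert c Q ∈ C (insert a M) else ∅
  set P := V.powersetCard (l - 1) with hP
  have hUsum : (U.card : ℝ) * (l * ((1 / 2 + ν) * (V.card.choose l : ℝ)))
      ≤ ∑ u ∈ U, ∑ Q ∈ P, (((V \ Q).filter fun a => insert a Q ∈ C (insert u M)).card : ℝ) := by
    rw [← nsmul_eq_mul, ← sum_const]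
    refine sum_le_sum fun u hu => ?_
    refine le_trans ?_ (ext_count V _ (hCps u hu))
    exact mul_le_mul_of_nonneg_left (hbig _ (hUm u hu).2.2) (by positivity)
  have hpsum : ∑ Q ∈ P, ∑ a ∈ V \ Q, ((pS Q a).card : ℝ)
      = ∑ u ∈ U, ∑ Q ∈ P, (((V \ Q).filter fun a => insert a Q ∈ C (insert u M)).card : ℝ) := by
    rw [sum_comm (s := U)]
    refine sum_congr rfl fun Q _ => ?_
    simp only [pS, card_filter]
    push_cast
    exact sum_comm
  have hqsum : ∑ u ∈ U, ∑ Q ∈ P, (((V \ Q).filter fun a => insert a Q ∈ C (insert u M)).card : ℝ)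
      ≤ ∑ Q ∈ P, ∑ a ∈ V \ Q, ((qS Q a).card : ℝ) := by
    rw [sum_comm]
    refine sum_le_sum fun Q _ => ?_
    have h1 : ∑ u ∈ U, (((V \ Q).filter fun a => insert a Q ∈ C (insert u M)).card : ℝ)
        = ∑ u ∈ U, ((qS Q u).card : ℝ) := by
      refine sum_congr rfl fun u hu => ?_
      simp [qS, hu]
    rw [h1]
    have h2 : ∑ u ∈ U, ((qS Q u).card : ℝ) = ∑ u ∈ U \ Q, ((qS Q u).card : ℝ) := by
      symm
      apply sum_subset sdiff_subset
      intro u hu hu'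
      have huQ : u ∈ Q := by
        by_contra h; exact hu' (mem_sdiff.2 ⟨hu, h⟩)
      have : qS Q u = ∅ := by
        simp only [qS, hu, if_true]
        rw [filter_eq_empty_iff]
        intro c _ hc
        exact (hCm u hu _ hc).2.2.1 (mem_insert_of_mem huQ)
      simp [this]
    rw [h2]
    refine sum_le_sum_of_subset_of_nonneg ?_ (fun _ _ _ => by positivity)
    exact sdiff_subset_sdiff (fun u hu => (hUm u hu).1) le_rfl
  have hcount : ∑ Q ∈ P, ∑ a ∈ V \ Q, (1 : ℝ) = l * (V.card.choose l : ℝ) := by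
    have h1 : ∀ Q ∈ P, ∑ a ∈ V \ Q, (1 : ℝ) = ((V.card - (l - 1) : ℕ) : ℝ) := by
      intro Q hQ
      have := mem_powersetCard.1 hQ
      rw [sum_const, nsmul_eq_mul, mul_one, card_sdiff_of_subset this.1, this.2]
    rw [sum_congr rfl h1, sum_const, nsmul_eq_mul, hP, card_powersetCard]
    obtain ⟨m, rfl⟩ : ∃ m, l = m + 1 := ⟨l - 1, by omega⟩
    have := Nat.choose_succ_right_eq V.card m
    simp only [Nat.add_sub_cancel]
    rw [mul_comm ((m+1 : ℕ) : ℝ)]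
    exact_mod_cast this.symm
  have htot : ∑ Q ∈ P, ∑ a ∈ V \ Q, ((1 + 2 * ν) * (U.card : ℝ))
      ≤ ∑ Q ∈ P, ∑ a ∈ V \ Q, (((pS Q a).card : ℝ) + ((qS Q a).card : ℝ)) := by
    have h1 : ∑ Q ∈ P, ∑ a ∈ V \ Q, ((1 + 2 * ν) * (U.card : ℝ))
        = (1 + 2 * ν) * (U.card : ℝ) * ∑ Q ∈ P, ∑ a ∈ V \ Q, (1 : ℝ) := by
      rw [mul_sum]
      refine sum_congr rfl fun Q _ => ?_
      rw [mul_sum]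
      simp
    rw [h1, hcount]
    simp_rw [sum_add_distrib]
    rw [hpsum]
    have := hUsum.trans hqsum
    nlinarith
  have hlV : l ≤ V.card := by omega
  obtain ⟨Q, hQ, hQle⟩ := exists_le_of_sum_le (powersetCard_nonempty.2 (by omega)) htot
  have hQm := mem_powersetCard.1 hQ
  obtain ⟨a, ha, hale⟩ := exists_le_of_sum_le (by
    rw [← card_pos, card_sdiff_of_subset hQm.1, hQm.2]; omega) hQle
  have hp : ((pS Q a).card : ℝ) ≤ ((V \ M).card : ℝ) := by
    exact_mod_cast card_le_card ((filter_subset _ _).trans hUsub)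
  have hq : ((qS Q a).card : ℝ) ≤ ((V \ M).card : ℝ) := by
    have : qS Q a ⊆ V \ M := by
      intro c hc
      by_cases haU : a ∈ U
      · simp only [qS, haU, if_true] at hc
        obtain ⟨h1, h2⟩ := mem_filter.1 hc
        exact mem_sdiff.2 ⟨(mem_sdiff.1 h1).1,
          fun h => Finset.disjoint_left.1 (hCm a haU _ h2).2.2.2 h (mem_insert_self _ _)⟩
      · simp [qS, haU] at hc
    exact_mod_cast card_le_card this
  have hp0 : (pS Q a).Nonempty := by
    rw [nonempty_iff_ne_empty]; intro h
    rw [h] at hale; simp at hale; linarith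
  have hq0 : (qS Q a).Nonempty := by
    rw [nonempty_iff_ne_empty]; intro h
    rw [h] at hale; simp at hale; linarith
  have h3 : 3 ≤ (pS Q a).card + (qS Q a).card := by
    have : (3 : ℝ) ≤ U.card := by exact_mod_cast hU3
    have : (3 : ℝ) ≤ ((pS Q a).card : ℝ) + ((qS Q a).card : ℝ) := by nlinarith
    exact_mod_cast this
  obtain ⟨u, hu, c, hc, huc⟩ : ∃ u ∈ pS Q a, ∃ c ∈ qS Q a, u ≠ c := by
    by_contra hcon
    push Not at hcon
    obtain ⟨u0, hu0⟩ := hp0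
    obtain ⟨c0, hc0⟩ := hq0
    have h1 : (pS Q a).card ≤ 1 := card_le_one.2 fun x hx y hy => (hcon x hx c0 hc0).trans (hcon y hy c0 hc0).symm
    have h2 : (qS Q a).card ≤ 1 := card_le_one.2 fun x hx y hy => (hcon u0 hu0 x hx).symm.trans (hcon u0 hu0 y hy)
    omega
  obtain ⟨huU, huC⟩ := mem_filter.1 hu
  have haU : a ∈ U := by
    by_contra h
    simp [qS, h] at hc
  simp only [qS, haU, if_true] at hc
  obtain ⟨hcVQ, hcC⟩ := mem_filter.1 hc
  have f1 := hCm u huU _ huC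
  have f2 := hCm a haU _ hcC
  have g1 := hUm u huU
  have g2 := hUm a haU
  have haQ : a ∉ Q := (mem_sdiff.1 ha).2
  have hcQ : c ∉ Q := (mem_sdiff.1 hcVQ).2
  have huaQ : u ≠ a ∧ u ∉ Q := by simpa using f1.2.2.1
  have hac : a ≠ c := by
    have := f2.2.2.1
    simp at this
    exact this.1
  have hMaQ : a ∉ M ∧ Disjoint M Q := by simpa using f1.2.2.2
  have hMcQ : c ∉ M ∧ Disjoint M Q := by simpa using f2.2.2.2
  have hML : M.toList.length = d - 1 := by simp [hMc]
  have hQL : Q.toList.length = l - 1 := by simp [hQm.2]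
  have e1 : u :: (M.toList ++ a :: (Q.toList ++ [c])) = (u :: M.toList) ++ (a :: (Q.toList ++ [c])) := by simp
  have e2 : a :: (Q.toList ++ [c]) = (a :: Q.toList) ++ [c] := by simp
  have e3 : u :: (M.toList ++ a :: (Q.toList ++ [c])) = (u :: (M.toList ++ [a])) ++ (Q.toList ++ [c]) := by simp
  have e4 : M.toList ++ a :: (Q.toList ++ [c]) = (M.toList ++ [a]) ++ (Q.toList ++ [c]) := by simp
  have l1 : d = (u :: M.toList).length := by simp [hMc]; omega
  have l2 : k - d = (a :: Q.toList).length := by simp [hQm.2]; omega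
  have l3 : d + 1 = (u :: (M.toList ++ [a])).length := by simp [hMc]; omega
  have l4 : d = (M.toList ++ [a]).length := by simp [hMc]; omega
  have t1 : (u :: (M.toList ++ a :: (Q.toList ++ [c]))).take d = u :: M.toList := by
    rw [e1]; exact l1 ▸ List.take_left
  have t2 : ((u :: (M.toList ++ a :: (Q.toList ++ [c]))).drop d).take (k - d) = a :: Q.toList := by
    have : (u :: (M.toList ++ a :: (Q.toList ++ [c]))).drop d = a :: (Q.toList ++ [c]) := by
      rw [e1]; exact l1 ▸ List.drop_left
    rw [this, e2, l2]; exact List.take_left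
  have t3 : ((u :: (M.toList ++ a :: (Q.toList ++ [c]))).drop 1).take d = M.toList ++ [a] := by
    rw [List.drop_one, List.tail_cons, e4]; exact l4 ▸ List.take_left
  have t4 : (u :: (M.toList ++ a :: (Q.toList ++ [c]))).drop (d + 1) = Q.toList ++ [c] := by
    rw [e3, l3]; exact List.drop_left
  have s1 : (u :: M.toList).toFinset = insert u M := by simp
  have s2 : (a :: Q.toList).toFinset = insert a Q := by simp
  have s3 : (M.toList ++ [a]).toFinset = insert a M := by ext; simp
  have s4 : (Q.toList ++ [c]).toFinset = insert c Q := by ext; simp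
  refine ⟨u :: (M.toList ++ a :: (Q.toList ++ [c])), ?_, ?_, ?_, ?_, ?_, ?_⟩
  · simp [hMc, hQm.2]; omega
  · simp only [List.nodup_cons, List.nodup_append, List.mem_append, List.mem_cons, mem_toList,
      nodup_toList, List.not_mem_nil, not_or, true_and]
    have hd1 := Finset.disjoint_left.1 hMaQ.2
    refine ⟨⟨g1.2.1, huaQ.1, huaQ.2, huc, by simp⟩, ⟨⟨haQ, hac, by simp⟩, ⟨by simp, ?_⟩⟩, ?_⟩
    · rintro x hx y (rfl | hy)
      · rintro rfl; exact hcQ hx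
      · simp at hy
    · rintro x hx y (rfl | hy | rfl | hy)
      · rintro rfl; exact hMaQ.1 hx
      · rintro rfl; exact hd1 hx hy
      · rintro rfl; exact hMcQ.1 hx
      · simp at hy
  · rw [t1, s1]; exact g1.2.2
  · rw [t2, t1, s1, s2]; exact huC
  · rw [t3, s3]; exact g2.2.2
  · rw [t4, t3, s3, s4]; exact hcC

theorem delta_ge {l : ℕ} (hl : 1 ≤ l) {δ : ℝ} (h0 : 0 < δ) (h : δ ^ l = 1 / 2) :
    (l : ℝ) ≤ (l + 1) * δ := by
  have hl0 : (0 : ℝ) < l := by exact_mod_cast hl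
  by_contra hcon
  push Not at hcon
  have h1 : ((l + 1) * δ) ^ l < (l : ℝ) ^ l :=
    pow_lt_pow_left₀ hcon (by positivity) (by omega)
  rw [mul_pow, h] at h1
  have h2 := one_add_mul_le_pow (a := 1 / (l : ℝ)) (by have : 0 < 1 / (l : ℝ) := by positivity
                                                       linarith) l
  have h3 : (l : ℝ) * (1 / l) = 1 := by field_simp
  rw [h3] at h2
  have h4 : ((l : ℝ) + 1) ^ l = (1 + 1 / (l : ℝ)) ^ l * (l : ℝ) ^ l := by
    rw [← mul_pow]; congr 1; field_simp
  have h5 : (0 : ℝ) < (l : ℝ) ^ l := by positivity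
  rw [h4] at h1
  nlinarith

theorem pow_lower {l : ℕ} (hl : 1 ≤ l) {δ η : ℝ} (h0 : 0 < δ) (h1 : δ ≤ 1) (hη : 0 ≤ η)
    (h : δ ^ l = 1 / 2) : 1 / 2 + η / 2 ≤ (δ + η) ^ l := by
  obtain ⟨m, rfl⟩ : ∃ m, l = m + 1 := ⟨l - 1, by omega⟩
  have hm : (1 : ℝ) / 2 ≤ δ ^ m := by
    rw [← h]; exact pow_le_pow_of_le_one h0.le h1 (by omega)
  have hm2 : δ ^ m ≤ (δ + η) ^ m := pow_le_pow_left₀ h0.le (by linarith) m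
  rw [pow_succ] at h ⊢
  nlinarith

set_option maxHeartbeats 1000000 in
theorem good_S {k d t : ℕ} (hd : 1 ≤ d) (hdk : d < k) {δ μ γ : ℝ} (h0 : 0 < δ)
    (hδ : δ ^ (k - d) = 1 / 2) (hμ : 0 < μ) (hγ0 : 0 < γ) (hγ : γ ≤ μ / (4 * ((k - d : ℕ) : ℝ)))
    (ht : 4 * (k : ℝ) ≤ μ * t) (hkt : k ≤ t) (V : Finset A) (hV : V.card = t)
    (E : Finset (Finset A)) (hE : ∀ e ∈ E, e ⊆ V ∧ e.card = k) (S : Finset A)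
    (hS : S ∈ _root_.shadow d E)
    (hdeg : (δ + μ) * (((V.card - d).choose (k - d) : ℕ) : ℝ)
      ≤ ((E.filter fun e => S ⊆ e).card : ℝ)) :
    δ + μ ≤ 1 ∧ ∃ K ⊆ link S E, TightlyConnected (k - d) K ∧ HasSwitcher K ∧
      HasFracMatching K ((1 / (k : ℝ) + γ) * (t : ℝ)) ∧
      (1 / 2 + μ / 4) * (t.choose (k - d) : ℝ) ≤ (K.card : ℝ) := by
  obtain ⟨l, hl⟩ : ∃ l, k - d = l := ⟨_, rfl⟩
  rw [hl] at hδ hγ hdeg ⊢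
  have hl1 : 1 ≤ l := by omega
  obtain ⟨e0, he0, hSe0, hSc⟩ := mem_shadow'.1 hS
  have hSV : S ⊆ V := hSe0.trans (hE e0 he0).1
  obtain ⟨n, hn⟩ : ∃ n, t - d = n := ⟨_, rfl⟩
  have hX : (V \ S).card = n := by rw [card_sdiff_of_subset hSV]; omega
  have hLX : link S E ⊆ (V \ S).powersetCard l := by
    intro x hx
    obtain ⟨h1, h2⟩ := mem_link' hx
    have h3 := hE _ h2
    rw [card_union_of_disjoint h1] at h3
    refine mem_powersetCard.2 ⟨fun y hy => mem_sdiff.2 ⟨h3.1 (mem_union_right _ hy), fun hyS => Finset.disjoint_left.1 h1 hyS hy⟩, by omega⟩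
  have hLcard : (link S E).card = (E.filter fun e => S ⊆ e).card := by
    apply card_image_of_injOn
    intro e he e' he' hee
    have he := (mem_filter.1 he).2
    have he' := (mem_filter.1 he').2
    have hee : e \ S = e' \ S := hee
    rw [← sdiff_union_of_subset he, hee, sdiff_union_of_subset he']
  rw [← hLcard, hV, hn] at hdeg
  have hln : l ≤ n := by omega
  have hβ1 : δ + μ ≤ 1 := by
    have h1 := card_le_card hLX
    rw [card_powersetCard, hX] at h1
    have h2 : ((link S E).card : ℝ) ≤ (n.choose l : ℝ) := by exact_mod_cast h1
    have h3 : (0 : ℝ) < (n.choose l : ℝ) := by exact_mod_cast Nat.choose_pos hln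
    have h4 := hdeg.trans h2
    by_contra hcon
    push Not at hcon
    nlinarith
  refine ⟨hβ1, ?_⟩
  obtain ⟨K, hKL, hKne, hKt, hKs⟩ := exists_component hl1 hln (V \ S) hX (link S E) hLX (δ + μ)
    (by linarith) hdeg
  have hKX := hKL.trans hLX
  have hKc : ∀ e ∈ K, e.card = l := fun e he => (mem_powersetCard.1 (hKX he)).2
  have hnk : (n : ℝ) - l + 1 = t - k + 1 := by
    have : n + k = t + l := by omega
    have : (n : ℝ) + k = t + l := by exact_mod_cast this
    linarith
  have hn' : (n : ℝ) - l = t - k := by linarith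
  rw [hnk] at hKs
  have hl0 : (1 : ℝ) ≤ l := by exact_mod_cast hl1
  have hk1 : (l : ℝ) + 1 ≤ k := by
    have : l + 1 ≤ k := by omega
    exact_mod_cast this
  have hkt' : (k : ℝ) ≤ t := by exact_mod_cast hkt
  have hδl := delta_ge hl1 h0 hδ
  have hδ2 : 1 / 2 ≤ δ := by nlinarith
  have hD : (δ + μ / 2) * t + l ≤ (δ + μ) * ((t : ℝ) - k + 1) := by nlinarith
  refine ⟨K, hKL, hKt, ?_, ?_, ?_⟩
  · refine exists_switcher hl1 (V \ S) hX K hKX hKne _ hKs ?_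
    rw [hn']
    have h1 : (l : ℝ) - 1 ≤ l * δ := by nlinarith
    have h2 : 1 < μ * ((t : ℝ) - k + 1) := by nlinarith
    have h3 : (0 : ℝ) ≤ t - k := by linarith
    nlinarith
  · obtain ⟨w, hw1, hw2, hw3⟩ := exists_fracMatching K hKne l hl1 hKc _ hKs
    refine ⟨w, hw1, hw2, le_trans ?_ hw3⟩
    rw [le_div_iff₀ (by linarith)]
    refine le_trans ?_ hD
    have hk0 : (0 : ℝ) < k := by linarith
    have h1 : (l : ℝ) * (1 / k) ≤ δ := by
      rw [mul_one_div, div_le_iff₀ hk0]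
      nlinarith
    have h2 : (l : ℝ) * γ ≤ μ / 4 := by
      rw [le_div_iff₀ (by linarith)] at hγ
      linarith
    have ht0 : (0 : ℝ) ≤ t := by positivity
    have h3 : ((l : ℝ) * (1 / k) + l * γ) * t ≤ (δ + μ / 2) * t :=
      mul_le_mul_of_nonneg_right (by linarith) ht0
    linarith
  · have ht0 : (0 : ℝ) ≤ t := by positivity
    have hDn : 0 ≤ (δ + μ) * ((t : ℝ) - k + 1) := by
      apply mul_nonneg <;> linarith
    obtain ⟨m, hm⟩ : ∃ m, ⌊(δ + μ) * ((t : ℝ) - k + 1)⌋₊ = m := ⟨_, rfl⟩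
    have hm1 : (m : ℝ) ≤ (δ + μ) * ((t : ℝ) - k + 1) := hm ▸ Nat.floor_le hDn
    have hm2 : (δ + μ) * ((t : ℝ) - k + 1) < m + 1 := hm ▸ Nat.lt_floor_add_one _
    have ht2 : (2 : ℝ) ≤ t := by linarith
    have hlm : l ≤ m := by
      have h : (1 / 2 : ℝ) * 2 ≤ (δ + μ / 2) * t :=
        mul_le_mul (by linarith) ht2 (by norm_num) (by linarith)
      have : (l : ℝ) < m + 1 := by linarith
      have : l < m + 1 := by exact_mod_cast this
      omega
    have hmn : m ≤ n := by
      have : (m : ℝ) ≤ n := by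
        have : (δ + μ) * ((t : ℝ) - k + 1) ≤ 1 * ((t : ℝ) - k + 1) :=
          mul_le_mul_of_nonneg_right hβ1 (by linarith)
        linarith
      exact_mod_cast this
    have hkk := kk_bound hl1 hlm hmn (V \ S) hX K hKX hKne (by
      have : (m : ℝ) * ((Finset.shadow K).card : ℝ) ≤ l * (K.card : ℝ) :=
        le_trans (mul_le_mul_of_nonneg_right hm1 (by positivity)) hKs
      exact_mod_cast this)
    have hkk' : (m.choose l : ℝ) ≤ K.card := by exact_mod_cast hkk
    refine le_trans ?_ hkk'
    refine le_trans ?_ (Nat.pow_le_choose l m)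
    have hml : ((m + 1 - l : ℕ) : ℝ) = m + 1 - l := by
      rw [Nat.cast_sub (by omega)]; push_cast; ring
    have hlow : (δ + μ / 2) * t ≤ ((m + 1 - l : ℕ) : ℝ) := by rw [hml]; linarith
    have hpow := pow_le_pow_left₀ (by apply mul_nonneg <;> linarith) hlow l
    have hpl := pow_lower hl1 h0 (by linarith) (by linarith : 0 ≤ μ / 2) hδ
    have hup : (t.choose l : ℝ) ≤ (t : ℝ) ^ l / (l.factorial : ℝ) := Nat.choose_le_pow_div l t
    calc (1 / 2 + μ / 4) * (t.choose l : ℝ) ≤ (δ + μ / 2) ^ l * ((t : ℝ) ^ l / (l.factorial : ℝ)) := by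
          apply mul_le_mul (by linarith) hup (by positivity)
          apply pow_nonneg; linarith
      _ = ((δ + μ / 2) * t) ^ l / (l.factorial : ℝ) := by rw [mul_pow]; ring
      _ ≤ _ := by
          apply div_le_div_of_nonneg_right _ (by positivity)
          exact_mod_cast hpow

end helpers

set_option maxHeartbeats 1000000 in
/-- `hv_d(k) ≤ 2^(-1/(k-d))`. -/
theorem vicinity_threshold_general (k d : ℕ) (hk : 2 ≤ k) (hd : 1 ≤ d) (hdk : d ≤ k - 1) :
    HamVicinityProp k d ((2 : ℝ) ^ (-(1 : ℝ) / ((k : ℝ) - (d : ℝ)))) := by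
  have hdk' : d < k := by omega
  obtain ⟨δ, hδdef⟩ : ∃ δ : ℝ, (2 : ℝ) ^ (-(1 : ℝ) / ((k : ℝ) - (d : ℝ))) = δ := ⟨_, rfl⟩
  rw [hδdef]
  have h0 : 0 < δ := hδdef ▸ Real.rpow_pos_of_pos (by norm_num) _
  have hkd : ((k - d : ℕ) : ℝ) = (k : ℝ) - d := Nat.cast_sub hdk'.le
  have hkd1 : (1 : ℝ) ≤ ((k - d : ℕ) : ℝ) := by
    have : 1 ≤ k - d := by omega
    exact_mod_cast this
  have hδ : δ ^ (k - d) = 1 / 2 := by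
    rw [← hδdef, ← Real.rpow_natCast, ← Real.rpow_mul (by norm_num), hkd,
      div_mul_cancel₀ _ (by rw [← hkd]; linarith), Real.rpow_neg_one]
    norm_num
  have hδ2 : 1 / 2 ≤ δ := by
    have := delta_ge (by omega : 1 ≤ k - d) h0 hδ
    nlinarith
  intro μ hμ
  refine ⟨μ / (4 * ((k - d : ℕ) : ℝ)), by positivity, ?_⟩
  intro γ hγ0 hγ
  have hγ4 : γ ≤ μ / 4 := hγ.trans (div_le_div_of_nonneg_left hμ.le (by norm_num) (by linarith))
  refine ⟨μ / 4, by positivity, ?_⟩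
  intro a ha ha'
  refine ⟨max (4 * k) ⌈4 * (k : ℝ) / μ⌉₊, ?_⟩
  intro t ht B _ V E hV hE hdeg hiso
  have hkt4 : 4 * k ≤ t := (le_max_left _ _).trans ht
  have htμ : 4 * (k : ℝ) ≤ μ * t := by
    have h1 : 4 * (k : ℝ) / μ ≤ t := Nat.ceil_le.1 ((le_max_right _ _).trans ht)
    rw [div_le_iff₀ hμ] at h1
    linarith
  have hP1 := (hdeg d hd le_rfl).1
  have hP3 := (hdeg d hd le_rfl).2.2
  have hgood := fun S hS => good_S hd hdk' h0 hδ hμ hγ0 hγ htμ (by omega) V hV E hE S hS (hP1 S hS)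
  obtain ⟨v, hv⟩ : V.Nonempty := by rw [← card_pos]; omega
  obtain ⟨e, he, -⟩ := hiso v hv
  obtain ⟨S0, hS0e, hS0c⟩ := exists_subset_card_eq (s := e) (n := d) (by rw [(hE e he).2]; omega)
  have hS0 : S0 ∈ _root_.shadow d E := mem_shadow'.2 ⟨e, he, hS0e, hS0c⟩
  have hβ1 := (hgood S0 hS0).1
  have hgood2 := fun S hS => (hgood S hS).2
  choose! C hC using hgood2
  obtain ⟨M, hMS, hMc⟩ := exists_subset_card_eq (s := S0) (n := d - 1) (by omega)
  have hMV : M ⊆ V := hMS.trans (hS0e.trans (hE e he).1)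
  have hMsh : M ∈ _root_.shadow (d - 1) E := mem_shadow'.2 ⟨e, he, hMS.trans hS0e, hMc⟩
  have hbad := hP3 M (Or.inl hMsh)
  have hCV : ∀ S ∈ _root_.shadow d E, C S ⊆ V.powersetCard (k - d) := by
    intro S hS x hx
    obtain ⟨h1, h2⟩ := mem_link' ((hC S hS).1 hx)
    have h3 := hE _ h2
    obtain ⟨_, _, _, hSc⟩ := mem_shadow'.1 hS
    rw [card_union_of_disjoint h1] at h3
    exact mem_powersetCard.2 ⟨subset_union_right.trans h3.1, by omega⟩
  have hch : (0 : ℝ) < (t.choose (k - d) : ℝ) := by exact_mod_cast Nat.choose_pos (by omega)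
  refine ⟨C, fun S hS => (hC S hS).1, fun S hS => (hC S hS).2.1, ?_, fun S hS => (hC S hS).2.2.1, ?_,
    fun S hS => by rw [hV]; exact (hC S hS).2.2.2.1, ?_⟩
  · intro S hS S' hS'
    apply inter_nonempty_of_card_lt_card_add_card (hCV S hS) (hCV S' hS')
    rw [card_powersetCard, hV]
    have h1 := (hC S hS).2.2.2.2
    have h2 := (hC S' hS').2.2.2.2
    have : (t.choose (k - d) : ℝ) < ((C S).card : ℝ) + ((C S').card : ℝ) := by nlinarith
    exact_mod_cast this
  · refine exists_arc hd hdk' V E hE (by omega) C (fun S hS => (hC S hS).1) (μ / 4) (by linarith)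
      (fun S hS => by rw [hV]; exact (hC S hS).2.2.2.2) M _ hMc rfl ?_ ?_
    all_goals
      have hsplit := card_filter_add_card_filter_not (s := V \ M)
        (fun u => insert u M ∈ _root_.shadow d E)
      have hle : ((V \ M).filter fun u => ¬ insert u M ∈ _root_.shadow d E).card ≤
          ((V.powersetCard d).filter fun S => M ⊆ S ∧ S ∉ _root_.shadow d E).card := by
        refine card_le_card_of_injOn (fun u => insert u M) ?_ ?_
        · intro u hu
          obtain ⟨h1, h2⟩ := mem_filter.1 hu
          obtain ⟨h3, h4⟩ := mem_sdiff.1 h1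
          refine mem_filter.2 ⟨mem_powersetCard.2 ⟨insert_subset h3 hMV, ?_⟩, subset_insert _ _, h2⟩
          rw [card_insert_of_notMem h4]; omega
        · intro u hu u' hu' huu
          have h1 := (mem_sdiff.1 (mem_filter.1 hu).1).2
          have huu : insert u M = insert u' M := huu
          have : u ∈ insert u' M := huu ▸ mem_insert_self u M
          rcases mem_insert.1 this with h | h
          · exact h
          · exact absurd h h1
      have hle' : (((V \ M).filter fun u => ¬ insert u M ∈ _root_.shadow d E).card : ℝ) ≤
          (((V.powersetCard d).filter fun S => M ⊆ S ∧ S ∉ _root_.shadow d E).card : ℝ) := by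
        exact_mod_cast hle
      have hn0 : ((V \ M).card : ℝ) = (V.card : ℝ) - d + 1 := by
        rw [card_sdiff_of_subset hMV, hMc, Nat.cast_sub (by omega), Nat.cast_sub hd]
        push_cast; ring
      rw [← hn0] at hbad
      have hsplit' : (((V \ M).filter fun u => insert u M ∈ _root_.shadow d E).card : ℝ) +
          (((V \ M).filter fun u => ¬ insert u M ∈ _root_.shadow d E).card : ℝ)
          = ((V \ M).card : ℝ) := by exact_mod_cast hsplit
      have hn6 : (6 : ℝ) ≤ ((V \ M).card : ℝ) := by
        have : 6 ≤ (V \ M).card := by rw [card_sdiff_of_subset hMV, hMc]; omega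
        exact_mod_cast this
      have hlow : (1 - μ / 4) * ((V \ M).card : ℝ) <
          (((V \ M).filter fun u => insert u M ∈ _root_.shadow d E).card : ℝ) := by
        have hx := mul_le_mul_of_nonneg_right ha' (by linarith : (0 : ℝ) ≤ ((V \ M).card : ℝ))
        have hy : (1 - μ / 4) * ((V \ M).card : ℝ) = ((V \ M).card : ℝ) - μ / 4 * ((V \ M).card : ℝ) := by ring
        linarith
    · have h1 : 1 < (1 + 2 * (μ / 4)) * (1 - μ / 4) := by
        clear * - hμ hβ1 hδ2
        nlinarith
      have h2 : (1 + 2 * (μ / 4)) * ((1 - μ / 4) * ((V \ M).card : ℝ)) <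
        (1 + 2 * (μ / 4)) * (((V \ M).filter fun u => insert u M ∈ _root_.shadow d E).card : ℝ) :=
        mul_lt_mul_of_pos_left hlow (by linarith)
      refine lt_trans ?_ h2
      have h3 := mul_lt_mul_of_pos_right h1 (by linarith : (0 : ℝ) < ((V \ M).card : ℝ))
      rw [one_mul, mul_assoc] at h3
      exact h3
    · have : (3 : ℝ) < (((V \ M).filter fun u => insert u M ∈ _root_.shadow d E).card : ℝ) := by
        have hz : (3 / 4 : ℝ) * 6 ≤ (1 - μ / 4) * ((V \ M).card : ℝ) :=
          mul_le_mul (by linarith) hn6 (by norm_num) (by linarith)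
        linarith
      have : 3 < ((V \ M).filter fun u => insert u M ∈ _root_.shadow d E).card := by exact_mod_cast this
      omega
  · intro S hS
    rw [hV]
    refine le_trans ?_ (hC S hS).2.2.2.2
    exact mul_le_mul_of_nonneg_right (by linarith) hch.le
end
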